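/- (Main theorem) Let V_1, …, V_r be irreducible rational representations of SL(n, ℂ). Suppose there exist a positive integer k, a dominant weight ν, and an element γ of the root lattice such that ν + kγ is dominant and both V(ν) and V(ν + kγ) occur as subrepresentations of V_1 ⊗ ⋯ ⊗ V_r. Then for every integer l with 0 ≤ l ≤ k, the irreducible representation V(ν + lγ) occurs in V_1 ⊗ ⋯ ⊗ V_r. -/

import Mathlib

/-!
(Main theorem.)  Let `V₁, …, V_r` be irreducible rational representations of `SL(n, ℂ)`.
Suppose there exist a positive integer `k`, a dominant weight `ν`, and an element `γ` of the root
lattice such that `ν + kγ` is dominant and both `V(ν)` and `V(ν + kγ)` occur in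
`V₁ ⊗ ⋯ ⊗ V_r`.  Then for every `0 ≤ l ≤ k`, the irreducible representation `V(ν + lγ)`
occurs in `V₁ ⊗ ⋯ ⊗ V_r`.

Weights of the diagonal maximal torus of `SL(n)` are written as vectors `a ∈ ℤⁿ`
(the character `diag d ↦ ∏ dᵢ^{aᵢ}`); the root lattice consists of the vectors whose
coordinates sum to zero.  `Occurs ρ a` says `ρ` contains a highest weight vector of weight `a`,
i.e. `V(a)` occurs in `ρ`.
-/

open scoped TensorProduct
abbrev SL (n : ℕ) := Matrix.SpecialLinearGroup (Fin n) ℂ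

section Defs

variable {n : ℕ} {V W : Type*} [AddCommGroup V] [Module ℂ V] [AddCommGroup W] [Module ℂ W]

/-- A matrix in `SL(n)` lying in the standard maximal torus (diagonal matrices). -/
def SLIsDiag (g : SL n) : Prop := ∀ i j, i ≠ j → g.val i j = 0

/-- A matrix in `SL(n)` lying in the unipotent radical of the standard Borel
(upper triangular, 1's on the diagonal). -/
def SLIsUniUpper (g : SL n) : Prop :=
  (∀ i, g.val i i = 1) ∧ ∀ i j : Fin n, j < i → g.val i j = 0

/-- `v` is a highest weight vector of weight `a` (a character of the diagonal torus,
`diag d ↦ ∏ dᵢ^{aᵢ}`): it is nonzero, fixed by the unipotent radical of the Borel, and the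
torus acts on it through the character `a`. -/
def IsHWVector (ρ : Representation ℂ (SL n) V) (a : Fin n → ℤ) (v : V) : Prop :=
  v ≠ 0 ∧ (∀ g, SLIsUniUpper g → ρ g v = v) ∧
    ∀ g, SLIsDiag g → ρ g v = (∏ i, g.val i i ^ a i) • v

/-- The irreducible representation `V(a)` of highest weight `a` occurs in `ρ`:
equivalently (for completely reducible `ρ`), `ρ` has a highest weight vector of weight `a`. -/
def Occurs (ρ : Representation ℂ (SL n) V) (a : Fin n → ℤ) : Prop := ∃ v, IsHWVector ρ a v

/-- `ρ` is irreducible: `V ≠ 0` and the only invariant subspaces are `⊥` and `⊤`. -/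
def RepIsIrreducible (ρ : Representation ℂ (SL n) V) : Prop :=
  (∃ v : V, v ≠ 0) ∧ ∀ p : Submodule ℂ V, (∀ g, ∀ x ∈ p, ρ g x ∈ p) → p = ⊥ ∨ p = ⊤

/-- The space of invariants `V^G` is nonzero. -/
def HasInvariant (ρ : Representation ℂ (SL n) V) : Prop := ∃ v : V, v ≠ 0 ∧ ∀ g, ρ g v = v

/-- Dominance of the weight `a` (for the standard choice of positive roots). -/
def SLDominant (a : Fin n → ℤ) : Prop := ∀ i j : Fin n, i ≤ j → a j ≤ a i

/-- The tensor product of a finite family of representations of `SL(n)`,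
with the diagonal action. -/
noncomputable def piTensorRep {r : ℕ} {V : Fin r → Type*} [∀ i, AddCommGroup (V i)]
    [∀ i, Module ℂ (V i)] (ρ : ∀ i, Representation ℂ (SL n) (V i)) :
    Representation ℂ (SL n) (⨂[ℂ] i, V i) where
  toFun g := PiTensorProduct.map fun i => ρ i g
  map_one' := by simp
  map_mul' g h := by
    simpa using PiTensorProduct.map_mul (fun i => ρ i g) (fun i => ρ i h)

/-- The tensor product of two representations of `SL(n)` with the diagonal action. -/
noncomputable def tensorRep2 (ρ : Representation ℂ (SL n) V) (σ : Representation ℂ (SL n) W) :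
    Representation ℂ (SL n) (V ⊗[ℂ] W) := ρ.tprod σ

end Defs

open Polynomial

section PolyCurves
variable {M N X Y : Type*} [AddCommGroup M] [Module ℂ M] [AddCommGroup N] [Module ℂ N]
  [AddCommGroup X] [Module ℂ X] [AddCommGroup Y] [Module ℂ Y]

/-- A curve in a complex vector space is polynomial if all its coordinates are. -/
def PolyCurve (ψ : ℂ → M) : Prop :=
  ∀ f : M →ₗ[ℂ] ℂ, ∃ q : ℂ[X], ∀ t, f (ψ t) = q.eval t

lemma PolyCurve.map {ψ : ℂ → M} (h : PolyCurve ψ) (L : M →ₗ[ℂ] N) :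
    PolyCurve fun t => L (ψ t) := fun f => h (f ∘ₗ L)

lemma PolyCurve.const (x : M) : PolyCurve fun _ => x := fun f => ⟨C (f x), by simp⟩

lemma PolyCurve.add {ψ φ : ℂ → M} (h : PolyCurve ψ) (h' : PolyCurve φ) :
    PolyCurve fun t => ψ t + φ t := by
  intro f
  obtain ⟨p, hp⟩ := h f
  obtain ⟨q, hq⟩ := h' f
  exact ⟨p + q, fun t => by simp [hp, hq]⟩

lemma PolyCurve.smul {ψ : ℂ → M} (h : PolyCurve ψ) (q : ℂ[X]) :
    PolyCurve fun t => q.eval t • ψ t := by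
  intro f
  obtain ⟨p, hp⟩ := h f
  exact ⟨q * p, fun t => by simp [hp]⟩

lemma PolyCurve.line (x y : M) : PolyCurve fun t : ℂ => x + t • y := by
  simpa using (PolyCurve.const x).add ((PolyCurve.const y).smul X)

lemma PolyCurve.pi {ι : Type*} [Fintype ι] {ψ : ℂ → ι → ℂ}
    (h : ∀ i, ∃ q : ℂ[X], ∀ t, ψ t i = q.eval t) : PolyCurve ψ := by
  classical
  intro f
  choose q hq using h
  refine ⟨∑ i, C (f (Pi.single i 1)) * q i, fun t => ?_⟩
  rw [LinearMap.pi_apply_eq_sum_univ f]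
  simp only [eval_finsetSum, eval_mul, eval_C, hq]
  refine Finset.sum_congr rfl fun i _ => ?_
  rw [smul_eq_mul, mul_comm]
  congr 2
  ext j
  simp [Pi.single_apply, eq_comm]

lemma exists_poly_det {ι : Type*} [Fintype ι] [DecidableEq ι] (A : ℂ → Matrix ι ι ℂ)
    (h : ∀ i j, ∃ q : ℂ[X], ∀ t, A t i j = q.eval t) :
    ∃ q : ℂ[X], ∀ t, (A t).det = q.eval t := by
  choose q hq using h
  refine ⟨(Matrix.of q).det, fun t => ?_⟩
  rw [← Polynomial.coe_evalRingHom, RingHom.map_det]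
  congr 1
  ext i j
  simp [hq]

lemma exists_section [FiniteDimensional ℂ X] [FiniteDimensional ℂ Y] (φ : X →ₗ[ℂ] Y) (r : ℕ)
    (hr : Module.finrank ℂ (LinearMap.range φ) = r) :
    ∃ (i : (Fin r → ℂ) →ₗ[ℂ] X) (p : Y →ₗ[ℂ] (Fin r → ℂ)), p ∘ₗ φ ∘ₗ i = LinearMap.id := by
  obtain ⟨e⟩ : Nonempty (LinearMap.range φ ≃ₗ[ℂ] (Fin r → ℂ)) :=
    FiniteDimensional.nonempty_linearEquiv_of_finrank_eq (by simpa using hr)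
  obtain ⟨p, hp⟩ := LinearMap.exists_extend (e : LinearMap.range φ →ₗ[ℂ] (Fin r → ℂ))
  obtain ⟨i, hi⟩ := LinearMap.exists_rightInverse_of_surjective φ.rangeRestrict
    (LinearMap.range_rangeRestrict φ)
  refine ⟨i ∘ₗ (e.symm : (Fin r → ℂ) →ₗ[ℂ] LinearMap.range φ), p, ?_⟩
  ext1 j
  ext1
  have h1 : φ (i (e.symm (Pi.single j 1))) = (e.symm (Pi.single j 1) : LinearMap.range φ) := by
    have := congrArg Subtype.val (LinearMap.congr_fun hi (e.symm (Pi.single j 1)))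
    simpa using this
  have h2 := LinearMap.congr_fun hp (e.symm (Pi.single j 1))
  simp only [LinearMap.comp_apply, LinearMap.single_apply, LinearEquiv.coe_coe, h1] 
  simp only [LinearMap.comp_apply, Submodule.subtype_apply, LinearEquiv.coe_coe,
    LinearEquiv.apply_symm_apply] at h2
  simpa using h2

lemma le_finrank_range_of_det_ne_zero [FiniteDimensional ℂ X] [FiniteDimensional ℂ Y] {r : ℕ}
    (φ : X →ₗ[ℂ] Y) (i : (Fin r → ℂ) →ₗ[ℂ] X) (p : Y →ₗ[ℂ] (Fin r → ℂ))
    (h : (LinearMap.toMatrix' (p ∘ₗ φ ∘ₗ i)).det ≠ 0) :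
    r ≤ Module.finrank ℂ (LinearMap.range φ) := by
  have h1 : Function.Surjective (p ∘ₗ φ ∘ₗ i) := by
    have := (LinearMap.isUnit_iff_range_eq_top (p ∘ₗ φ ∘ₗ i)).1 (by
      rw [← LinearMap.isUnit_toMatrix'_iff, Matrix.isUnit_iff_isUnit_det]
      exact isUnit_iff_ne_zero.2 h)
    exact LinearMap.range_eq_top.1 this
  have h2 : Function.Surjective (p ∘ₗ (LinearMap.range φ).subtype) := by
    intro y
    obtain ⟨x, hx⟩ := h1 y
    exact ⟨⟨φ (i x), ⟨_, rfl⟩⟩, hx⟩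
  simpa using LinearMap.finrank_le_finrank_of_surjective h2

/-- Lower semicontinuity of the rank along a polynomial curve of linear maps. -/
lemma PolyCurve.exists_rank_le [FiniteDimensional ℂ X] [FiniteDimensional ℂ Y]
    {ψ : ℂ → X →ₗ[ℂ] Y} (h : PolyCurve ψ) (t₀ : ℂ) :
    ∃ q : ℂ[X], q.eval t₀ ≠ 0 ∧ ∀ t, q.eval t ≠ 0 →
      Module.finrank ℂ (LinearMap.range (ψ t₀)) ≤ Module.finrank ℂ (LinearMap.range (ψ t)) := by
  obtain ⟨i, p, hip⟩ := exists_section (ψ t₀) _ rfl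
  obtain ⟨q, hq⟩ := exists_poly_det (fun t => LinearMap.toMatrix' (p ∘ₗ ψ t ∘ₗ i)) (by
    intro a b
    refine h ⟨⟨fun φ => LinearMap.toMatrix' (p ∘ₗ φ ∘ₗ i) a b, ?_⟩, ?_⟩
    · intro x y; simp [LinearMap.toMatrix'_apply]
    · intro c x; simp [LinearMap.toMatrix'_apply])
  refine ⟨q, ?_, fun t ht => le_finrank_range_of_det_ne_zero (ψ t) i p (by rwa [hq])⟩
  rw [← hq]
  simp [hip]

/-- If the rank of `D₀ + t D₁` is maximal at `t = 0`, then kernel vectors of `D₀` extend to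
polynomial families of kernel vectors. -/
lemma exists_kernel_curve [FiniteDimensional ℂ M] [FiniteDimensional ℂ N] (D₀ D₁ : M →ₗ[ℂ] N)
    (hr : ∀ t : ℂ, Module.finrank ℂ (LinearMap.range (D₀ + t • D₁)) ≤
      Module.finrank ℂ (LinearMap.range D₀)) (φ : M) (hφ : D₀ φ = 0) :
    ∃ (χ : ℂ → M) (δ : ℂ[X]), PolyCurve χ ∧ δ.eval 0 ≠ 0 ∧
      (∀ t, δ.eval t ≠ 0 → (D₀ + t • D₁) (φ + t • χ t) = 0) := by
  obtain ⟨r, hrdef⟩ : ∃ r, Module.finrank ℂ (LinearMap.range D₀) = r := ⟨_, rfl⟩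
  rw [hrdef] at hr
  obtain ⟨i, p, hip⟩ := exists_section D₀ r hrdef
  set B : Matrix (Fin r) (Fin r) ℂ := LinearMap.toMatrix' (p ∘ₗ D₁ ∘ₗ i) with hB
  set Bt : Matrix (Fin r) (Fin r) ℂ[X] := 1 + (X : ℂ[X]) • B.map C with hBt
  have hBte : ∀ t : ℂ, (evalRingHom t).mapMatrix Bt = 1 + t • B := by
    intro t
    ext a b
    simp [hBt, Matrix.one_apply, apply_ite]
    ring
  have hBte' : ∀ t : ℂ, (1 + t • B) = LinearMap.toMatrix' (p ∘ₗ (D₀ + t • D₁) ∘ₗ i) := by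
    intro t
    rw [LinearMap.add_comp, LinearMap.comp_add, hip, LinearMap.smul_comp, LinearMap.comp_smul]
    simp [hB]
  set δ := Bt.det with hδ
  have hδe : ∀ t : ℂ, δ.eval t = (1 + t • B).det := by
    intro t
    rw [hδ, ← coe_evalRingHom, RingHom.map_det, hBte]
  have hδ0 : δ.eval 0 = 1 := by rw [hδe]; simp
  obtain ⟨δ', hδ'⟩ : X ∣ δ - 1 := by
    rw [X_dvd_iff, coeff_zero_eq_eval_zero]; simp [hδ0]
  set w : Fin r → ℂ := p (D₁ φ) with hw
  refine ⟨fun t => δ'.eval t • φ + -(i ((1 + t • B).adjugate.mulVec w)), δ, ?_, by simp [hδ0], ?_⟩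
  · refine ((PolyCurve.const φ).smul δ').add ?_
    have : PolyCurve (fun t : ℂ => (1 + t • B).adjugate.mulVec w) := by
      refine PolyCurve.pi fun a => ⟨∑ b, Bt.adjugate a b * C (w b), fun t => ?_⟩
      rw [Matrix.mulVec, dotProduct, eval_finsetSum]
      refine Finset.sum_congr rfl fun b _ => ?_
      rw [← hBte, ← RingHom.map_adjugate]
      simp
    exact this.map (-i)
  · intro t ht
    have hdet : (LinearMap.toMatrix' (p ∘ₗ (D₀ + t • D₁) ∘ₗ i)).det ≠ 0 := by
      rw [← hBte', ← hδe]; exact ht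
    have key : p ((D₀ + t • D₁) (φ + t • (δ'.eval t • φ + -(i ((1 + t • B).adjugate.mulVec w)))))
        = 0 := by
      have e1 : φ + t • (δ'.eval t • φ + -(i ((1 + t • B).adjugate.mulVec w)))
          = δ.eval t • φ - t • i ((1 + t • B).adjugate.mulVec w) := by
        have : δ = 1 + X * δ' := by rw [← hδ']; ring
        rw [this]
        simp only [eval_add, eval_one, eval_mul, eval_X]
        module
      have e2 : p ((D₀ + t • D₁) (i ((1 + t • B).adjugate.mulVec w))) = δ.eval t • w := by
        have : p ((D₀ + t • D₁) (i ((1 + t • B).adjugate.mulVec w))) =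
            (LinearMap.toMatrix' (p ∘ₗ (D₀ + t • D₁) ∘ₗ i)).mulVec
              ((1 + t • B).adjugate.mulVec w) := by
          rw [LinearMap.toMatrix'_mulVec]; rfl
        rw [this, ← hBte', Matrix.mulVec_mulVec, Matrix.mul_adjugate, hδe]
        simp [Matrix.smul_mulVec]
      rw [e1, map_sub, map_sub, map_smul, map_smul, map_smul, map_smul, e2]
      simp only [LinearMap.add_apply, LinearMap.smul_apply, hφ, zero_add, map_smul]
      rw [← hw, smul_comm, sub_self]
    set D := D₀ + t • D₁ with hD
    have h1 : Function.Surjective (p ∘ₗ (LinearMap.range D).subtype) := by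
      have hu : Function.Surjective (p ∘ₗ D ∘ₗ i) := by
        have := (LinearMap.isUnit_iff_range_eq_top (p ∘ₗ D ∘ₗ i)).1 (by
          rw [← LinearMap.isUnit_toMatrix'_iff, Matrix.isUnit_iff_isUnit_det]
          exact isUnit_iff_ne_zero.2 hdet)
        exact LinearMap.range_eq_top.1 this
      intro y
      obtain ⟨x, hx⟩ := hu y
      exact ⟨⟨D (i x), ⟨_, rfl⟩⟩, hx⟩
    have h2 : Function.Injective (p ∘ₗ (LinearMap.range D).subtype) := by
      refine (LinearMap.injective_iff_surjective_of_finrank_eq_finrank ?_).2 h1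
      refine le_antisymm ?_ (LinearMap.finrank_le_finrank_of_surjective h1)
      simpa using hr t
    have := @h2 ⟨D (φ + t • (δ'.eval t • φ + -(i ((1 + t • B).adjugate.mulVec w)))), ⟨_, rfl⟩⟩ 0
      (by simpa using key)
    simpa using congrArg Subtype.val this
end PolyCurves

section PseudoInverse
variable {X Y : Type*} [AddCommGroup X] [Module ℂ X] [AddCommGroup Y] [Module ℂ Y]

lemma exists_pseudoinverse (φ : X →ₗ[ℂ] Y) : ∃ σ : Y →ₗ[ℂ] X, ∀ x, φ (σ (φ x)) = φ x := by
  obtain ⟨i, hi⟩ := LinearMap.exists_rightInverse_of_surjective φ.rangeRestrict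
    (LinearMap.range_rangeRestrict φ)
  obtain ⟨σ, hσ⟩ := LinearMap.exists_extend i
  refine ⟨σ, fun x => ?_⟩
  have h1 := LinearMap.congr_fun hσ ⟨φ x, ⟨x, rfl⟩⟩
  have h2 := congrArg Subtype.val (LinearMap.congr_fun hi ⟨φ x, ⟨x, rfl⟩⟩)
  simp only [LinearMap.comp_apply, Submodule.subtype_apply] at h1
  rw [h1]
  simpa using h2

lemma PolyCurve.exists_rank_lt [FiniteDimensional ℂ X] [FiniteDimensional ℂ Y]
    {φ : X →ₗ[ℂ] Y} {χ : ℂ → X →ₗ[ℂ] Y} (h : PolyCurve χ) (k : X) (hk : φ k = 0)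
    (hχ : χ 0 k ∉ LinearMap.range φ) :
    ∃ q : ℂ[X], q.eval 0 ≠ 0 ∧ ∀ t, t ≠ 0 → q.eval t ≠ 0 →
      Module.finrank ℂ (LinearMap.range φ) < Module.finrank ℂ (LinearMap.range (φ + t • χ t)) := by
  obtain ⟨r, hr⟩ : ∃ r, Module.finrank ℂ (LinearMap.range φ) = r := ⟨_, rfl⟩
  obtain ⟨i, p, hip⟩ := exists_section φ r hr
  set ψ : ℂ → ((Fin r → ℂ) × ℂ →ₗ[ℂ] Y) := fun t =>
    ((φ ∘ₗ i) ∘ₗ LinearMap.fst ℂ _ _) + (t • ((χ t ∘ₗ i) ∘ₗ LinearMap.fst ℂ _ _) +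
      (χ t ∘ₗ (LinearMap.toSpanSingleton ℂ X k)) ∘ₗ LinearMap.snd ℂ _ _) with hψ
  have hP : PolyCurve ψ := by
    refine (PolyCurve.const _).add (PolyCurve.add ?_ ?_)
    · have := (h.smul Polynomial.X).map (LinearMap.lcomp ℂ Y (i ∘ₗ LinearMap.fst ℂ (Fin r → ℂ) ℂ))
      simp only [eval_X] at this
      exact this
    · exact h.map (LinearMap.lcomp ℂ Y ((LinearMap.toSpanSingleton ℂ X k) ∘ₗ
        LinearMap.snd ℂ (Fin r → ℂ) ℂ))
  obtain ⟨q, hq0, hq⟩ := hP.exists_rank_le 0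
  refine ⟨q, hq0, fun t ht hqt => ?_⟩
  have h1 : Module.finrank ℂ (LinearMap.range (ψ 0)) = r + 1 := by
    rw [LinearMap.finrank_range_of_inj]
    · simp
    · rw [← LinearMap.ker_eq_bot, LinearMap.ker_eq_bot']
      rintro ⟨y, c⟩ hy
      simp only [hψ, LinearMap.add_apply, LinearMap.comp_apply, LinearMap.fst_apply, zero_smul,
        LinearMap.snd_apply, LinearMap.toSpanSingleton_apply, map_smul, zero_add] at hy
      have hc : c = 0 := by
        by_contra hc
        apply hχ
        refine ⟨-(c⁻¹ • i y), ?_⟩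
        rw [map_neg, map_smul, eq_neg_of_add_eq_zero_left hy, smul_neg, neg_neg, smul_smul,
          inv_mul_cancel₀ hc, one_smul]
      rw [hc, zero_smul, add_zero] at hy
      have := LinearMap.congr_fun hip y
      simp only [LinearMap.comp_apply, hy, map_zero, LinearMap.id_apply] at this
      simp [hc, ← this]
  have h2 : LinearMap.range (ψ t) ≤ LinearMap.range (φ + t • χ t) := by
    rintro _ ⟨⟨y, c⟩, rfl⟩
    refine ⟨i y + (c * t⁻¹) • k, ?_⟩
    simp only [hψ, LinearMap.add_apply, LinearMap.comp_apply, LinearMap.fst_apply, 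
        LinearMap.snd_apply, LinearMap.toSpanSingleton_apply, map_smul, LinearMap.smul_apply,
        map_add, hk, zero_add, smul_smul]
    rw [mul_assoc, inv_mul_cancel₀ ht, mul_one, add_assoc]
  have h3 := hq t hqt
  have h4 := Submodule.finrank_mono h2
  omega
end PseudoInverse

section Quiver
variable {Q0 Q1 : Type} {s t : Q1 → Q0}

variable (s t) in
/-- Representations of the quiver with arrows `a : s a ⟶ t a` on given vector spaces. -/
abbrev QuiverRep (X : Q0 → Type*) [∀ v, AddCommGroup (X v)] [∀ v, Module ℂ (X v)] :=
  ∀ a, X (s a) →ₗ[ℂ] X (t a)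

/-- The differential `φ ↦ (F_a φ_{s a} - φ_{t a} A_a)_a` attached to two quiver representations. -/
def quiverD {X Y : Q0 → Type*} [∀ v, AddCommGroup (X v)] [∀ v, Module ℂ (X v)]
    [∀ v, AddCommGroup (Y v)] [∀ v, Module ℂ (Y v)]
    (A : QuiverRep s t X) (F : QuiverRep s t Y) :
    (∀ v, X v →ₗ[ℂ] Y v) →ₗ[ℂ] (∀ a, X (s a) →ₗ[ℂ] Y (t a)) where
  toFun φ a := F a ∘ₗ φ (s a) - φ (t a) ∘ₗ A a
  map_add' φ ψ := by
    ext a x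
    simp
    abel
  map_smul' c φ := by
    ext a x
    simp [smul_sub]

variable (s t) in
/-- The Euler form of a quiver. -/
def quiverEuler [Fintype Q0] [Fintype Q1] (α β : Q0 → ℤ) : ℤ :=
  ∑ v, α v * β v - ∑ a, α (s a) * β (t a)

variable (s t) in
/-- Every representation of dimension vector `β` has a subrepresentation of dimension
vector `ρ`. -/
def IsUnivSub (β ρ : Q0 → ℕ) : Prop :=
  ∀ F : QuiverRep s t fun v => Fin (β v) → ℂ,
    ∃ S : ∀ v, Submodule ℂ (Fin (β v) → ℂ), (∀ v, Module.finrank ℂ (S v) = ρ v) ∧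
      ∀ a, ∀ x ∈ S (s a), F a x ∈ S (t a)

lemma IsUnivSub.transport {β ρ : Q0 → ℕ} (h : IsUnivSub s t β ρ) {X : Q0 → Type*}
    [∀ v, AddCommGroup (X v)] [∀ v, Module ℂ (X v)] [∀ v, FiniteDimensional ℂ (X v)]
    (hX : ∀ v, Module.finrank ℂ (X v) = β v) (F : QuiverRep s t X) :
    ∃ S : ∀ v, Submodule ℂ (X v), (∀ v, Module.finrank ℂ (S v) = ρ v) ∧
      ∀ a, ∀ x ∈ S (s a), F a x ∈ S (t a) := by
  have e : ∀ v, Nonempty (X v ≃ₗ[ℂ] (Fin (β v) → ℂ)) := fun v =>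
    FiniteDimensional.nonempty_linearEquiv_of_finrank_eq (by simpa using hX v)
  let e' := fun v => (e v).some
  obtain ⟨S, hS, hF⟩ := h fun a => (e' (t a)).toLinearMap ∘ₗ F a ∘ₗ (e' (s a)).symm.toLinearMap
  refine ⟨fun v => (S v).map (e' v).symm.toLinearMap, fun v => ?_, ?_⟩
  · rw [← hS v]
    exact LinearEquiv.finrank_map_eq (e' v).symm (S v)
  · rintro a _ ⟨x, hx, rfl⟩
    exact ⟨_, hF a x hx, by simp⟩

lemma quiverD_add_smul {X Y : Q0 → Type*} [∀ v, AddCommGroup (X v)] [∀ v, Module ℂ (X v)]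
    [∀ v, AddCommGroup (Y v)] [∀ v, Module ℂ (Y v)]
    (A A' : QuiverRep s t X) (F F' : QuiverRep s t Y) (c : ℂ) :
    quiverD (A + c • A') (F + c • F') = quiverD A F + c • quiverD A' F' := by
  ext φ a x
  simp only [quiverD, LinearMap.coe_mk, AddHom.coe_mk, LinearMap.add_apply, LinearMap.smul_apply,
    Pi.add_apply, Pi.smul_apply, LinearMap.sub_apply, LinearMap.comp_apply, map_add, map_smul,
    smul_sub]
  abel_nf

lemma finrank_quiverD_dom [Fintype Q0] {X Y : Q0 → Type*} [∀ v, AddCommGroup (X v)]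
    [∀ v, Module ℂ (X v)] [∀ v, AddCommGroup (Y v)] [∀ v, Module ℂ (Y v)]
    [∀ v, FiniteDimensional ℂ (X v)] [∀ v, FiniteDimensional ℂ (Y v)] :
    Module.finrank ℂ (∀ v, X v →ₗ[ℂ] Y v) =
      ∑ v, Module.finrank ℂ (X v) * Module.finrank ℂ (Y v) := by
  rw [Module.finrank_pi_fintype]
  exact Finset.sum_congr rfl fun v _ => Module.finrank_linearMap _ _ _ _

lemma finrank_quiverD_cod [Fintype Q1] {X Y : Q0 → Type*} [∀ v, AddCommGroup (X v)]
    [∀ v, Module ℂ (X v)] [∀ v, AddCommGroup (Y v)] [∀ v, Module ℂ (Y v)]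
    [∀ v, FiniteDimensional ℂ (X v)] [∀ v, FiniteDimensional ℂ (Y v)] :
    Module.finrank ℂ (∀ a, X (s a) →ₗ[ℂ] Y (t a)) =
      ∑ a, Module.finrank ℂ (X (s a)) * Module.finrank ℂ (Y (t a)) := by
  rw [Module.finrank_pi_fintype]
  exact Finset.sum_congr rfl fun v _ => Module.finrank_linearMap _ _ _ _

end Quiver

section Frames

lemma exists_frame {m r : ℕ} (S : Submodule ℂ (Fin m → ℂ)) (hS : Module.finrank ℂ S = r) :
    ∃ W : Matrix (Fin m) (Fin r) ℂ, W.conjTranspose * W = 1 ∧ LinearMap.range W.mulVecLin = S := by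
  set e := (WithLp.linearEquiv 2 ℂ (Fin m → ℂ)) with he
  set S' : Submodule ℂ (EuclideanSpace ℂ (Fin m)) := S.map e.symm.toLinearMap with hS'
  have hr : Module.finrank ℂ S' = r := by
    rw [← hS]; exact LinearEquiv.finrank_map_eq e.symm S
  set b := (stdOrthonormalBasis ℂ S').reindex (finCongr hr) with hb
  set W : Matrix (Fin m) (Fin r) ℂ := Matrix.of fun i j => (b j : EuclideanSpace ℂ (Fin m)) i
    with hW
  have h1 : W.conjTranspose * W = 1 := by
    ext i j
    have := b.inner_eq_ite i j
    rw [Submodule.coe_inner, EuclideanSpace.inner_eq_star_dotProduct] at this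
    rw [Matrix.one_apply, ← this, Matrix.mul_apply, dotProduct]
    refine Finset.sum_congr rfl fun k _ => ?_
    simp [hW, mul_comm]
  refine ⟨W, h1, ?_⟩
  have hle : LinearMap.range W.mulVecLin ≤ S := by
    rintro _ ⟨y, rfl⟩
    have : W.mulVecLin y = ∑ j, y j • e (b j : EuclideanSpace ℂ (Fin m)) := by
      ext i
      simp [hW, Matrix.mulVec, dotProduct, he, mul_comm]
    rw [this]
    refine Submodule.sum_mem _ fun j _ => Submodule.smul_mem _ _ ?_
    obtain ⟨x, hx, hxe⟩ := (b j).2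
    rw [← hxe]
    simpa using hx
  refine Submodule.eq_of_le_of_finrank_eq hle ?_
  rw [LinearMap.finrank_range_of_inj, hS]
  · simp
  · intro x y hxy
    have := congrArg W.conjTranspose.mulVec hxy
    simpa [Matrix.mulVec_mulVec, h1] using this

lemma mem_range_frame {m r : ℕ} {W : Matrix (Fin m) (Fin r) ℂ} (hW : W.conjTranspose * W = 1)
    (x : Fin m → ℂ) : x ∈ LinearMap.range W.mulVecLin ↔ W.mulVec (W.conjTranspose.mulVec x) = x :=
        by
  constructor
  · rintro ⟨y, rfl⟩
    simp only [Matrix.mulVecLin_apply]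
    rw [Matrix.mulVec_mulVec y, hW, Matrix.one_mulVec]
  · intro h
    exact ⟨_, h⟩

lemma finrank_range_frame {m r : ℕ} {W : Matrix (Fin m) (Fin r) ℂ}
    (hW : W.conjTranspose * W = 1) : Module.finrank ℂ (LinearMap.range W.mulVecLin) = r := by
  rw [LinearMap.finrank_range_of_inj]
  · simp
  · intro x y hxy
    have := congrArg W.conjTranspose.mulVec hxy
    simpa [Matrix.mulVec_mulVec, hW] using this

lemma isCompact_frames {Q0 : Type} (β ρ : Q0 → ℕ) :
    IsCompact {W : ∀ v, Matrix (Fin (β v)) (Fin (ρ v)) ℂ | ∀ v, (W v).conjTranspose * W v = 1} := by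
  have hc : IsCompact (Set.univ.pi fun v : Q0 => (Set.univ.pi fun _ : Fin (β v) =>
      (Set.univ.pi fun _ : Fin (ρ v) => Metric.closedBall (0 : ℂ) 1))) :=
    isCompact_univ_pi fun v => isCompact_univ_pi fun _ => isCompact_univ_pi fun _ =>
      isCompact_closedBall 0 1
  refine hc.of_isClosed_subset ?_ ?_
  · rw [Set.ofPred_forall]
    refine isClosed_iInter fun v => isClosed_eq ?_ continuous_const
    have : Continuous fun W : (∀ v, Matrix (Fin (β v)) (Fin (ρ v)) ℂ) => W v := continuous_apply v
    exact this.matrix_conjTranspose.matrix_mul this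
  · intro W hW v _ i _ j _
    have h1 : (Matrix.conjTranspose (W v) * (show Matrix (Fin (β v)) (Fin (ρ v)) ℂ from W v)) j j =
        (1 : Matrix (Fin (ρ v)) (Fin (ρ v)) ℂ) j j :=
      congrFun (congrFun (hW v) j) j
    rw [Matrix.mul_apply, Matrix.one_apply_eq] at h1
    have h2 : ∑ k, ‖W v k j‖ ^ 2 = 1 := by
      have : ((∑ k, ‖W v k j‖ ^ 2 : ℝ) : ℂ) = 1 := by
        rw [← h1]
        push_cast
        refine Finset.sum_congr rfl fun k _ => ?_
        exact (Complex.conj_mul' _).symm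
      exact_mod_cast this
    have h3 : ‖W v i j‖ ^ 2 ≤ 1 := by
      rw [← h2]
      exact Finset.single_le_sum (f := fun k => ‖W v k j‖ ^ 2) (fun k _ => by positivity)
        (Finset.mem_univ i)
    rw [mem_closedBall_zero_iff]
    exact (sq_le_one_iff₀ (norm_nonneg _)).1 h3

lemma dense_eval_ne_zero {q : ℂ[X]} (hq : q ≠ 0) : Dense {z : ℂ | q.eval z ≠ 0} := by
  have : {z : ℂ | q.eval z ≠ 0} = (q.roots.toFinset : Set ℂ)ᶜ := by
    ext z
    simp [hq]
  rw [this]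
  exact (Finset.countable_toSet _).dense_compl ℂ

/-- Having a subrepresentation of given dimension vector is a closed condition on a line. -/
lemma exists_subrep_of_generic {Q0 Q1 : Type} {s t : Q1 → Q0} {β ρ : Q0 → ℕ}
    (F F' : QuiverRep s t fun v => Fin (β v) → ℂ) {q : ℂ[X]} (hq : q ≠ 0)
    (h : ∀ z : ℂ, q.eval z ≠ 0 → ∃ S : ∀ v, Submodule ℂ (Fin (β v) → ℂ),
      (∀ v, Module.finrank ℂ (S v) = ρ v) ∧ ∀ a, ∀ x ∈ S (s a), (F a + z • F' a) x ∈ S (t a))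
    (z : ℂ) : ∃ S : ∀ v, Submodule ℂ (Fin (β v) → ℂ),
      (∀ v, Module.finrank ℂ (S v) = ρ v) ∧ ∀ a, ∀ x ∈ S (s a), (F a + z • F' a) x ∈ S (t a) := by
  set Fr := {W : ∀ v, Matrix (Fin (β v)) (Fin (ρ v)) ℂ | ∀ v, (W v).conjTranspose * W v = 1}
  have : CompactSpace Fr := isCompact_iff_compactSpace.1 (isCompact_frames β ρ)
  set M : ℂ → ∀ a, Matrix (Fin (β (t a))) (Fin (β (s a))) ℂ := fun z a =>
    LinearMap.toMatrix' (F a) + z • LinearMap.toMatrix' (F' a) with hM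
  have hMv : ∀ z a x, (M z a).mulVec x = (F a + z • F' a) x := by
    intro z a x
    simp [hM, Matrix.add_mulVec, Matrix.smul_mulVec, LinearMap.toMatrix'_mulVec]
  set Z : Set (ℂ × Fr) := {p | ∀ a, M p.1 a * p.2.1 (s a) =
    p.2.1 (t a) * ((p.2.1 (t a)).conjTranspose * (M p.1 a * p.2.1 (s a)))} with hZ
  have hZc : IsClosed Z := by
    rw [hZ, Set.ofPred_forall]
    refine isClosed_iInter fun a => ?_
    have c1 : Continuous fun p : ℂ × Fr => M p.1 a :=
      continuous_const.add (continuous_fst.smul continuous_const)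
    have c2 : ∀ v, Continuous fun p : ℂ × Fr => p.2.1 v := fun v =>
      (continuous_apply v).comp (continuous_subtype_val.comp continuous_snd)
    have c3 := c1.matrix_mul (c2 (s a))
    exact isClosed_eq c3 ((c2 (t a)).matrix_mul ((c2 (t a)).matrix_conjTranspose.matrix_mul c3))
  have hP : IsClosed (Prod.fst '' Z) := isClosedMap_fst_of_compactSpace _ hZc
  have hsub : {z : ℂ | q.eval z ≠ 0} ⊆ Prod.fst '' Z := by
    intro z hz
    obtain ⟨S, hS, hF⟩ := h z hz
    choose W hW hWS using fun v => exists_frame (S v) (hS v)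
    refine ⟨(z, ⟨W, hW⟩), fun a => ?_, rfl⟩
    refine Matrix.ext_of_mulVec_single fun j => ?_
    have hmem : (M z a * W (s a)).mulVec (Pi.single j 1) ∈
        LinearMap.range (W (t a)).mulVecLin := by
      rw [hWS, ← Matrix.mulVec_mulVec, hMv]
      refine hF a _ ?_
      rw [← hWS]
      exact ⟨_, rfl⟩
    have := (mem_range_frame (hW (t a)) _).1 hmem
    simp only [Matrix.mulVec_mulVec] at this ⊢
    exact this.symm
  have hz : z ∈ Prod.fst '' Z := by
    have := closure_minimal hsub hP
    rw [(dense_eval_ne_zero hq).closure_eq] at this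
    exact this trivial
  obtain ⟨⟨_, W, hW⟩, hWZ, rfl⟩ := hz
  refine ⟨fun v => LinearMap.range (W v).mulVecLin, fun v => finrank_range_frame (hW v), ?_⟩
  rintro a _ ⟨y, rfl⟩
  rw [mem_range_frame (hW (t a)), ← hMv]
  have := congrArg (fun A => A.mulVec y) (hWZ a)
  simp only [← Matrix.mulVec_mulVec] at this
  simpa using this.symm

end Frames

section Schofield
variable {Q0 Q1 : Type} [Fintype Q0] [Fintype Q1] {s t : Q1 → Q0}

lemma finrank_lt_of_quiverD {X Y : Q0 → Type*} [∀ v, AddCommGroup (X v)]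
    [∀ v, Module ℂ (X v)] [∀ v, AddCommGroup (Y v)] [∀ v, Module ℂ (Y v)]
    [∀ v, FiniteDimensional ℂ (X v)] [∀ v, FiniteDimensional ℂ (Y v)]
    (A : QuiverRep s t X) (F : QuiverRep s t Y)
    (hinj : Function.Injective (quiverD A F)) (hs : ¬ Function.Surjective (quiverD A F)) :
    quiverEuler s t (fun v => Module.finrank ℂ (X v)) (fun v => Module.finrank ℂ (Y v)) < 0 := by
  have h1 := LinearMap.finrank_range_of_inj hinj
  have h2 : Module.finrank ℂ (LinearMap.range (quiverD A F)) <
      Module.finrank ℂ (∀ a, X (s a) →ₗ[ℂ] Y (t a)) := by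
    apply Submodule.finrank_lt
    rwa [Ne, LinearMap.range_eq_top]
  rw [h1, finrank_quiverD_dom, finrank_quiverD_cod] at h2
  rw [quiverEuler]
  have : ((∑ v, Module.finrank ℂ (X v) * Module.finrank ℂ (Y v) : ℕ) : ℤ) <
    ((∑ a, Module.finrank ℂ (X (s a)) * Module.finrank ℂ (Y (t a)) : ℕ) : ℤ) := by
    exact_mod_cast h2
  push_cast at this
  linarith

/-- A pair of representations together with a map which is extremal in the sense that it has
constant rank along all deformations. -/
lemma quiver_extremal_step {X Y : Q0 → Type*} [∀ v, AddCommGroup (X v)]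
    [∀ v, Module ℂ (X v)] [∀ v, AddCommGroup (Y v)] [∀ v, Module ℂ (Y v)]
    [∀ v, FiniteDimensional ℂ (X v)] [∀ v, FiniteDimensional ℂ (Y v)]
    (A : QuiverRep s t X) (F : QuiverRep s t Y)
    (φ : ∀ v, X v →ₗ[ℂ] Y v) (hφ : quiverD A F φ = 0)
    (hdef : ∀ A' F', ∃ χ : ∀ v, X v →ₗ[ℂ] Y v, quiverD A F χ = - quiverD A' F' φ ∧
      ∀ v, ∀ x, φ v x = 0 → χ v x ∈ LinearMap.range (φ v))
    (hker : ∀ ξ, quiverD A F ξ = 0 → ∀ v, ∀ x, φ v x = 0 → ξ v x ∈ LinearMap.range (φ v))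
    (hs : ¬ Function.Surjective (quiverD A F)) :
    quiverEuler s t (fun v => Module.finrank ℂ (X v) - Module.finrank ℂ (LinearMap.range (φ v)))
      (fun v => Module.finrank ℂ (Y v) - Module.finrank ℂ (LinearMap.range (φ v))) < 0 := by
  have hφ' : ∀ a x, F a (φ (s a) x) = φ (t a) (A a x) := fun a x => by
    have := LinearMap.congr_fun (congrFun hφ a) x
    simpa [quiverD, sub_eq_zero] using this
  choose σ hσ using fun v => exists_pseudoinverse (φ v)
  -- everything respecting kernel and image is hit
  have hR0 : ∀ r : ∀ a, X (s a) →ₗ[ℂ] Y (t a),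
      (∀ a x, φ (s a) x = 0 → r a x ∈ LinearMap.range (φ (t a))) →
      ∃ χ : ∀ v, X v →ₗ[ℂ] Y v, quiverD A F χ = r ∧
        ∀ v, ∀ x, φ v x = 0 → χ v x ∈ LinearMap.range (φ v) := by
    intro r hr
    obtain ⟨χ, h1, h2⟩ := hdef (fun a => σ (t a) ∘ₗ r a ∘ₗ (LinearMap.id - σ (s a) ∘ₗ φ (s a)))
      (fun a => - (r a ∘ₗ σ (s a)))
    refine ⟨χ, ?_, h2⟩
    rw [h1]
    ext a x
    have hk : φ (s a) (x - σ (s a) (φ (s a) x)) = 0 := by rw [map_sub, hσ, sub_self]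
    obtain ⟨y, hy⟩ := hr a _ hk
    have : φ (t a) (σ (t a) (r a (x - σ (s a) (φ (s a) x)))) =
        r a (x - σ (s a) (φ (s a) x)) := by rw [← hy, hσ]
    simp only [quiverD, LinearMap.coe_mk, AddHom.coe_mk, Pi.neg_apply, LinearMap.neg_apply,
      LinearMap.sub_apply, LinearMap.comp_apply, LinearMap.id_apply, this]
    rw [map_sub]
    abel
  set K : ∀ v, Submodule ℂ (X v) := fun v => LinearMap.ker (φ v) with hK
  set I : ∀ v, Submodule ℂ (Y v) := fun v => LinearMap.range (φ v) with hI
  have hA : ∀ a, ∀ x ∈ K (s a), A a x ∈ K (t a) := fun a x hx => by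
    rw [hK, LinearMap.mem_ker] at *
    rw [← hφ', hx, map_zero]
  have hF : ∀ a, I (s a) ≤ (I (t a)).comap (F a) := by
    rintro a _ ⟨x, rfl⟩
    exact ⟨A a x, (hφ' a x).symm⟩
  set A' : QuiverRep s t fun v => K v := fun a => (A a).restrict (hA a) with hA'
  set F' : QuiverRep s t fun v => Y v ⧸ I v :=
    fun a => (I (s a)).mapQ (I (t a)) (F a) (hF a) with hF'
  -- lifting maps from the kernel to the cokernel
  have lift : ∀ {v w} (f : K v →ₗ[ℂ] (Y w ⧸ I w)), ∃ g : X v →ₗ[ℂ] Y w,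
      ∀ x : K v, (I w).mkQ (g x) = f x := by
    intro v w f
    obtain ⟨f', hf'⟩ := LinearMap.exists_extend f
    obtain ⟨i, hi⟩ := LinearMap.exists_rightInverse_of_surjective (I w).mkQ (I w).range_mkQ
    refine ⟨i ∘ₗ f', fun x => ?_⟩
    have h1 := LinearMap.congr_fun hi (f' x)
    have h2 := LinearMap.congr_fun hf' x
    simp only [LinearMap.comp_apply, LinearMap.id_apply, Submodule.subtype_apply] at h1 h2 ⊢
    rw [h1, h2]
  have hcomp : ∀ (ψ : ∀ v, X v →ₗ[ℂ] Y v) (ψ' : ∀ v, K v →ₗ[ℂ] (Y v ⧸ I v)),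
      (∀ v (x : K v), (I v).mkQ (ψ v x) = ψ' v x) → ∀ a (x : K (s a)),
      (I (t a)).mkQ (quiverD A F ψ a x) = quiverD A' F' ψ' a x := by
    intro ψ ψ' h a x
    simp only [quiverD, LinearMap.coe_mk, AddHom.coe_mk, LinearMap.sub_apply,
      LinearMap.comp_apply, ← h, map_sub]
    congr 1
  have key := finrank_lt_of_quiverD A' F' ?_ ?_
  · convert key using 2 <;> ext v
    · have h1 := LinearMap.finrank_range_add_finrank_ker (φ v)
      have h2 : Module.finrank ℂ (K v) = Module.finrank ℂ (LinearMap.ker (φ v)) := rfl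
      omega
    · have h1 := (I v).finrank_quotient_add_finrank
      have h2 : Module.finrank ℂ (I v) = Module.finrank ℂ (LinearMap.range (φ v)) := rfl
      omega
  · rw [← LinearMap.ker_eq_bot, LinearMap.ker_eq_bot']
    intro ψ' hψ'
    choose ψ hψ using fun v => lift (ψ' v)
    obtain ⟨χ, h1, h2⟩ := hR0 (quiverD A F ψ) (fun a x hx => by
      have := hcomp ψ ψ' hψ a ⟨x, hx⟩
      rw [hψ'] at this
      exact (Submodule.Quotient.mk_eq_zero _).1 this)
    have h3 := hker (ψ - χ) (by rw [map_sub, h1, sub_self])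
    ext v x
    rw [← hψ]
    have h4 := (I v).add_mem (h3 v x x.2) (h2 v x x.2)
    simpa using h4
  · intro hsurj
    apply hs
    intro r
    obtain ⟨ψ', hψ'⟩ := hsurj (fun a => (I (t a)).mkQ ∘ₗ r a ∘ₗ (K (s a)).subtype)
    choose ψ hψ using fun v => lift (ψ' v)
    obtain ⟨χ, h1, -⟩ := hR0 (r - quiverD A F ψ) (fun a x hx => by
      have := hcomp ψ ψ' hψ a ⟨x, hx⟩
      rw [hψ'] at this
      simp only [Submodule.mkQ_apply, LinearMap.coe_comp, Function.comp_apply,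
        Submodule.subtype_apply] at this
      exact (Submodule.Quotient.eq _).1 this.symm)
    exact ⟨ψ + χ, by rw [map_add, h1]; abel⟩

variable (s t) in
/-- Inductive step for Schofield's theorem: if no `quiverD A F` is onto and the Euler form is
nonnegative, there is a nontrivial universal sub dimension vector. -/
lemma exists_universal_rank (α β : Q0 → ℕ)
    (h : ∀ (A : QuiverRep s t fun v => Fin (α v) → ℂ)
      (F : QuiverRep s t fun v => Fin (β v) → ℂ),
      ¬ Function.Surjective (quiverD A F))
    (he : 0 ≤ quiverEuler s t (fun v => (α v : ℤ)) (fun v => β v)) :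
    ∃ ρ : Q0 → ℕ, (∃ v, ρ v ≠ 0) ∧ (∀ v, ρ v ≤ α v) ∧ (∀ v, ρ v ≤ β v) ∧ IsUnivSub s t β ρ ∧
      IsUnivSub s t α (fun v => α v - ρ v) ∧
      quiverEuler s t (fun v => (α v : ℤ) - ρ v) (fun v => (β v : ℤ) - ρ v) < 0 := by
  classical
  -- the maximal rank of the differential
  obtain ⟨r, ⟨⟨A₀, F₀, hr⟩, hmaxr⟩⟩ : ∃ r, (∃ (A : QuiverRep s t fun v => Fin (α v) → ℂ) (F :
      QuiverRep s t fun v => Fin (β v) → ℂ),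
      Module.finrank ℂ (LinearMap.range (quiverD A F)) = r) ∧
      ∀ (A : QuiverRep s t fun v => Fin (α v) → ℂ) (F : QuiverRep s t fun v => Fin (β v) → ℂ),
          Module.finrank ℂ (LinearMap.range (quiverD A F)) ≤ r := by
    set S : Set ℕ := {r | ∃ (A : QuiverRep s t fun v => Fin (α v) → ℂ) (F :
        QuiverRep s t fun v => Fin (β v) → ℂ),
      Module.finrank ℂ (LinearMap.range (quiverD A F)) = r}
    have hb : BddAbove S := by
      refine ⟨Module.finrank ℂ (∀ a, (Fin (α (s a)) → ℂ) →ₗ[ℂ] (Fin (β (t a)) → ℂ)), ?_⟩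
      rintro _ ⟨A, F, rfl⟩
      exact Submodule.finrank_le _
    have hne : S.Nonempty := ⟨_, fun a => 0, fun a => 0, rfl⟩
    exact ⟨sSup S, Nat.sSup_mem hne hb, fun A F => le_csSup hb ⟨A, F, rfl⟩⟩
  -- the maximal total rank of a homomorphism
  obtain ⟨m, ⟨⟨A, F, φ, hAF, hφ, hm⟩, hmaxm⟩⟩ : ∃ m, (∃ (A : QuiverRep s t fun v => Fin (α v) →
      ℂ) (F : QuiverRep s t fun v => Fin (β v) → ℂ) (φ : ∀ v, (Fin (α v) → ℂ) →ₗ[ℂ] (Fin (β v) →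
      ℂ)),
      Module.finrank ℂ (LinearMap.range (quiverD A F)) = r ∧ quiverD A F φ = 0 ∧
        ∑ v, Module.finrank ℂ (LinearMap.range (φ v)) = m) ∧
      ∀ (A : QuiverRep s t fun v => Fin (α v) → ℂ) (F : QuiverRep s t fun v => Fin (β v) → ℂ) (φ :
          ∀ v, (Fin (α v) → ℂ) →ₗ[ℂ] (Fin (β v) → ℂ)), Module.finrank ℂ (LinearMap.range (quiverD A
          F)) = r →
        quiverD A F φ = 0 → ∑ v, Module.finrank ℂ (LinearMap.range (φ v)) ≤ m := by
    set S : Set ℕ := {m | ∃ (A : QuiverRep s t fun v => Fin (α v) → ℂ) (F :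
        QuiverRep s t fun v => Fin (β v) → ℂ) (φ : ∀ v, (Fin (α v) → ℂ) →ₗ[ℂ] (Fin (β v) → ℂ)),
      Module.finrank ℂ (LinearMap.range (quiverD A F)) = r ∧ quiverD A F φ = 0 ∧
        ∑ v, Module.finrank ℂ (LinearMap.range (φ v)) = m}
    have hb : BddAbove S := by
      refine ⟨∑ v, β v, ?_⟩
      rintro _ ⟨A, F, φ, -, -, rfl⟩
      refine Finset.sum_le_sum fun v _ => ?_
      simpa using Submodule.finrank_le (LinearMap.range (φ v))
    have hne : S.Nonempty := ⟨_, A₀, F₀, 0, hr, map_zero _, rfl⟩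
    exact ⟨sSup S, Nat.sSup_mem hne hb,
      fun A F φ h1 h2 => le_csSup hb ⟨A, F, φ, h1, h2, rfl⟩⟩
  set ρ : Q0 → ℕ := fun v => Module.finrank ℂ (LinearMap.range (φ v)) with hρ
  -- rank constancy along deformations
  have curve : ∀ (A' : QuiverRep s t fun v => Fin (α v) → ℂ) (F' :
      QuiverRep s t fun v => Fin (β v) → ℂ) (χ : ℂ → ∀ v, (Fin (α v) → ℂ) →ₗ[ℂ] (Fin (β v) → ℂ)),
      PolyCurve χ → ∀ δ : ℂ[X], δ.eval 0 ≠ 0 →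
      (∀ z, δ.eval z ≠ 0 → quiverD (A + z • A') (F + z • F') (φ + z • χ z) = 0) →
      ∃ q : ℂ[X], q.eval 0 ≠ 0 ∧ ∀ z, q.eval z ≠ 0 →
        quiverD (A + z • A') (F + z • F') (φ + z • χ z) = 0 ∧
        ∀ v, Module.finrank ℂ (LinearMap.range (φ v + z • χ z v)) = ρ v := by
    intro A' F' χ hχ δ hδ0 hδ
    have c1 := PolyCurve.exists_rank_le
      (PolyCurve.line (quiverD A F) (quiverD A' F')) 0
    obtain ⟨q₁, hq₁0, hq₁⟩ := c1
    have c2 : ∀ v, PolyCurve fun z => φ v + z • χ z v := fun v => by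
      have := (PolyCurve.const (φ v)).add ((hχ.smul X).map (LinearMap.proj v))
      simpa using this
    choose q₂ hq₂0 hq₂ using fun v => (c2 v).exists_rank_le 0
    refine ⟨δ * q₁ * ∏ v, q₂ v, ?_, fun z hz => ?_⟩
    · simp [hδ0, hq₁0, eval_prod, Finset.prod_ne_zero_iff, hq₂0]
    · rw [eval_mul, eval_mul, eval_prod] at hz
      have hz1 := left_ne_zero_of_mul (left_ne_zero_of_mul hz)
      have hz2 := right_ne_zero_of_mul (left_ne_zero_of_mul hz)
      have hz3 := Finset.prod_ne_zero_iff.1 (right_ne_zero_of_mul hz)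
      refine ⟨hδ z hz1, ?_⟩
      have e1 := hq₁ z hz2
      rw [zero_smul, add_zero, hAF, ← quiverD_add_smul] at e1
      have e2 := hmaxm _ _ _ (le_antisymm (hmaxr _ _) e1) (hδ z hz1)
      have e3 : ∀ v ∈ Finset.univ, ρ v ≤
          Module.finrank ℂ (LinearMap.range (φ v + z • χ z v)) := fun v _ => by
        have := hq₂ v z (hz3 v (Finset.mem_univ _))
        rwa [zero_smul, add_zero] at this
      have e4 := (Finset.sum_eq_sum_iff_of_le e3).1
        (le_antisymm (Finset.sum_le_sum e3) (by rw [hρ, hm]; exact e2))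
      exact fun v => (e4 v (Finset.mem_univ _)).symm
  have curve' : ∀ (A' : QuiverRep s t fun v => Fin (α v) → ℂ) (F' :
      QuiverRep s t fun v => Fin (β v) → ℂ), ∃ χ : ℂ → ∀ v, (Fin (α v) → ℂ) →ₗ[ℂ] (Fin (β v) → ℂ),
      PolyCurve χ ∧
      ∃ q : ℂ[X], q.eval 0 ≠ 0 ∧ ∀ z, q.eval z ≠ 0 →
        quiverD (A + z • A') (F + z • F') (φ + z • χ z) = 0 ∧
        ∀ v, Module.finrank ℂ (LinearMap.range (φ v + z • χ z v)) = ρ v := by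
    intro A' F'
    obtain ⟨χ, δ, h1, h2, h3⟩ := exists_kernel_curve (quiverD A F) (quiverD A' F') (fun z => by
      rw [← quiverD_add_smul, hAF]; exact hmaxr _ _) φ hφ
    exact ⟨χ, h1, curve A' F' χ h1 δ h2 (fun z hz => by rw [quiverD_add_smul]; exact h3 z hz)⟩
  have kerim : ∀ (χ : ℂ → ∀ v, (Fin (α v) → ℂ) →ₗ[ℂ] (Fin (β v) → ℂ)), PolyCurve χ → ∀ q : ℂ[X],
      q.eval 0 ≠ 0 → (∀ z, q.eval z ≠ 0 →
      ∀ v, Module.finrank ℂ (LinearMap.range (φ v + z • χ z v)) = ρ v) →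
      ∀ v, ∀ x, φ v x = 0 → χ 0 v x ∈ LinearMap.range (φ v) := by
    intro χ hχ q hq0 hq v x hx
    by_contra hcon
    obtain ⟨q', hq'0, hq'⟩ := PolyCurve.exists_rank_lt (χ := fun z => χ z v)
      (hχ.map (LinearMap.proj v)) x hx hcon
    have hne : X * q * q' ≠ 0 := by
      refine mul_ne_zero (mul_ne_zero X_ne_zero ?_) ?_ <;> rintro rfl <;> simp at *
    obtain ⟨z, hz⟩ := (dense_eval_ne_zero hne).nonempty
    simp only [Set.mem_ofPred_eq, eval_mul, eval_X] at hz
    have h1 := hq z (right_ne_zero_of_mul (left_ne_zero_of_mul hz)) v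
    have h3 : ρ v = Module.finrank ℂ (LinearMap.range (φ v)) := rfl
    have h2 := hq' z (left_ne_zero_of_mul (left_ne_zero_of_mul hz)) (right_ne_zero_of_mul hz)
    omega
  have hsub : ∀ (A' : QuiverRep s t fun v => Fin (α v) → ℂ) (F' :
      QuiverRep s t fun v => Fin (β v) → ℂ) (ψ : ∀ v, (Fin (α v) → ℂ) →ₗ[ℂ] (Fin (β v) → ℂ)),
      quiverD A' F' ψ = 0 → ∀ a x,
      F' a (ψ (s a) x) = ψ (t a) (A' a x) := fun A' F' ψ h a x => by
    have := LinearMap.congr_fun (congrFun h a) x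
    simpa [quiverD, sub_eq_zero] using this
  refine ⟨ρ, ?_, fun v => ?_, fun v => ?_, ?_, ?_, ?_⟩
  · -- some homomorphism is nonzero
    by_contra! hcon
    have hm0 : m = 0 := by rw [← hm]; exact Finset.sum_eq_zero fun v _ => hcon v
    have hinj : Function.Injective (quiverD A F) := by
      rw [← LinearMap.ker_eq_bot, LinearMap.ker_eq_bot']
      intro ψ hψ
      have := hmaxm A F ψ hAF hψ
      rw [hm0, Nat.le_zero, Finset.sum_eq_zero_iff] at this
      ext1 v
      have h1 := this v (Finset.mem_univ _)
      rw [Submodule.finrank_eq_zero, LinearMap.range_eq_bot] at h1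
      exact h1
    have := finrank_lt_of_quiverD A F hinj (h A F)
    simp only [Module.finrank_fin_fun] at this
    omega
  · simpa using LinearMap.finrank_range_le (φ v)
  · simpa using Submodule.finrank_le (LinearMap.range (φ v))
  · intro F'
    obtain ⟨χ, -, q, hq0, hq⟩ := curve' 0 (F' - F)
    have := exists_subrep_of_generic (ρ := ρ) F (F' - F) (q := q) (by rintro rfl; simp at hq0)
      (fun z hz => ⟨fun v => LinearMap.range (φ v + z • χ z v), (hq z hz).2, by
        rintro a _ ⟨x, rfl⟩
        exact ⟨_, (hsub _ _ _ (hq z hz).1 a x).symm⟩⟩) 1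
    simpa using this
  · intro A'
    obtain ⟨χ, -, q, hq0, hq⟩ := curve' (A' - A) 0
    have := exists_subrep_of_generic (ρ := fun v => α v - ρ v) A (A' - A) (q := q)
      (by rintro rfl; simp at hq0)
      (fun z hz => ⟨fun v => LinearMap.ker (φ v + z • χ z v), fun v => by
          have h1 := (hq z hz).2 v
          have h2 := LinearMap.finrank_range_add_finrank_ker (φ v + z • χ z v)
          simp only [Module.finrank_fin_fun] at h2
          change Module.finrank ℂ (LinearMap.ker (φ v + z • χ z v)) = _
          omega, by
        intro a x hx
        rw [LinearMap.mem_ker] at hx ⊢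
        have := hsub _ _ _ (hq z hz).1 a x
        simp only [Pi.add_apply, Pi.smul_apply] at this
        rw [← this, hx, map_zero]⟩) 1
    simpa using this
  · have := quiver_extremal_step A F φ hφ (fun A' F' => ?_) (fun ξ hξ => ?_) (h A F)
    · simpa using this
    · obtain ⟨χ, hχ, q, hq0, hq⟩ := curve' A' F'
      refine ⟨χ 0, ?_, kerim χ hχ q hq0 fun z hz => (hq z hz).2⟩
      -- first order term
      rw [← sub_eq_zero]
      refine (Module.forall_dual_apply_eq_zero_iff ℂ _).1 fun f => ?_
      obtain ⟨p₁, hp₁⟩ := hχ (f ∘ₗ quiverD A F)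
      obtain ⟨p₂, hp₂⟩ := hχ (f ∘ₗ quiverD A' F')
      have hzero : X * q * (p₁ + C (f (quiverD A' F' φ)) + X * p₂) = 0 := by
        refine Polynomial.funext fun z => ?_
        simp only [eval_mul, eval_add, eval_C, eval_X, eval_zero]
        by_cases hz : q.eval z = 0
        · simp [hz]
        have h1 := congrArg f (hq z hz).1
        rw [quiverD_add_smul] at h1
        have h3 := hp₁ z
        have h4 := hp₂ z
        simp only [LinearMap.comp_apply] at h3 h4
        simp only [LinearMap.add_apply, LinearMap.smul_apply, map_add, map_smul, hφ, zero_add,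
          map_zero, h3, h4, smul_eq_mul] at h1
        linear_combination q.eval z * h1
      have hq' : q ≠ 0 := by rintro rfl; simp at hq0
      have h5 := (mul_eq_zero.1 hzero).resolve_left (mul_ne_zero X_ne_zero hq')
      have h6 := congrArg (Polynomial.eval 0) h5
      have h3 := hp₁ 0
      simp only [LinearMap.comp_apply] at h3
      simp only [eval_add, eval_mul, eval_X, eval_C, zero_mul, add_zero, eval_zero] at h6
      rw [map_sub, map_neg, h3]
      linear_combination h6
    · have hc : PolyCurve (fun _ : ℂ => ξ) := PolyCurve.const ξ
      obtain ⟨q, hq0, hq⟩ := curve 0 0 (fun _ => ξ) hc 1 (by simp) (fun z _ => by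
        simp [hφ, hξ])
      exact kerim _ hc q hq0 fun z hz => (hq z hz).2

variable (s t) in
/-- Schofield's theorem on generic extensions, in the direction needed here. -/
theorem exists_univSub_of_not_surjective (α β : Q0 → ℕ)
    (h : ∀ (A : QuiverRep s t fun v => Fin (α v) → ℂ)
      (F : QuiverRep s t fun v => Fin (β v) → ℂ),
      ¬ Function.Surjective (quiverD A F)) :
    ∃ ρ : Q0 → ℕ, (∀ v, ρ v ≤ β v) ∧ IsUnivSub s t β ρ ∧
      quiverEuler s t (fun v => (α v : ℤ)) (fun v => (β v : ℤ) - ρ v) < 0 := by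
  induction hN : ∑ v, β v using Nat.strong_induction_on generalizing β with
  | _ N ih =>
  subst hN
  rcases lt_or_ge (quiverEuler s t (fun v => (α v : ℤ)) (fun v => β v)) 0 with he | he
  · exact ⟨0, fun v => Nat.zero_le _, fun F => ⟨fun v => ⊥, fun v => by simp, by simp⟩,
      by simpa using he⟩
  obtain ⟨ρ, ⟨v₀, hv₀⟩, hρα, hρβ, hUβ, hUα, hlt⟩ := exists_universal_rank s t α β h he
  have hsurj : ∀ (A : QuiverRep s t fun v => Fin (α v) → ℂ)
      (F : QuiverRep s t fun v => Fin (β v - ρ v) → ℂ),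
      ¬ Function.Surjective (quiverD A F) := by
    intro A F hs
    obtain ⟨K, hK, hAK⟩ := hUα A
    set A' : QuiverRep s t fun v => K v := fun a => (A a).restrict (hAK a) with hA'
    have hs' : Function.Surjective (quiverD A' F) := by
      intro r
      choose r' hr' using fun a => LinearMap.exists_extend (r a)
      obtain ⟨ψ, hψ⟩ := hs r'
      refine ⟨fun v => ψ v ∘ₗ (K v).subtype, ?_⟩
      ext1 a
      rw [← hr' a, ← hψ]
      rfl
    have h1 := LinearMap.finrank_le_finrank_of_surjective hs'
    have e1 := finrank_quiverD_dom (X := fun v => K v) (Y := fun v => Fin (β v - ρ v) → ℂ)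
    have e2 := finrank_quiverD_cod (s := s) (t := t) (X := fun v => K v)
      (Y := fun v => Fin (β v - ρ v) → ℂ)
    rw [e1, e2] at h1
    simp only [hK, Module.finrank_fin_fun] at h1
    rw [quiverEuler] at hlt
    have h2 : ((∑ a, (α (s a) - ρ (s a)) * (β (t a) - ρ (t a)) : ℕ) : ℤ) ≤
      ((∑ v, (α v - ρ v) * (β v - ρ v) : ℕ) : ℤ) := by exact_mod_cast h1
    simp only [Nat.cast_sum, Nat.cast_mul, Nat.cast_sub (hρα _), Nat.cast_sub (hρβ _)] at h2
    linarith
  obtain ⟨ρ', hρ', hU', hlt'⟩ := ih (∑ v, (β v - ρ v)) (by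
    refine Finset.sum_lt_sum (fun v _ => Nat.sub_le _ _) ⟨v₀, Finset.mem_univ _, ?_⟩
    have := hρβ v₀
    omega) (fun v => β v - ρ v) hsurj rfl
  refine ⟨fun v => ρ v + ρ' v, fun v => ?_, ?_, ?_⟩
  · have h1 : ρ' v ≤ β v - ρ v := hρ' v
    have h2 := hρβ v
    change ρ v + ρ' v ≤ β v
    omega
  · intro F
    obtain ⟨I, hI, hFI⟩ := hUβ F
    obtain ⟨S, hS, hFS⟩ := hU'.transport (X := fun v => (Fin (β v) → ℂ) ⧸ I v) (fun v => by
      have := (I v).finrank_quotient_add_finrank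
      simp only [Module.finrank_fin_fun, hI] at this
      omega) (fun a => (I (s a)).mapQ (I (t a)) (F a) (hFI a))
    refine ⟨fun v => (S v).comap (I v).mkQ, fun v => ?_, fun a x hx => ?_⟩
    · have h1 : Module.finrank ℂ ((S v).comap (I v).mkQ) =
          Module.finrank ℂ (LinearMap.range ((I v).mkQ.domRestrict ((S v).comap (I v).mkQ))) +
          Module.finrank ℂ (LinearMap.ker ((I v).mkQ.domRestrict ((S v).comap (I v).mkQ))) :=
        (LinearMap.finrank_range_add_finrank_ker _).symm
      have h2 : LinearMap.range ((I v).mkQ.domRestrict ((S v).comap (I v).mkQ)) = S v := by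
        rw [LinearMap.range_domRestrict]
        exact Submodule.map_comap_eq_of_surjective (I v).mkQ_surjective _
      have h3 : Module.finrank ℂ
          (LinearMap.ker ((I v).mkQ.domRestrict ((S v).comap (I v).mkQ))) =
          Module.finrank ℂ (I v) := by
        have hle : I v ≤ (S v).comap (I v).mkQ := fun x hx => by
          have : (I v).mkQ x = 0 := by simpa using hx
          simp only [Submodule.mem_comap, this, Submodule.zero_mem]
        rw [LinearMap.ker_domRestrict, Submodule.ker_mkQ]
        exact LinearEquiv.finrank_eq (Submodule.comapSubtypeEquivOfLe hle)
      rw [h1, h2, h3, hI, hS, add_comm]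
    · have := hFS a _ hx
      simpa using this
  · convert hlt' using 2
    ext v
    have := hρβ v
    push_cast [Nat.cast_sub this]
    ring

end Schofield

section Generic
variable {Q0 Q1 : Type} [Fintype Q0] [Fintype Q1] {s t : Q1 → Q0}

lemma exists_full_rank (a b : ℕ) : ∃ f : (Fin a → ℂ) →ₗ[ℂ] (Fin b → ℂ),
    min a b ≤ Module.finrank ℂ (LinearMap.range f) := by
  rcases le_total a b with h | h
  · have hs := LinearMap.funLeft_surjective_of_injective ℂ ℂ (Fin.castLE h)
      (Fin.castLE_injective h)
    obtain ⟨g, hg⟩ := (LinearMap.funLeft ℂ ℂ (Fin.castLE h)).exists_rightInverse_of_surjective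
      (LinearMap.range_eq_top.2 hs)
    refine ⟨g, ?_⟩
    have : Function.Injective g := fun x y hxy => by
      have := congrArg (LinearMap.funLeft ℂ ℂ (Fin.castLE h)) hxy
      rw [← LinearMap.comp_apply, ← LinearMap.comp_apply, hg] at this
      exact this
    rw [LinearMap.finrank_range_of_inj this]
    simp [h]
  · have hs := LinearMap.funLeft_surjective_of_injective ℂ ℂ (Fin.castLE h)
      (Fin.castLE_injective h)
    refine ⟨LinearMap.funLeft ℂ ℂ (Fin.castLE h), ?_⟩
    rw [LinearMap.range_eq_top.2 hs]
    simp [h]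

variable (s t) in
theorem exists_bijective_quiverD (α β : Q0 → ℕ)
    (h : ∀ ρ : Q0 → ℕ, (∀ v, ρ v ≤ β v) → IsUnivSub s t β ρ →
      0 ≤ quiverEuler s t (fun v => (α v : ℤ)) (fun v => (β v : ℤ) - ρ v))
    (h0 : quiverEuler s t (fun v => (α v : ℤ)) (fun v => (β v : ℤ)) = 0) :
    ∃ (A : QuiverRep s t fun v => Fin (α v) → ℂ) (F : QuiverRep s t fun v => Fin (β v) → ℂ),
      Function.Bijective (quiverD A F) ∧
      (∀ a, min (α (s a)) (α (t a)) ≤ Module.finrank ℂ (LinearMap.range (A a))) ∧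
      (∀ a, min (β (s a)) (β (t a)) ≤ Module.finrank ℂ (LinearMap.range (F a))) := by
  have hex : ∃ (A : QuiverRep s t fun v => Fin (α v) → ℂ)
      (F : QuiverRep s t fun v => Fin (β v) → ℂ), Function.Surjective (quiverD A F) := by
    by_contra! hne
    obtain ⟨ρ, h1, h2, h3⟩ := exists_univSub_of_not_surjective s t α β hne
    exact absurd (h ρ h1 h2) (not_le.2 h3)
  obtain ⟨A, F, hs⟩ := hex
  choose A' hA' using fun a => exists_full_rank (α (s a)) (α (t a))
  choose F' hF' using fun a => exists_full_rank (β (s a)) (β (t a))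
  obtain ⟨q, hq0, hq⟩ := (PolyCurve.line (quiverD A F)
    (quiverD (fun a => A' a - A a) (fun a => F' a - F a))).exists_rank_le 0
  choose qA hqA0 hqA using fun a => (PolyCurve.line (A a) (A' a - A a)).exists_rank_le 1
  choose qF hqF0 hqF using fun a => (PolyCurve.line (F a) (F' a - F a)).exists_rank_le 1
  have hne : q * (∏ a, qA a) * ∏ a, qF a ≠ 0 := by
    refine mul_ne_zero (mul_ne_zero ?_ ?_) ?_
    · rintro rfl; simp at hq0
    · refine Finset.prod_ne_zero_iff.2 fun a _ hz => ?_
      have := hqA0 a; rw [hz] at this; simp at this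
    · refine Finset.prod_ne_zero_iff.2 fun a _ hz => ?_
      have := hqF0 a; rw [hz] at this; simp at this
  obtain ⟨z, hz⟩ := (dense_eval_ne_zero hne).nonempty
  simp only [Set.mem_ofPred_eq, eval_mul, eval_prod, mul_ne_zero_iff, Finset.prod_ne_zero_iff] at hz
  obtain ⟨⟨hz1, hz2⟩, hz3⟩ := hz
  refine ⟨A + z • (fun a => A' a - A a), F + z • (fun a => F' a - F a), ?_, fun a => ?_,
    fun a => ?_⟩
  · have h1 := hq z hz1
    rw [zero_smul, add_zero, LinearMap.range_eq_top.2 hs, finrank_top] at h1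
    have hs2 : Function.Surjective (quiverD (A + z • (fun a => A' a - A a))
        (F + z • (fun a => F' a - F a))) := by
      rw [quiverD_add_smul, ← LinearMap.range_eq_top]
      exact Submodule.eq_top_of_finrank_eq (le_antisymm (Submodule.finrank_le _) h1)
    refine ⟨?_, hs2⟩
    have hd : Module.finrank ℂ (∀ v, (Fin (α v) → ℂ) →ₗ[ℂ] (Fin (β v) → ℂ)) =
        Module.finrank ℂ (∀ a, (Fin (α (s a)) → ℂ) →ₗ[ℂ] (Fin (β (t a)) → ℂ)) := by
      have e1 := finrank_quiverD_dom (X := fun v => Fin (α v) → ℂ) (Y := fun v => Fin (β v) → ℂ)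
      have e2 := finrank_quiverD_cod (s := s) (t := t) (X := fun v => Fin (α v) → ℂ)
        (Y := fun v => Fin (β v) → ℂ)
      rw [e1, e2]
      simp only [Module.finrank_fin_fun]
      rw [quiverEuler, sub_eq_zero] at h0
      exact_mod_cast h0
    exact (LinearMap.injective_iff_surjective_of_finrank_eq_finrank hd).2 hs2
  · have h1 := hqA a z (hz2 a (Finset.mem_univ a))
    rw [one_smul, add_sub_cancel] at h1
    exact (hA' a).trans h1
  · have h1 := hqF a z (hz3 a (Finset.mem_univ a))
    rw [one_smul, add_sub_cancel] at h1
    exact (hF' a).trans h1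
end Generic

section Minors
variable {n : ℕ} {I : Type} [Fintype I]

/-- The leading principal minor of size `j + 1`. -/
noncomputable def leadingMinor (j : Fin n) (M : Matrix (Fin n) (Fin n) ℂ) : ℂ :=
  (M.submatrix (Fin.castLE (Nat.succ_le_of_lt j.2)) (Fin.castLE (Nat.succ_le_of_lt j.2))).det

/-- The product of powers of leading minors, a function on a power of `SL n`. -/
noncomputable def minorProd (a : I → Fin n → ℕ) (g : I → SL n) : ℂ :=
  ∏ i, ∏ j, leadingMinor j (g i).val ^ a i j

/-- The span of the right translates of `minorProd a`. -/
noncomputable def minorSpan (a : I → Fin n → ℕ) : Submodule ℂ ((I → SL n) → ℂ) :=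
  Submodule.span ℂ (Set.range fun (h : I → SL n) (g : I → SL n) => minorProd a (g * h))

/-- `Φ` is invariant under the diagonal right action of the upper unipotent group and has weight
`ν` for the diagonal torus. -/
def IsRightHW (ν : Fin n → ℤ) (Φ : (I → SL n) → ℂ) : Prop :=
  (∀ g u, SLIsUniUpper u → Φ (fun i => g i * u) = Φ g) ∧
    ∀ g t, SLIsDiag t → Φ (fun i => g i * t) = (∏ p, t.val p p ^ ν p) * Φ g

/-- `minorSpan a` contains a nonzero highest weight function of weight `ν`. -/
def HasHWFun (a : I → Fin n → ℕ) (ν : Fin n → ℤ) : Prop :=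
  ∃ Φ ∈ minorSpan a, Φ ≠ 0 ∧ IsRightHW ν Φ

end Minors

section FlagQuiver

/-- Truncation or extension by zero. -/
def padMap (m k : ℕ) : (Fin m → ℂ) →ₗ[ℂ] (Fin k → ℂ) where
  toFun x p := if h : p.val < m then x ⟨p, h⟩ else 0
  map_add' x y := by
    ext p
    by_cases h : p.val < m <;> simp [h]
  map_smul' c x := by
    ext p
    by_cases h : p.val < m <;> simp [h]

lemma padMap_apply (m k : ℕ) (x : Fin m → ℂ) (p : Fin k) :
    padMap m k x p = if h : p.val < m then x ⟨p, h⟩ else 0 := rfl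

lemma padMap_self (m : ℕ) (x : Fin m → ℂ) : padMap m m x = x := by
  ext p
  simp [padMap_apply]

lemma padMap_padMap {m k l : ℕ} (h : m ≤ k ∨ l ≤ k) (x : Fin m → ℂ) :
    padMap k l (padMap m k x) = padMap m l x := by
  ext p
  simp only [padMap_apply]
  have := p.2
  split_ifs <;> first | rfl | omega

variable (N : ℕ) (I : Type)

abbrev FlagV := Fin (N + 1) ⊕ I × Fin (N + 1)
abbrev FlagE := Fin N ⊕ I ⊕ I × Fin N

variable {N I}
def flagSrc : FlagE N I → FlagV N I
  | .inl j => .inl j.castSucc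
  | .inr (.inl _) => .inl (Fin.last N)
  | .inr (.inr x) => .inr (x.1, x.2.succ)

def flagTgt : FlagE N I → FlagV N I
  | .inl j => .inl j.succ
  | .inr (.inl i) => .inr (i, Fin.last N)
  | .inr (.inr x) => .inr (x.1, x.2.castSucc)

def flagBeta : FlagV N I → ℕ
  | .inl j => j + 1
  | .inr x => x.2 + 1

def flagAlpha (ν : ℕ → ℕ) (lam : I → ℕ → ℕ) : FlagV N I → ℕ
  | .inl j => ν 0 - ν (j + 1)
  | .inr x => ν 0 - lam x.1 x.2

lemma flag_euler [Fintype I] (ν : ℕ → ℕ) (lam : I → ℕ → ℕ) (hν : Antitone ν) (hν0 : ν (N + 1) = 0)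
    (hlam : ∀ i j, lam i j ≤ ν 0) (hlam0 : ∀ i, lam i (N + 1) = 0) (ρ : FlagV N I → ℤ) :
    quiverEuler flagSrc flagTgt (fun v => (flagAlpha ν lam v : ℤ)) ρ =
      ∑ j : Fin (N + 1), ((ν j : ℤ) - ν (j + 1)) * ρ (.inl j) -
        ∑ i, ∑ j : Fin (N + 1), ((lam i j : ℤ) - lam i (j + 1)) * ρ (.inr (i, j)) := by
  have e1 : ∀ j, ((ν 0 - ν j : ℕ) : ℤ) = ν 0 - ν j := fun j => by
    rw [Nat.cast_sub (hν (Nat.zero_le _))]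
  have e2 : ∀ i j, ((ν 0 - lam i j : ℕ) : ℤ) = ν 0 - lam i j := fun i j => by
    rw [Nat.cast_sub (hlam i j)]
  simp only [quiverEuler, Fintype.sum_sum_type, flagSrc, flagTgt, flagAlpha, e1, e2,
    Fintype.sum_prod_type]
  have h1 : ∑ j : Fin (N + 1), ((ν 0 : ℤ) - ν (j + 1)) * ρ (.inl j) -
      ∑ j : Fin N, ((ν 0 : ℤ) - ν (j.castSucc + 1)) * ρ (.inl j.succ) =
      ∑ j : Fin (N + 1), ((ν j : ℤ) - ν (j + 1)) * ρ (.inl j) := by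
    rw [Fin.sum_univ_succ, Fin.sum_univ_succ (fun j : Fin (N + 1) => ((ν j : ℤ) - ν (j + 1)) *
      ρ (.inl j)), add_sub_assoc, ← Finset.sum_sub_distrib]
    congr 1
    refine Finset.sum_congr rfl fun j _ => ?_
    simp only [Fin.val_castSucc, Fin.val_succ]
    ring
  have h2 : ∀ i, ∑ j : Fin (N + 1), ((ν 0 : ℤ) - lam i j) * ρ (.inr (i, j)) -
      (((ν 0 : ℤ) - ν (Fin.last N + 1)) * ρ (.inr (i, Fin.last N)) +
        ∑ j : Fin N, ((ν 0 : ℤ) - lam i j.succ) * ρ (.inr (i, j.castSucc))) =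
      - ∑ j : Fin (N + 1), ((lam i j : ℤ) - lam i (j + 1)) * ρ (.inr (i, j)) := by
    intro i
    rw [Fin.sum_univ_castSucc, Fin.sum_univ_castSucc (fun j : Fin (N + 1) =>
      ((lam i j : ℤ) - lam i (j + 1)) * ρ (.inr (i, j)))]
    simp only [Fin.val_last, hν0, hlam0, Fin.val_castSucc, Fin.val_succ]
    have : ∑ j : Fin N, ((lam i j : ℤ) - lam i (j + 1)) * ρ (.inr (i, j.castSucc)) =
      ∑ j : Fin N, ((ν 0 : ℤ) - lam i (j + 1)) * ρ (.inr (i, j.castSucc)) -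
      ∑ j : Fin N, ((ν 0 : ℤ) - lam i j) * ρ (.inr (i, j.castSucc)) := by
      rw [← Finset.sum_sub_distrib]
      exact Finset.sum_congr rfl fun j _ => by ring
    rw [this]
    push_cast
    ring
  have h3 := Finset.sum_congr (rfl : (Finset.univ : Finset I) = Finset.univ) fun i _ => h2 i
  rw [Finset.sum_sub_distrib, Finset.sum_add_distrib, Finset.sum_neg_distrib] at h3
  linarith

end FlagQuiver

lemma exists_poly_det_add_smul {m r : ℕ} (B : Matrix (Fin m) (Fin m) ℂ)
    (P : Matrix (Fin m) (Fin r) ℂ) (Q : Matrix (Fin r) (Fin m) ℂ) :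
    ∃ q : ℂ[X], q.natDegree ≤ r ∧ ∀ s : ℂ, (B + s • (P * Q)).det = q.eval s := by
  obtain ⟨q, hq⟩ := exists_poly_det (fun s : ℂ => B + s • (P * Q)) fun i j =>
    ⟨C (B i j) + X * C ((P * Q) i j), fun t => by simp; ring⟩
  obtain ⟨w, hw⟩ := exists_poly_det (fun s : ℂ => Matrix.fromBlocks B (-P) Q (s • 1)) (by
    rintro (i | i) (j | j)
    · exact ⟨C (B i j), fun t => by simp⟩
    · exact ⟨C (-P i j), fun t => by simp⟩
    · exact ⟨C (Q i j), fun t => by simp⟩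
    · exact ⟨X * C ((1 : Matrix (Fin r) (Fin r) ℂ) i j), fun t => by simp; ring⟩)
  refine ⟨q, ?_, hq⟩
  have key : ∀ s : ℂ, s ≠ 0 → q.eval s * s ^ w.natDegree = s ^ r * w.reverse.eval s := by
    intro s hs
    have hinv : Invertible s⁻¹ := invertibleOfNonzero (inv_ne_zero hs)
    have h1 := eval₂_reverse_mul_pow (RingHom.id ℂ) s⁻¹ w
    rw [invOf_eq_inv, inv_inv] at h1
    change w.reverse.eval s * _ = w.eval s⁻¹ at h1
    rw [← hw] at h1
    obtain ⟨hi, h2⟩ : ∃ hi : Invertible (s⁻¹ • (1 : Matrix (Fin r) (Fin r) ℂ)),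
        ⅟(s⁻¹ • (1 : Matrix (Fin r) (Fin r) ℂ)) = s • 1 :=
      ⟨⟨s • 1, by simp [smul_smul, hs], by simp [smul_smul, hs]⟩, rfl⟩
    rw [Matrix.det_fromBlocks₂₂, h2] at h1
    simp only [Matrix.det_smul, Matrix.det_one, Fintype.card_fin, mul_one, Matrix.mul_smul,
      Matrix.smul_mul, Matrix.neg_mul, smul_neg, sub_neg_eq_add] at h1
    rw [Matrix.mul_one, hq] at h1
    have h3 : w.reverse.eval s = s⁻¹ ^ r * q.eval s * s ^ w.natDegree := by
      rw [← h1, mul_assoc, ← mul_pow, inv_mul_cancel₀ hs, one_pow, mul_one]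
    rw [h3, ← mul_assoc, ← mul_assoc, ← mul_pow, mul_inv_cancel₀ hs, one_pow, one_mul]
  have hpoly : q * X ^ w.natDegree = X ^ r * w.reverse := by
    refine eq_of_infinite_eval_eq _ _ (Set.Infinite.mono (s := {s : ℂ | s ≠ 0}) ?_ ?_)
    · intro s hs
      simpa using key s hs
    · exact (Set.finite_singleton (0 : ℂ)).infinite_compl
  by_cases hq0 : q = 0
  · simp [hq0]
  have h4 := congrArg natDegree hpoly
  rw [natDegree_mul_X_pow _ hq0] at h4
  have h5 : (X ^ r * w.reverse).natDegree ≤ r + w.natDegree :=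
    natDegree_mul_le.trans (add_le_add (natDegree_X_pow_le r) (reverse_natDegree_le w))
  omega

section FlagRep
set_option linter.unusedSectionVars false
variable {N : ℕ} {I : Type} [Fintype I]

/-- The representation of the flag quiver given by a tuple of matrices. -/
def flagRep (g : I → Matrix (Fin (N + 1)) (Fin (N + 1)) ℂ) :
    QuiverRep (flagSrc (N := N) (I := I)) flagTgt (fun v => Fin (flagBeta v) → ℂ)
  | .inl j => padMap (j.castSucc + 1) (j.succ + 1)
  | .inr (.inl i) => (g i).mulVecLin
  | .inr (.inr x) => padMap (x.2.succ + 1) (x.2.castSucc + 1)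

variable {g : I → Matrix (Fin (N + 1)) (Fin (N + 1)) ℂ}
  {S : ∀ v : FlagV N I, Submodule ℂ (Fin (flagBeta v) → ℂ)}

lemma flagRep_pad_mem (hS : ∀ a, ∀ x ∈ S (flagSrc a), flagRep g a x ∈ S (flagTgt a))
    (j : Fin (N + 1)) (x : Fin (j + 1) → ℂ) (hx : x ∈ S (.inl j)) :
    padMap (j + 1) (N + 1) x ∈ S (.inl (Fin.last N)) := by
  induction j using Fin.reverseInduction with
  | last =>
    have : padMap (N + 1) (N + 1) x = x := padMap_self _ _
    exact Eq.subst (motive := fun y => y ∈ S (.inl (Fin.last N))) this.symm hx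
  | cast j ih =>
    have h1 := ih _ (hS (.inl j) x hx)
    have h2 := padMap_padMap (m := j + 1) (k := j + 1 + 1) (l := N + 1) (Or.inl (by omega)) x
    exact h2 ▸ h1

lemma flagRep_trunc_mem (hS : ∀ a, ∀ x ∈ S (flagSrc a), flagRep g a x ∈ S (flagTgt a))
    (i : I) (j : Fin (N + 1)) (x : Fin (N + 1) → ℂ) (hx : x ∈ S (.inl (Fin.last N))) :
    padMap (N + 1) (j + 1) ((g i).mulVec x) ∈ S (.inr (i, j)) := by
  induction j using Fin.reverseInduction with
  | last =>
    have h1 := hS (.inr (.inl i)) x hx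
    have h2 := padMap_self (N + 1) ((g i).mulVec x)
    exact h2.symm ▸ h1
  | cast j ih =>
    have h1 := hS (.inr (.inr (i, j))) _ ih
    have h2 := padMap_padMap (m := N + 1) (k := j + 1 + 1) (l := j + 1) (Or.inr (by omega))
      ((g i).mulVec x)
    exact h2 ▸ h1

/-- The pivots of a subspace with respect to the standard flag. -/
def pivots (W : Submodule ℂ (Fin (N + 1) → ℂ)) : Set (Fin (N + 1)) :=
  {p | ∃ x ∈ W, x p = 1 ∧ ∀ q, p < q → x q = 0}

open Classical in
lemma finrank_le_card_pivots (W : Submodule ℂ (Fin (N + 1) → ℂ)) (j : Fin (N + 1))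
    (V : Submodule ℂ (Fin (j + 1) → ℂ)) (hV : ∀ x ∈ V, padMap (j + 1) (N + 1) x ∈ W) :
    Module.finrank ℂ V ≤ (Finset.univ.filter fun p => p ∈ pivots W ∧ p ≤ j).card := by
  set J := Finset.univ.filter fun p => p ∈ pivots W ∧ p ≤ j
  let f : V →ₗ[ℂ] (J → ℂ) :=
    (LinearMap.funLeft ℂ ℂ (Subtype.val : J → Fin (N + 1))) ∘ₗ padMap (j + 1) (N + 1) ∘ₗ V.subtype
  have hf : Function.Injective f := by
    rw [← LinearMap.ker_eq_bot, LinearMap.ker_eq_bot']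
    intro x hx
    by_contra hne
    have hne' : ∃ p, (x : Fin (j + 1) → ℂ) p ≠ 0 := by
      by_contra! h
      exact hne (Subtype.ext (funext h))
    obtain ⟨p, hp, hmax⟩ : ∃ p, (x : Fin (j + 1) → ℂ) p ≠ 0 ∧
        ∀ q, p < q → (x : Fin (j + 1) → ℂ) q = 0 := by
      obtain ⟨p, hp⟩ := (Finset.univ.filter fun p => (x : Fin (j + 1) → ℂ) p ≠ 0).exists_maximal
        (by simpa [Finset.Nonempty] using hne')
      have h1 := hp.1
      refine ⟨p, by simpa using h1, fun q hq => ?_⟩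
      by_contra h
      exact absurd (hp.2 (by simpa using h) hq.le) (not_le.2 hq)
    set p' : Fin (N + 1) := Fin.castLE (Nat.succ_le_of_lt j.2) p with hp'
    have hxp : padMap (j + 1) (N + 1) (x : Fin (j + 1) → ℂ) p' = (x : Fin (j + 1) → ℂ) p := by
      have : p'.val < j.val + 1 := p.2
      rw [padMap_apply, dif_pos this]
      rfl
    have hpJ : p' ∈ J := by
      refine Finset.mem_filter.2 ⟨Finset.mem_univ _, ⟨((x : Fin (j + 1) → ℂ) p)⁻¹ •
        padMap (j + 1) (N + 1) (x : Fin (j + 1) → ℂ), W.smul_mem _ (hV _ x.2), ?_, ?_⟩, ?_⟩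
      · rw [Pi.smul_apply, hxp, smul_eq_mul, inv_mul_cancel₀ hp]
      · intro q hq
        rw [Pi.smul_apply, padMap_apply]
        split_ifs with h
        · rw [hmax ⟨q, h⟩ hq, smul_zero]
        · simp
      · exact Nat.lt_succ_iff.1 p.2
    have := congrFun hx ⟨p', hpJ⟩
    exact hp (hxp ▸ this)
  have := LinearMap.finrank_le_finrank_of_injective hf
  simpa using this

/-- Abel summation. -/
lemma sum_sub_mul_card (ν : ℕ → ℕ) (hν : Antitone ν) (hν0 : ν (N + 1) = 0)
    (J : Finset (Fin (N + 1))) :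
    ∑ j : Fin (N + 1), (ν j - ν (j + 1)) * (J.filter (· ≤ j)).card = ∑ p ∈ J, ν p := by
  simp only [Finset.card_filter, Finset.mul_sum]
  rw [Finset.sum_comm]
  refine Finset.sum_congr rfl fun p _ => ?_
  have h1 : ∀ k, k ≤ N + 1 → ∑ j ∈ Finset.range k, (if p.val ≤ j then ν j - ν (j + 1) else 0) =
      if p.val ≤ k then ν p - ν k else 0 := by
    intro k
    induction k with
    | zero =>
      intro _
      by_cases h : p.val ≤ 0
      · simp [Nat.le_zero.1 h]
      · simp [h]
    | succ k ih =>
      intro hk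
      rw [Finset.sum_range_succ, ih (by omega)]
      have a1 := hν (Nat.le_succ k)
      by_cases h : p.val ≤ k
      · have a2 := hν h
        rw [if_pos h, if_pos h, if_pos (by omega)]
        simp only [Nat.succ_eq_add_one] at a1
        omega
      · rw [if_neg h, if_neg h]
        by_cases h' : p.val ≤ k + 1
        · rw [if_pos h', show p.val = k + 1 by omega]; simp
        · rw [if_neg h']
  have h2 := h1 (N + 1) le_rfl
  rw [Finset.sum_range, hν0, if_pos p.2.le] at h2
  simp only [tsub_zero] at h2
  rw [← h2]
  refine Finset.sum_congr rfl fun j _ => ?_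
  by_cases h : p ≤ j
  · rw [if_pos h, if_pos (Fin.le_def.1 h), mul_one]
  · rw [if_neg h, if_neg (fun h' => h (Fin.le_def.2 h')), mul_zero]

end FlagRep

section Growth
variable {N : ℕ}

lemma exists_poly_leadingMinor (M H : Matrix (Fin (N + 1)) (Fin (N + 1)) ℂ)
    (J : Finset (Fin (N + 1))) (j : Fin (N + 1)) {d : ℕ} (S : Submodule ℂ (Fin (j + 1) → ℂ))
    (hd : Module.finrank ℂ S = d)
    (hS : ∀ p ∈ J, (fun q : Fin (j + 1) => M (Fin.castLE (Nat.succ_le_of_lt j.2) q) p) ∈ S) :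
    ∃ q : ℂ[X], q.natDegree ≤ d ∧ ∀ t : ℂ, t ≠ 0 →
      (t ^ J.card) ^ (j.val + 1) * leadingMinor j (M * Matrix.diagonal (fun p =>
        (if p ∈ J then t ^ (N + 1) else 1) * (t ^ J.card)⁻¹) * H) = q.eval (t ^ (N + 1)) := by
  obtain ⟨P, hP1, hP2⟩ := exists_frame S hd
  set c : Fin (j + 1) → Fin (N + 1) := Fin.castLE (Nat.succ_le_of_lt j.2) with hc
  set A : Matrix (Fin (j + 1)) (Fin (N + 1)) ℂ :=
    Matrix.of fun q p => if p ∈ J then M (c q) p else 0 with hA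
  set B : Matrix (Fin (j + 1)) (Fin (N + 1)) ℂ :=
    Matrix.of fun q p => if p ∈ J then 0 else M (c q) p with hB
  set Hc := H.submatrix id c with hHc
  have hPA : P * (P.conjTranspose * A) = A := by
    ext q p
    have h1 : (fun q => A q p) ∈ LinearMap.range P.mulVecLin := by
      rw [hP2]
      by_cases hp : p ∈ J
      · simpa [hA, hp] using hS p hp
      · simp only [hA, Matrix.of_apply, hp, if_false]
        exact S.zero_mem
    rw [mem_range_frame hP1] at h1
    have := congrFun h1 q
    simpa [Matrix.mul_apply, Matrix.mulVec, dotProduct] using this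
  obtain ⟨q, hq1, hq2⟩ := exists_poly_det_add_smul (B * Hc) P (P.conjTranspose * A * Hc)
  refine ⟨q, hq1, fun t ht => ?_⟩
  rw [← hq2, leadingMinor, ← Matrix.mul_assoc, hPA]
  have hsm := fun X : Matrix (Fin (j + 1)) (Fin (j + 1)) ℂ => Matrix.det_smul X (t ^ J.card)
  simp only [Fintype.card_fin] at hsm
  rw [← hsm]
  congr 1
  have ht' : t ^ J.card ≠ 0 := pow_ne_zero _ ht
  generalize t ^ J.card = T at ht'
  generalize t ^ (N + 1) = z
  have e : ∀ (D : Fin (N + 1) → ℂ) x y, (M * Matrix.diagonal D * H) x y =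
      ∑ p, M x p * D p * H p y := by
    intro D x y
    rw [Matrix.mul_apply]
    exact Finset.sum_congr rfl fun p _ => by rw [Matrix.mul_diagonal]
  ext x y
  rw [Matrix.smul_apply, Matrix.submatrix_apply, e, Matrix.add_apply, Matrix.smul_apply,
    Matrix.mul_apply, Matrix.mul_apply, smul_eq_mul, smul_eq_mul, Finset.mul_sum, Finset.mul_sum,
    ← Finset.sum_add_distrib]
  refine Finset.sum_congr rfl fun p _ => ?_
  simp only [hA, hB, hHc, Matrix.of_apply, Matrix.submatrix_apply, id]
  rw [← hc]
  by_cases hp : p ∈ J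
  · simp only [hp, if_true]
    rw [show T * (M (c x) p * (z * T⁻¹) * H p (c y)) = T * T⁻¹ * (z * (M (c x) p * H p (c y))) by
      ring, mul_inv_cancel₀ ht']
    ring
  · simp only [hp, if_false]
    rw [show T * (M (c x) p * (1 * T⁻¹) * H p (c y)) = T * T⁻¹ * (M (c x) p * H p (c y)) by
      ring, mul_inv_cancel₀ ht']
    ring

variable {I : Type} [Fintype I]

open Classical in
theorem sum_pivots_le (a : I → Fin (N + 1) → ℕ) (ν : Fin (N + 1) → ℕ)
    (hsum : ∑ p, ν p = ∑ i, ∑ j : Fin (N + 1), a i j * (j.val + 1))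
    {Φ : (I → SL (N + 1)) → ℂ} (hΦ : Φ ∈ minorSpan a) (hhw : IsRightHW (fun p => (ν p : ℤ)) Φ)
    (g : I → SL (N + 1)) (hg : Φ g ≠ 0) (W : Submodule ℂ (Fin (N + 1) → ℂ))
    (S : ∀ (_ : I) (j : Fin (N + 1)), Submodule ℂ (Fin (j + 1) → ℂ))
    (hS : ∀ i j, ∀ x ∈ W, padMap (N + 1) (j + 1) ((g i).val.mulVec x) ∈ S i j) :
    ∑ p with p ∈ pivots W, ν p ≤ ∑ i, ∑ j, a i j * Module.finrank ℂ (S i j) := by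
  set J := Finset.univ.filter fun p => p ∈ pivots W with hJ
  have hex : ∀ p, ∃ x : Fin (N + 1) → ℂ, (p ∈ J → x ∈ W) ∧ x p = 1 ∧ ∀ q, p < q → x q = 0 := by
    intro p
    by_cases hp : p ∈ pivots W
    · obtain ⟨x, h1, h2, h3⟩ := hp
      exact ⟨x, fun _ => h1, h2, h3⟩
    · exact ⟨Pi.single p 1, fun h => absurd (Finset.mem_filter.1 h).2 hp, by simp,
        fun q hq => by simp [hq.ne']⟩
  choose x hxW hx1 hx0 using hex
  have hudet : (Matrix.of fun q p => x p q).det = 1 := by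
    rw [Matrix.det_of_isUpperTriangular]
    · simp [hx1]
    · intro q p hqp
      exact hx0 p q hqp
  set u : SL (N + 1) := ⟨Matrix.of fun q p => x p q, hudet⟩ with hu
  have huU : SLIsUniUpper u := ⟨fun i => hx1 i, fun i j hij => hx0 j i hij⟩
  have hθ : ∀ t : ℂ, t ≠ 0 → (Matrix.diagonal (fun p : Fin (N + 1) =>
        (if p ∈ J then t ^ (N + 1) else 1) * (t ^ J.card)⁻¹)).det = 1 := by
    intro t ht
    have ht' : t ^ J.card ≠ 0 := pow_ne_zero _ ht
    rw [Matrix.det_diagonal, Finset.prod_mul_distrib, Finset.prod_ite_mem, Finset.univ_inter]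
    simp only [Finset.prod_const, Finset.card_univ, Fintype.card_fin]
    rw [inv_pow, ← pow_mul, ← pow_mul, mul_comm J.card]
    exact mul_inv_cancel₀ (pow_ne_zero _ ht)
  set D := ∑ i, ∑ j, a i j * Module.finrank ℂ (S i j) with hD
  have hspan : ∀ φ ∈ minorSpan a, ∃ q : ℂ[X], q.natDegree ≤ D ∧ ∀ (t : ℂ) (ht : t ≠ 0),
      (t ^ J.card) ^ (∑ p, ν p) * φ (fun i => g i * u * ⟨_, hθ t ht⟩) = q.eval (t ^ (N + 1)) := by
    intro φ hφ
    induction hφ using Submodule.span_induction with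
    | mem φ h =>
      obtain ⟨h, rfl⟩ := h
      choose q hq1 hq2 using fun i j => exists_poly_leadingMinor ((g i).val * u.val) (h i).val J j
        (S i j) rfl (fun p hp => by
          have h1 := hS i j (x p) (hxW p hp)
          have h2 : padMap (N + 1) (j + 1) ((g i).val.mulVec (x p)) =
              fun q => ((g i).val * u.val) (Fin.castLE (Nat.succ_le_of_lt j.2) q) p := by
            ext q
            have : q.val < N + 1 := by omega
            rw [padMap_apply, dif_pos this]
            rfl
          rwa [h2] at h1)
      refine ⟨∏ i, ∏ j, q i j ^ a i j, ?_, fun t ht => ?_⟩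
      · refine (natDegree_prod_le _ _).trans (Finset.sum_le_sum fun i _ =>
          (natDegree_prod_le _ _).trans (Finset.sum_le_sum fun j _ =>
          natDegree_pow_le.trans (Nat.mul_le_mul_left _ (hq1 i j))))
      · simp only [eval_prod, eval_pow, ← hq2 _ _ t ht, minorProd, hsum,
          mul_pow, ← Finset.prod_pow_eq_pow_sum, ← Finset.prod_mul_distrib]
        refine Finset.prod_congr rfl fun i _ => Finset.prod_congr rfl fun j _ => ?_
        congr 1
        simp only [← pow_mul]
        congr 1
        ring
    | zero => exact ⟨0, by simp, by simp⟩
    | add φ ψ _ _ hφ hψ =>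
      obtain ⟨q, hq1, hq2⟩ := hφ
      obtain ⟨r, hr1, hr2⟩ := hψ
      refine ⟨q + r, natDegree_add_le_of_degree_le hq1 hr1, fun t ht => ?_⟩
      rw [eval_add, ← hq2 t ht, ← hr2 t ht, Pi.add_apply, mul_add]
    | smul c φ _ hφ =>
      obtain ⟨q, hq1, hq2⟩ := hφ
      refine ⟨C c * q, (natDegree_C_mul_le _ _).trans hq1, fun t ht => ?_⟩
      rw [eval_mul, eval_C, ← hq2 t ht, Pi.smul_apply, smul_eq_mul]
      ring
  obtain ⟨q, hq1, hq2⟩ := hspan Φ hΦ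
  have hq3 : ∀ t : ℂ, t ≠ 0 → (t ^ (N + 1)) ^ (∑ p ∈ J, ν p) * Φ g = q.eval (t ^ (N + 1)) := by
    intro t ht
    have ht' : t ^ J.card ≠ 0 := pow_ne_zero _ ht
    have e := hhw.2 (fun i => g i * u) ⟨_, hθ t ht⟩
      (fun i j hij => Matrix.diagonal_apply_ne _ hij)
    simp only at e
    rw [← hq2 t ht, e, hhw.1 g u huU, ← mul_assoc]
    congr 1
    simp only [Matrix.diagonal_apply_eq, zpow_natCast, mul_pow, Finset.prod_mul_distrib, inv_pow]
    rw [← Finset.prod_pow_eq_pow_sum _ ν (t ^ J.card), Finset.prod_inv_distrib, mul_comm,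
      inv_mul_cancel_right₀ (Finset.prod_ne_zero_iff.2 fun p _ => pow_ne_zero _ ht')]
    rw [← Finset.prod_pow_eq_pow_sum, ← Finset.univ_inter J, ← Finset.prod_ite_mem]
    refine Finset.prod_congr rfl fun p _ => ?_
    by_cases hp : p ∈ J <;> simp [hp]
  have hpoly : C (Φ g) * X ^ (∑ p ∈ J, ν p) = q := by
    refine eq_of_infinite_eval_eq _ _ (Set.Infinite.mono (s := {s : ℂ | s ≠ 0}) ?_ ?_)
    · intro s hs
      obtain ⟨t, rfl⟩ := IsAlgClosed.exists_pow_nat_eq s (Nat.succ_pos N)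
      have ht : t ≠ 0 := fun h => hs (by simp [h])
      have := hq3 t ht
      simp only [Set.mem_ofPred_eq, eval_mul, eval_C, eval_pow, eval_X]
      rw [← hq3 t ht, mul_comm]
    · exact (Set.finite_singleton (0 : ℂ)).infinite_compl
  rw [← hpoly, natDegree_C_mul_X_pow _ _ hg] at hq1
  exact hq1
end Growth

section Sign
variable {B : Type} [Fintype B] [DecidableEq B] {β : B → Type} [∀ b, Fintype (β b)]
  [∀ b, DecidableEq (β b)]

open Equiv.Perm in
lemma sign_sigmaCongrRight_mulSingle (b : B) (π : Equiv.Perm (β b)) :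
    sign (sigmaCongrRight (Pi.mulSingle b π)) = sign π := by
  induction π using swap_induction_on with
  | one => rw [Pi.mulSingle_one]; exact (sign (α := Sigma β)).map_one.trans sign_one.symm
  | swap_mul f x y hxy ih =>
    rw [Pi.mulSingle_mul, ← sigmaCongrRight_mul, Equiv.Perm.sign_mul, Equiv.Perm.sign_mul, ih]
    congr 1
    have : sigmaCongrRight (Pi.mulSingle b (Equiv.swap x y)) =
        Equiv.swap (⟨b, x⟩ : Sigma β) ⟨b, y⟩ := by
      ext1 ⟨c, z⟩
      by_cases hc : c = b
      · subst hc
        simp only [Equiv.sigmaCongrRight_apply, Pi.mulSingle_eq_same]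
        rw [Equiv.swap_apply_def, Equiv.swap_apply_def]
        by_cases h1 : z = x
        · simp [h1]
        · by_cases h2 : z = y
          · subst h2; simp [h1]
          · simp [h1, h2]
      · simp only [Equiv.sigmaCongrRight_apply, Pi.mulSingle_eq_of_ne hc]
        rw [Equiv.swap_apply_of_ne_of_ne]
        · rfl
        · intro h; exact hc (congrArg Sigma.fst h)
        · intro h; exact hc (congrArg Sigma.fst h)
    rw [this, sign_swap hxy, sign_swap]
    intro h
    exact hxy (by simpa using h)

open Equiv.Perm in
lemma sign_sigmaCongrRight (τ : ∀ b, Equiv.Perm (β b)) :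
    sign (sigmaCongrRight τ) = ∏ b, sign (τ b) := by
  suffices h : ∀ (s : Finset B) (τ : ∀ b, Equiv.Perm (β b)), (∀ b ∉ s, τ b = 1) →
      sign (sigmaCongrRight τ) = ∏ b, sign (τ b) from h Finset.univ τ (by simp)
  intro s
  induction s using Finset.induction_on with
  | empty =>
    intro τ hτ
    have : τ = 1 := funext fun b => hτ b (by simp)
    subst this
    rw [sigmaCongrRight_one]
    simp
  | insert b s hb ih =>
    intro τ hτ
    have h1 : τ = Pi.mulSingle b (τ b) * Function.update τ b 1 := by
      ext1 c
      by_cases hc : c = b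
      · subst hc; simp
      · simp [hc]
    have h2 := ih (Function.update τ b 1) fun c hc => by
      by_cases hcb : c = b
      · subst hcb; simp
      · rw [Function.update_of_ne hcb]
        exact hτ c (by simp [hcb, hc])
    conv_lhs => rw [h1, ← sigmaCongrRight_mul, Equiv.Perm.sign_mul,
      sign_sigmaCongrRight_mulSingle, h2]
    rw [← Finset.mul_prod_erase _ _ (Finset.mem_univ b),
      ← Finset.mul_prod_erase _ _ (Finset.mem_univ b)]
    simp only [Function.update_self, Equiv.Perm.sign_one, one_mul]
    congr 1
    refine Finset.prod_congr rfl fun c hc => ?_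
    rw [Function.update_of_ne (Finset.ne_of_mem_erase hc)]

/-- Expansion of a determinant whose rows are grouped into blocks, by symmetrising every block. -/
lemma det_block_expansion {X : Type} (v : ∀ b, β b → X → ℂ) (π : Sigma β → X)
    (K : B → Sigma β → ℂ) :
    (∏ b, ((Fintype.card (β b)).factorial : ℂ)) *
      (Matrix.of fun r c : Sigma β => v r.1 r.2 (π c) * K r.1 c).det =
    ∑ σ : Equiv.Perm (Sigma β), ((Equiv.Perm.sign σ : ℤ) : ℂ) * (∏ r : Sigma β, K r.1 (σ r)) *
      ∏ b, (Matrix.of fun p p' : β b => v b p (π (σ ⟨b, p'⟩))).det := by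
  have h1 : ∀ σ : Equiv.Perm (Sigma β),
      ∏ b, (Matrix.of fun p p' : β b => v b p (π (σ ⟨b, p'⟩))).det =
      ∑ τ : ∀ b, Equiv.Perm (β b), ((Equiv.Perm.sign (Equiv.Perm.sigmaCongrRight τ) : ℤ) : ℂ) *
        ∏ r : Sigma β, v r.1 (τ r.1 r.2) (π (σ r)) := by
    intro σ
    simp only [Matrix.det_apply', Matrix.of_apply]
    rw [Finset.prod_univ_sum, Fintype.piFinset_univ]
    refine Finset.sum_congr rfl fun τ _ => ?_
    rw [Finset.prod_mul_distrib, sign_sigmaCongrRight, Fintype.prod_sigma]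
    simp
  simp only [h1, Finset.mul_sum]
  rw [Finset.sum_comm]
  have h2 : ∀ τ : ∀ b, Equiv.Perm (β b), ∑ σ : Equiv.Perm (Sigma β),
      ((Equiv.Perm.sign σ : ℤ) : ℂ) * (∏ r : Sigma β, K r.1 (σ r)) *
      (((Equiv.Perm.sign (Equiv.Perm.sigmaCongrRight τ) : ℤ) : ℂ) *
        ∏ r : Sigma β, v r.1 (τ r.1 r.2) (π (σ r))) =
      (Matrix.of fun r c : Sigma β => v r.1 r.2 (π c) * K r.1 c).det := by
    intro τ
    rw [← Matrix.det_transpose, Matrix.det_apply']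
    refine Fintype.sum_equiv (Equiv.mulRight (Equiv.Perm.sigmaCongrRight τ)⁻¹) _ _ fun σ => ?_
    simp only [Equiv.coe_mulRight, Equiv.Perm.sign_mul, Equiv.Perm.sign_inv, Matrix.transpose_apply,
      Matrix.of_apply, Equiv.Perm.mul_apply]
    rw [← Equiv.prod_comp (Equiv.Perm.sigmaCongrRight τ) (fun r =>
      v r.1 r.2 (π (σ ((Equiv.Perm.sigmaCongrRight τ)⁻¹ r))) *
        K r.1 (σ ((Equiv.Perm.sigmaCongrRight τ)⁻¹ r)))]
    have h3 : ∀ r, (Equiv.Perm.sigmaCongrRight τ)⁻¹ (Equiv.Perm.sigmaCongrRight τ r) = r :=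
      fun r => Equiv.symm_apply_apply _ _
    simp only [h3, Finset.prod_mul_distrib]
    have h4 : ∀ r, v ((Equiv.Perm.sigmaCongrRight τ) r).fst ((Equiv.Perm.sigmaCongrRight τ) r).snd
        (π (σ r)) = v r.1 (τ r.1 r.2) (π (σ r)) := fun r => rfl
    have h5 : ∀ r, K ((Equiv.Perm.sigmaCongrRight τ) r).fst (σ r) = K r.1 (σ r) := fun r => rfl
    simp only [h4, h5]
    push_cast
    ring
  rw [Finset.sum_congr rfl fun τ _ => h2 τ]
  simp [Finset.card_univ, Fintype.card_perm]
end Sign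

/-- A symmetric form of the Cauchy-Binet formula, as a sum over all functions. -/
lemma factorial_mul_det_mul {j n : ℕ} (X : Matrix (Fin j) (Fin n) ℂ) (Y :
    Matrix (Fin n) (Fin j) ℂ) :
    (j.factorial : ℂ) * (X * Y).det =
      ∑ f : Fin j → Fin n, (X.submatrix id f).det * (Y.submatrix f id).det := by
  have h1 : ∀ f : Fin j → Fin n, (X.submatrix id f).det * (Y.submatrix f id).det =
      ∑ τ : Equiv.Perm (Fin j), (X.submatrix id (f ∘ τ)).det * ∏ k, Y (f (τ k)) k := by
    intro f
    rw [Matrix.det_apply' (Y.submatrix f id), Finset.mul_sum]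
    refine Finset.sum_congr rfl fun τ _ => ?_
    have : X.submatrix id (f ∘ τ) = (X.submatrix id f).submatrix id τ := rfl
    rw [this, Matrix.det_permute']
    simp only [Matrix.submatrix_apply, id]
    ring
  simp only [h1]
  rw [Finset.sum_comm]
  have h2 : ∀ τ : Equiv.Perm (Fin j), ∑ f : Fin j → Fin n,
      (X.submatrix id (f ∘ τ)).det * ∏ k, Y (f (τ k)) k = (X * Y).det := by
    intro τ
    have h3 : (X * Y).det = ∑ f : Fin j → Fin n, (X.submatrix id f).det * ∏ k, Y (f k) k := by
      rw [Matrix.det_apply']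
      simp only [Matrix.mul_apply, Finset.prod_univ_sum, Fintype.piFinset_univ, Finset.mul_sum]
      rw [Finset.sum_comm]
      refine Finset.sum_congr rfl fun f _ => ?_
      rw [Matrix.det_apply', Finset.sum_mul]
      refine Finset.sum_congr rfl fun σ _ => ?_
      rw [Finset.prod_mul_distrib]
      simp only [Matrix.submatrix_apply, id]
      ring
    rw [h3]
    exact Fintype.sum_equiv (Equiv.arrowCongr τ.symm (Equiv.refl _)) _ _ fun f => rfl
  rw [Finset.sum_congr rfl fun τ _ => h2 τ]
  simp [Finset.card_univ, Fintype.card_perm]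

/-- If the functions `a f` are the complex conjugates of the `b f`, every linear combination of
them is a combination of specialisations of the kernel `∑ f, a f g * b f h`. -/
lemma sum_mem_span_kernel {F X Y : Type*} [Fintype F] (a : F → X → ℂ) (b : F → Y → ℂ)
    (hab : ∀ g, ∃ h, ∀ f, a f g = star (b f h)) (w : F → ℂ) :
    (fun g => ∑ f, w f * a f g) ∈
      Submodule.span ℂ (Set.range fun (h : Y) (g : X) => ∑ f, a f g * b f h) := by
  let Λ : EuclideanSpace ℂ F →ₗ[ℂ] (X → ℂ) :=
    { toFun := fun w g => ∑ f, w f * a f g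
      map_add' := fun x y => by ext g; simp [add_mul, Finset.sum_add_distrib]
      map_smul' := fun c x => by ext g; simp [mul_assoc, Finset.mul_sum] }
  let M : Submodule ℂ (EuclideanSpace ℂ F) :=
    Submodule.span ℂ (Set.range fun h => WithLp.toLp 2 fun f => b f h)
  obtain ⟨y, hy, z, hz, hyz⟩ := M.exists_add_mem_mem_orthogonal (WithLp.toLp 2 w)
  have hΛz : Λ z = 0 := by
    ext g
    obtain ⟨h, hh⟩ := hab g
    have := (Submodule.mem_orthogonal M z).1 hz _ (Submodule.subset_span ⟨h, rfl⟩)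
    rw [PiLp.inner_apply] at this
    show ∑ f, z f * a f g = 0
    rw [← this]
    refine Finset.sum_congr rfl fun f _ => ?_
    rw [hh f]
    simp
  have hΛy : Λ y ∈ Submodule.span ℂ (Set.range fun (h : Y) (g : X) => ∑ f, a f g * b f h) := by
    have : M.map Λ ≤ Submodule.span ℂ (Set.range fun (h : Y) (g : X) => ∑ f, a f g * b f h) := by
      rw [Submodule.map_span_le]
      rintro _ ⟨h, rfl⟩
      refine Submodule.subset_span ⟨h, ?_⟩
      ext g
      exact Finset.sum_congr rfl fun f _ => mul_comm _ _
    exact this ⟨y, hy, rfl⟩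
  have : Λ (WithLp.toLp 2 w) = Λ y := by rw [hyz, map_add, hΛz, add_zero]
  rw [← this] at hΛy
  exact hΛy

section KernelHW
variable {n : ℕ} {I : Type} [Fintype I]

/-- The product over blocks of the minors of `g` on leading rows and prescribed columns. -/
noncomputable def rowMinors (a : I → Fin n → ℕ)
    (f : ∀ b : (Σ i, Σ j, Fin (a i j)), Fin (b.2.1 + 1) → Fin n) (g : I → SL n) : ℂ :=
  ∏ b : (Σ i, Σ j, Fin (a i j)),
    ((g b.1).val.submatrix (Fin.castLE (Nat.succ_le_of_lt b.2.1.2)) (f b)).det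

/-- The product over blocks of the minors of `g` on leading columns and prescribed rows. -/
noncomputable def colMinors (a : I → Fin n → ℕ)
    (f : ∀ b : (Σ i, Σ j, Fin (a i j)), Fin (b.2.1 + 1) → Fin n) (g : I → SL n) : ℂ :=
  ∏ b : (Σ i, Σ j, Fin (a i j)),
    ((g b.1).val.submatrix (f b) (Fin.castLE (Nat.succ_le_of_lt b.2.1.2))).det

lemma factorial_mul_minorProd [DecidableEq I] (a : I → Fin n → ℕ) (g h : I → SL n) :
    (∏ b : (Σ i, Σ j, Fin (a i j)), ((b.2.1 + 1 : ℕ).factorial : ℂ)) * minorProd a (g * h) =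
      ∑ f, rowMinors a f g * colMinors a f h := by
  have h1 : minorProd a (g * h) =
      ∏ b : (Σ i, Σ j, Fin (a i j)), leadingMinor b.2.1 ((g * h) b.1).val := by
    simp [minorProd, Fintype.prod_sigma]
  rw [h1, ← Finset.prod_mul_distrib]
  have h2 : ∀ b : (Σ i, Σ j, Fin (a i j)),
      ((b.2.1 + 1 : ℕ).factorial : ℂ) * leadingMinor b.2.1 ((g * h) b.1).val =
      ∑ f : Fin (b.2.1 + 1) → Fin n,
        ((g b.1).val.submatrix (Fin.castLE (Nat.succ_le_of_lt b.2.1.2)) f).det *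
        ((h b.1).val.submatrix f (Fin.castLE (Nat.succ_le_of_lt b.2.1.2))).det := by
    intro b
    have := factorial_mul_det_mul
      ((g b.1).val.submatrix (Fin.castLE (Nat.succ_le_of_lt b.2.1.2)) id)
      ((h b.1).val.submatrix id (Fin.castLE (Nat.succ_le_of_lt b.2.1.2)))
    exact this
  simp only [h2]
  rw [Finset.prod_univ_sum, Fintype.piFinset_univ]
  refine Finset.sum_congr rfl fun f _ => ?_
  rw [Finset.prod_mul_distrib]
  rfl

lemma sum_rowMinors_mem [DecidableEq I] (a : I → Fin n → ℕ)
    (w : (∀ b : (Σ i, Σ j, Fin (a i j)), Fin (b.2.1 + 1) → Fin n) → ℂ) :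
    (fun g => ∑ f, w f * rowMinors a f g) ∈ minorSpan a := by
  have h := sum_mem_span_kernel (rowMinors a) (colMinors a) (fun g => by
    refine ⟨fun i => ⟨(g i).val.conjTranspose, by rw [Matrix.det_conjTranspose, (g i).2]; simp⟩,
      fun f => ?_⟩
    simp only [rowMinors, colMinors, star_prod]
    refine Finset.prod_congr rfl fun b _ => ?_
    rw [← Matrix.det_conjTranspose]
    congr 1
    ext p q
    simp) w
  refine Submodule.span_le.2 ?_ h
  rintro _ ⟨k, rfl⟩
  have : (fun g => ∑ f, rowMinors a f g * colMinors a f k) =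
      (∏ b : (Σ i, Σ j, Fin (a i j)), ((b.2.1 + 1 : ℕ).factorial : ℂ)) •
        (fun g : I → SL n => minorProd a (g * k)) := by
    ext g
    rw [Pi.smul_apply, smul_eq_mul, factorial_mul_minorProd]
  simp only [this]
  exact Submodule.smul_mem _ _ (Submodule.subset_span ⟨k, rfl⟩)

/-- The determinant of the linear system cut out by flags gives a highest weight function. -/
theorem hasHWFun_of_kernel {m : ℕ} (a : I → Fin n → ℕ) (ν : Fin n → ℕ) (hν : Antitone ν)
    (hm : ∀ p, ν p ≤ m) (C : I → Matrix (Fin m) (Fin m) ℂ)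
    (κ : (Σ i, Σ j, Fin (a i j)) → Fin m) (hcard : ∑ p, ν p = ∑ i, ∑ j, a i j * (j + 1))
    (g₀ : I → SL n)
    (hinj : ∀ x : Fin n → Fin m → ℂ, (∀ p q, q.val + ν p < m → x p q = 0) →
      (∀ (b : (Σ i, Σ j, Fin (a i j))) (p : Fin n), p ≤ b.2.1 →
        ∑ p', ∑ q', (g₀ b.1).val p p' * C b.1 q' (κ b) * x p' q' = 0) → x = 0) :
    HasHWFun a (fun p => (ν p : ℤ)) := by
  classical
  let R := Σ b : (Σ i, Σ j, Fin (a i j)), Fin (b.2.1 + 1)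
  let S := {c : Fin n × Fin m // m ≤ c.2.val + ν c.1}
  have hfib : ∀ p, (Finset.univ.filter fun q : Fin m => m ≤ q.val + ν p).card = ν p := by
    intro p
    have h1 : (Finset.univ.filter fun q : Fin m => q.val < m - ν p).card = m - ν p := by
      rw [Fin.card_filter_val_lt]; simp
    have h2 := Finset.card_filter_add_card_filter_not (s := (Finset.univ : Finset (Fin m)))
      (fun q : Fin m => q.val < m - ν p)
    rw [h1, Finset.card_univ, Fintype.card_fin] at h2
    have h3 : (Finset.univ.filter fun q : Fin m => m ≤ q.val + ν p) =
        Finset.univ.filter fun q : Fin m => ¬ q.val < m - ν p := by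
      ext q
      simp only [Finset.mem_filter, Finset.mem_univ, true_and]
      omega
    have := hm p
    rw [h3]; omega
  have hprodS : ∀ (y : Fin n → ℂ), ∏ c : S, y c.1.1 = ∏ p, y p ^ ν p := by
    intro y
    rw [← Finset.prod_subtype (Finset.univ.filter fun c : Fin n × Fin m => m ≤ c.2.val + ν c.1)
      (by simp) (fun c => y c.1), Finset.prod_filter, Fintype.prod_prod_type]
    refine Finset.prod_congr rfl fun p _ => ?_
    rw [← Finset.prod_filter]
    simp only [Finset.prod_const, hfib]
  have hcardS : Fintype.card S = ∑ p, ν p := by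
    rw [Fintype.card_subtype, Finset.card_filter, Fintype.sum_prod_type]
    refine Finset.sum_congr rfl fun p _ => ?_
    rw [← Finset.card_filter, hfib]
  have hcardR : Fintype.card R = ∑ i, ∑ j, a i j * (j + 1) := by
    simp [R, Fintype.card_sigma, Fintype.sum_sigma]
  let e : R ≃ S := Fintype.equivOfCardEq (by rw [hcardR, hcardS, hcard])
  let L : (I → SL n) → Matrix R R ℂ := fun g => Matrix.of fun r c =>
    (g r.1.1).val (Fin.castLE (Nat.succ_le_of_lt r.1.2.1.2) r.2) (e c).1.1 *
      C r.1.1 (e c).1.2 (κ r.1)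
  refine ⟨fun g => (L g).det, ?_, ?_, ?_, ?_⟩
  · have h0 : (∏ b : (Σ i, Σ j, Fin (a i j)), ((Fintype.card (Fin (b.2.1 + 1))).factorial :
        ℂ)) ≠ 0 :=
      Finset.prod_ne_zero_iff.2 fun b _ => Nat.cast_ne_zero.2 (Nat.factorial_ne_zero _)
    have h1 : (∏ b : (Σ i, Σ j, Fin (a i j)),
        ((Fintype.card (Fin (b.2.1 + 1))).factorial : ℂ)) • (fun g => (L g).det) ∈ minorSpan a := by
      have h2 : (∏ b : (Σ i, Σ j, Fin (a i j)),
          ((Fintype.card (Fin (b.2.1 + 1))).factorial : ℂ)) • (fun g => (L g).det) =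
          ∑ σ : Equiv.Perm R, (((Equiv.Perm.sign σ : ℤ) : ℂ) *
            (∏ r : R, C r.1.1 (e (σ r)).1.2 (κ r.1))) •
            rowMinors a (fun b p' => (e (σ ⟨b, p'⟩)).1.1) := by
        ext g
        have := det_block_expansion (β := fun b : (Σ i, Σ j, Fin (a i j)) => Fin (b.2.1 + 1))
          (fun b p x => (g b.1).val (Fin.castLE (Nat.succ_le_of_lt b.2.1.2) p) x)
          (fun c => (e c).1.1) (fun b c => C b.1 (e c).1.2 (κ b))
        rw [Pi.smul_apply, smul_eq_mul]
        refine this.trans ?_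
        rw [Finset.sum_apply]
        rfl
      rw [h2]
      refine Submodule.sum_mem _ fun σ _ => Submodule.smul_mem _ _ ?_
      have := sum_rowMinors_mem a (Pi.single (fun b p' => (e (σ ⟨b, p'⟩)).1.1) 1)
      convert this using 1
      ext g
      simp [Pi.single_apply]
    exact (Submodule.smul_mem_iff _ h0).1 h1
  · intro h
    have h1 : (L g₀).det = 0 := congrFun h g₀
    obtain ⟨v, hv0, hv⟩ := Matrix.exists_mulVec_eq_zero_iff.2 h1
    let x : Fin n → Fin m → ℂ := fun p q =>
      if h : m ≤ q.val + ν p then v (e.symm ⟨(p, q), h⟩) else 0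
    have hx : x = 0 := by
      refine hinj x (fun p q hpq => dif_neg (by omega)) fun b p hp => ?_
      have h2 := congrFun hv ⟨b, ⟨p.val, Nat.lt_succ_of_le hp⟩⟩
      rw [Pi.zero_apply] at h2
      rw [← h2]
      simp only [Matrix.mulVec, dotProduct]
      rw [← Equiv.sum_comp e.symm]
      rw [← Fintype.sum_prod_type' (fun p' q' => (g₀ b.1).val p p' * C b.1 q' (κ b) * x p' q')]
      rw [← Finset.sum_filter_add_sum_filter_not Finset.univ
        (fun c : Fin n × Fin m => m ≤ c.2.val + ν c.1)]
      rw [Finset.sum_eq_zero (s := Finset.univ.filter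
        (fun c : Fin n × Fin m => ¬ m ≤ c.2.val + ν c.1)), add_zero]
      · rw [Finset.sum_subtype (Finset.univ.filter
          fun c : Fin n × Fin m => m ≤ c.2.val + ν c.1)
          (p := fun c : Fin n × Fin m => m ≤ c.2.val + ν c.1) (by simp)]
        refine Finset.sum_congr rfl fun c _ => ?_
        have h3 : x c.1.1 c.1.2 = v (e.symm c) := dif_pos c.2
        rw [h3]
        simp [L]
      · intro c hc
        have : x c.1 c.2 = 0 := dif_neg (Finset.mem_filter.1 hc).2
        rw [this, mul_zero]
    refine hv0 (funext fun r => ?_)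
    have h4 : x (e r).1.1 (e r).1.2 = v (e.symm (e r)) := dif_pos (e r).2
    rw [Equiv.symm_apply_apply, hx] at h4
    exact h4.symm
  · intro g u hu
    let M : Matrix S S ℂ := Matrix.of fun c' c => if c'.1.2 = c.1.2 then u.val c'.1.1 c.1.1 else 0
    have hM : M.det = 1 := by
      have hT : M.BlockTriangular (fun c : S => c.1.1) := fun c' c hc => by
        simp only [M, Matrix.of_apply, hu.2 _ _ hc, ite_self]
      rw [hT.det]
      refine Finset.prod_eq_one fun p _ => ?_
      have : M.toSquareBlock (fun c : S => c.1.1) p = 1 := by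
        ext c' c
        rw [Matrix.toSquareBlock_def, Matrix.of_apply, Matrix.one_apply]
        have h1 : c'.1.1.1 = p := c'.2
        have h2 : c.1.1.1 = p := c.2
        simp only [M, Matrix.of_apply, h1, h2, hu.1]
        refine if_congr ?_ rfl rfl
        rw [Subtype.ext_iff, Subtype.ext_iff, Prod.ext_iff, h1, h2]
        simp
      rw [this, Matrix.det_one]
    have hL : L (fun i => g i * u) = L g * M.submatrix e e := by
      ext r c
      simp only [L, Matrix.mul_apply, Matrix.of_apply, Matrix.submatrix_apply, M,
        Matrix.SpecialLinearGroup.coe_mul]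
      rw [Equiv.sum_comp e fun c' : S =>
        (g r.1.1).val (Fin.castLE (Nat.succ_le_of_lt r.1.2.1.2) r.2) c'.1.1 *
          C r.1.1 c'.1.2 (κ r.1) * if c'.1.2 = (e c).1.2 then u.val c'.1.1 (e c).1.1 else 0]
      rw [← Finset.sum_subtype (Finset.univ.filter
          fun c : Fin n × Fin m => m ≤ c.2.val + ν c.1)
          (p := fun c : Fin n × Fin m => m ≤ c.2.val + ν c.1) (by simp) fun c' =>
        (g r.1.1).val (Fin.castLE (Nat.succ_le_of_lt r.1.2.1.2) r.2) c'.1 *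
          C r.1.1 c'.2 (κ r.1) * if c'.2 = (e c).1.2 then u.val c'.1 (e c).1.1 else 0]
      rw [Finset.sum_filter, Fintype.sum_prod_type, Finset.sum_mul]
      refine Finset.sum_congr rfl fun p'' _ => ?_
      rw [Finset.sum_eq_single (e c).1.2]
      · by_cases h1 : m ≤ (e c).1.2.val + ν p''
        · simp only [h1, if_true]
          ring
        · simp only [h1, if_false]
          have h2 := (e c).2
          have h3 : (e c).1.1 < p'' := by
            by_contra h4
            have := hν (not_lt.1 h4)
            omega
          rw [hu.2 _ _ h3]; ring
      · intro q _ hq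
        simp [hq]
      · simp
    show (L fun i => g i * u).det = (L g).det
    rw [hL, Matrix.det_mul, Matrix.det_submatrix_equiv_self, hM, mul_one]
  · intro g t ht
    have hL : L (fun i => g i * t) = Matrix.of fun r c => t.val (e c).1.1 (e c).1.1 * L g r c := by
      ext r c
      simp only [L, Matrix.of_apply, Matrix.SpecialLinearGroup.coe_mul, Matrix.mul_apply]
      rw [Finset.sum_eq_single (e c).1.1]
      · ring
      · intro p _ hp
        rw [ht _ _ hp, mul_zero]
      · simp
    show (L fun i => g i * t).det = _
    rw [hL, Matrix.det_mul_row, Equiv.prod_comp e fun c => t.val c.1.1 c.1.1,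
      hprodS fun p => t.val p p]
    simp

end KernelHW

section FlagBasis
variable {V : Type*} [AddCommGroup V] [Module ℂ V] [FiniteDimensional ℂ V]

lemma exists_linearIndependent_extend_fin (W : Submodule ℂ V) {r : ℕ} (v : Fin r → V)
    (hv : LinearIndependent ℂ v) (hvW : ∀ q, v q ∈ W) (s : ℕ) (hrs : r ≤ s)
    (hs : s ≤ Module.finrank ℂ W) :
    ∃ v' : Fin s → V, LinearIndependent ℂ v' ∧ (∀ q, v' q ∈ W) ∧
      ∀ q : Fin r, v' (Fin.castLE hrs q) = v q := by
  induction s, hrs using Nat.le_induction with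
  | base => exact ⟨v, hv, hvW, fun q => rfl⟩
  | succ s hrs ih =>
    obtain ⟨v', h1, h2, h3⟩ := ih (by omega)
    obtain ⟨w, hwW, hw⟩ : ∃ w ∈ W, w ∉ Submodule.span ℂ (Set.range v') := by
      by_contra! h
      have := Submodule.finrank_mono (show W ≤ Submodule.span ℂ (Set.range v') from h)
      rw [finrank_span_eq_card h1, Fintype.card_fin] at this
      omega
    refine ⟨Fin.snoc v' w, linearIndependent_finSnoc.2 ⟨h1, hw⟩, fun q => ?_, fun q => ?_⟩
    · induction q using Fin.lastCases with
      | last => simpa using hwW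
      | cast q => simpa using h2 q
    · have : Fin.castLE (hrs.trans (Nat.le_succ s)) q = (Fin.castLE hrs q).castSucc := rfl
      rw [this, Fin.snoc_castSucc, h3]

lemma exists_linearIndependent_flag (S : ℕ → Submodule ℂ V) (hS : Monotone S) (K : ℕ) :
    ∃ v : Fin (Module.finrank ℂ (S K)) → V, LinearIndependent ℂ v ∧ (∀ q, v q ∈ S K) ∧
      ∀ k ≤ K, ∀ q, q.val < Module.finrank ℂ (S k) → v q ∈ S k := by
  induction K with
  | zero =>
    obtain ⟨v, h1, h2, h3⟩ := exists_linearIndependent_extend_fin (S 0) (Fin.elim0 : Fin 0 → V)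
      (linearIndependent_empty_type) (fun q => q.elim0) _ (Nat.zero_le _) le_rfl
    refine ⟨v, h1, h2, fun k hk q _ => ?_⟩
    rw [Nat.le_zero.1 hk]
    exact h2 q
  | succ K ih =>
    obtain ⟨v, h1, h2, h3⟩ := ih
    obtain ⟨v', h1', h2', h3'⟩ := exists_linearIndependent_extend_fin (S (K + 1)) v h1
      (fun q => hS (Nat.le_succ K) (h2 q)) _ (Submodule.finrank_mono (hS (Nat.le_succ K))) le_rfl
    refine ⟨v', h1', h2', fun k hk q hq => ?_⟩
    rcases Nat.le_succ_iff.1 hk with hk | rfl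
    · have h4 : q.val < Module.finrank ℂ (S K) := hq.trans_le (Submodule.finrank_mono (hS hk))
      have h5 := h3 k hk ⟨q, h4⟩ hq
      rw [← h3'] at h5
      exact h5
    · exact h2' q

/-- A basis adapted to a chain of subspaces. -/
lemma exists_basis_flag (S : ℕ → Submodule ℂ V) (hS : Monotone S) (d : ℕ)
    (hd : Module.finrank ℂ V = d) (K : ℕ) (hK : S K = ⊤) :
    ∃ b : Module.Basis (Fin d) ℂ V, ∀ k ≤ K, ∀ x,
      x ∈ S k ↔ ∀ q : Fin d, Module.finrank ℂ (S k) ≤ q.val → b.repr x q = 0 := by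
  obtain ⟨v, h1, -, h3⟩ := exists_linearIndependent_flag S hS K
  have hfin : Module.finrank ℂ (S K) = d := by rw [hK, finrank_top, hd]
  have hcast : ∃ v' : Fin d → V, LinearIndependent ℂ v' ∧
      ∀ k ≤ K, ∀ q, q.val < Module.finrank ℂ (S k) → v' q ∈ S k := by
    refine ⟨v ∘ Fin.cast hfin.symm, h1.comp _ (Fin.cast_injective _), fun k hk q hq => ?_⟩
    exact h3 k hk _ hq
  obtain ⟨v', h1', h3'⟩ := hcast
  by_cases hd0 : d = 0
  · subst hd0
    have := Module.finrank_zero_iff.1 hd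
    exact ⟨Module.Basis.empty V, fun k _ x => by
      rw [Subsingleton.elim x 0]; simp⟩
  have : Nonempty (Fin d) := ⟨⟨0, Nat.pos_of_ne_zero hd0⟩⟩
  let b := basisOfLinearIndependentOfCardEqFinrank h1' (by rw [Fintype.card_fin, hd])
  have hb : ∀ q, b q = v' q := fun q => by
    simp [b]
  refine ⟨b, fun k hk x => ?_⟩
  have hle : Module.finrank ℂ (S k) ≤ d := hd ▸ Submodule.finrank_le _
  have hspan : Submodule.span ℂ (Set.range fun q : Fin (Module.finrank ℂ (S k)) =>
      v' (Fin.castLE hle q)) = S k := by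
    refine Submodule.eq_of_le_of_finrank_eq ?_ ?_
    · rw [Submodule.span_le]
      rintro _ ⟨q, rfl⟩
      exact h3' k hk _ q.2
    · rw [finrank_span_eq_card, Fintype.card_fin]
      exact h1'.comp _ (Fin.castLE_injective hle)
  constructor
  · intro hx q hq
    rw [← hspan] at hx
    have : Submodule.span ℂ (Set.range fun q : Fin (Module.finrank ℂ (S k)) =>
      v' (Fin.castLE hle q)) ≤ LinearMap.ker (b.coord q) := by
      rw [Submodule.span_le]
      rintro _ ⟨q', rfl⟩
      have hne : Fin.castLE hle q' ≠ q := by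
        intro h
        have := congrArg Fin.val h
        have h2 := q'.2
        simp only [Fin.val_castLE] at this
        omega
      show b.coord q (v' (Fin.castLE hle q')) = 0
      rw [← hb, Module.Basis.coord_apply, Module.Basis.repr_self, Finsupp.single_eq_of_ne hne.symm]
    exact this hx
  · intro h
    rw [← b.sum_repr x]
    refine Submodule.sum_mem _ fun q _ => ?_
    by_cases hq : q.val < Module.finrank ℂ (S k)
    · rw [hb]
      exact Submodule.smul_mem _ _ (h3' k hk q hq)
    · rw [h q (not_lt.1 hq), zero_smul]
      exact Submodule.zero_mem _

end FlagBasis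

section FlagPaths
variable {N : ℕ} {I : Type} {X : FlagV N I → Type} [∀ v, AddCommGroup (X v)]
  [∀ v, Module ℂ (X v)]

/-- The composite of the arrows from the `j`-th vertex of the chain to its end. -/
noncomputable def flagPad (R : QuiverRep (flagSrc (N := N) (I := I)) flagTgt X) (j : Fin (N + 1)) :
    X (.inl j) →ₗ[ℂ] X (.inl (Fin.last N)) :=
  Fin.reverseInduction (motive := fun j => X (.inl j) →ₗ[ℂ] X (.inl (Fin.last N)))
    LinearMap.id (fun j f => f ∘ₗ R (.inl j)) j

/-- The composite of the arrows from the centre to the `j`-th vertex of an outgoing chain. -/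
noncomputable def flagTrunc (R : QuiverRep (flagSrc (N := N) (I := I)) flagTgt X) (i : I)
    (j : Fin (N + 1)) : X (.inl (Fin.last N)) →ₗ[ℂ] X (.inr (i, j)) :=
  Fin.reverseInduction (motive := fun j => X (.inl (Fin.last N)) →ₗ[ℂ] X (.inr (i, j)))
    (R (.inr (.inl i))) (fun j f => R (.inr (.inr (i, j))) ∘ₗ f) j

variable (R : QuiverRep (flagSrc (N := N) (I := I)) flagTgt X)

lemma flagPad_last : flagPad R (Fin.last N) = LinearMap.id :=
  Fin.reverseInduction_last

lemma flagPad_castSucc (j : Fin N) : flagPad R j.castSucc = flagPad R j.succ ∘ₗ R (.inl j) :=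
  Fin.reverseInduction_castSucc _

lemma flagTrunc_last (i : I) : flagTrunc R i (Fin.last N) = R (.inr (.inl i)) :=
  Fin.reverseInduction_last

lemma flagTrunc_castSucc (i : I) (j : Fin N) :
    flagTrunc R i j.castSucc = R (.inr (.inr (i, j))) ∘ₗ flagTrunc R i j.succ :=
  Fin.reverseInduction_castSucc _

lemma flagPad_injective (h : ∀ j : Fin N, Function.Injective (R (.inl j))) (j : Fin (N + 1)) :
    Function.Injective (flagPad R j) := by
  induction j using Fin.reverseInduction with
  | last => rw [flagPad_last]; exact Function.injective_id
  | cast j ih => rw [flagPad_castSucc]; exact ih.comp (h j)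

lemma flagTrunc_surjective (h1 : ∀ i, Function.Surjective (R (.inr (.inl i))))
    (h2 : ∀ x, Function.Surjective (R (.inr (.inr x)))) (i : I) (j : Fin (N + 1)) :
    Function.Surjective (flagTrunc R i j) := by
  induction j using Fin.reverseInduction with
  | last => rw [flagTrunc_last]; exact h1 i
  | cast j ih => rw [flagTrunc_castSucc]; exact (h2 (i, j)).comp ih

lemma range_flagPad_mono : Monotone fun j => LinearMap.range (flagPad R j) := by
  refine Fin.monotone_iff_le_succ.2 fun j => ?_
  simp only [flagPad_castSucc]
  exact LinearMap.range_comp_le_range _ _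

lemma ker_flagTrunc_anti (i : I) : Antitone fun j => LinearMap.ker (flagTrunc R i j) := by
  refine Fin.antitone_iff_succ_le.2 fun j => ?_
  simp only [flagTrunc_castSucc]
  exact LinearMap.ker_le_ker_comp _ _

end FlagPaths

section FlagHom
variable {N : ℕ} {I : Type} {X Y : FlagV N I → Type} [∀ v, AddCommGroup (X v)]
  [∀ v, Module ℂ (X v)] [∀ v, AddCommGroup (Y v)] [∀ v, Module ℂ (Y v)]
  (A : QuiverRep (flagSrc (N := N) (I := I)) flagTgt X)
  (F : QuiverRep (flagSrc (N := N) (I := I)) flagTgt Y)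

lemma eq_zero_of_flag_preserving (hD : Function.Injective (quiverD A F))
    (hF : ∀ j : Fin N, Function.Injective (F (.inl j)))
    (hA1 : ∀ i, Function.Surjective (A (.inr (.inl i))))
    (hA2 : ∀ x, Function.Surjective (A (.inr (.inr x))))
    (T : X (.inl (Fin.last N)) →ₗ[ℂ] Y (.inl (Fin.last N)))
    (h1 : ∀ j, ∀ x ∈ LinearMap.range (flagPad A j), T x ∈ LinearMap.range (flagPad F j))
    (h2 : ∀ i j, ∀ x ∈ LinearMap.ker (flagTrunc A i j), T x ∈ LinearMap.ker (flagTrunc F i j)) :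
    T = 0 := by
  have e1 : ∀ j, ∃ φ : X (.inl j) →ₗ[ℂ] Y (.inl j), ∀ x, flagPad F j (φ x) = T (flagPad A j x) := by
    intro j
    obtain ⟨r, hr⟩ := (flagPad F j).exists_leftInverse_of_injective
      (LinearMap.ker_eq_bot.2 (flagPad_injective F hF j))
    refine ⟨r ∘ₗ T ∘ₗ flagPad A j, fun x => ?_⟩
    obtain ⟨y, hy⟩ := h1 j _ ⟨x, rfl⟩
    simp only [LinearMap.comp_apply, ← hy]
    have := LinearMap.congr_fun hr y
    simp only [LinearMap.comp_apply, LinearMap.id_apply] at this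
    rw [this]
  have e2 : ∀ x : I × Fin (N + 1), ∃ φ : X (.inr x) →ₗ[ℂ] Y (.inr x), ∀ y,
      φ (flagTrunc A x.1 x.2 y) = flagTrunc F x.1 x.2 (T y) := by
    rintro ⟨i, j⟩
    obtain ⟨s, hs⟩ := (flagTrunc A i j).exists_rightInverse_of_surjective
      (LinearMap.range_eq_top.2 (flagTrunc_surjective A hA1 hA2 i j))
    refine ⟨flagTrunc F i j ∘ₗ T ∘ₗ s, fun y => ?_⟩
    have h3 : s (flagTrunc A i j y) - y ∈ LinearMap.ker (flagTrunc A i j) := by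
      have := LinearMap.congr_fun hs (flagTrunc A i j y)
      simp only [LinearMap.comp_apply, LinearMap.id_apply] at this
      rw [LinearMap.mem_ker, map_sub, this, sub_self]
    have h4 := h2 i j _ h3
    rw [LinearMap.mem_ker, map_sub, map_sub, sub_eq_zero] at h4
    exact h4
  choose φ1 hφ1 using e1
  choose φ2 hφ2 using e2
  let φ : ∀ v, X v →ₗ[ℂ] Y v := fun v => match v with
    | .inl j => φ1 j
    | .inr x => φ2 x
  have hlast : φ1 (Fin.last N) = T := by
    ext x
    have := hφ1 (Fin.last N) x
    rwa [flagPad_last, flagPad_last] at this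
  have hφ : quiverD A F φ = 0 := by
    ext a x
    refine sub_eq_zero.2 ?_
    match a with
    | .inl j =>
      refine flagPad_injective F hF j.succ ?_
      have h3 := hφ1 j.castSucc x
      rw [flagPad_castSucc, flagPad_castSucc] at h3
      exact h3.trans (hφ1 j.succ _).symm
    | .inr (.inl i) =>
      have h3 := hφ2 (i, Fin.last N) x
      simp only [flagTrunc_last] at h3
      rw [← hlast] at h3
      exact h3.symm
    | .inr (.inr (i, j)) =>
      obtain ⟨y, rfl⟩ := flagTrunc_surjective A hA1 hA2 i j.succ x
      have h3 := hφ2 (i, j.castSucc) y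
      have h4 := hφ2 (i, j.succ) y
      simp only [flagTrunc_castSucc] at h3 h4
      refine Eq.trans ?_ h3.symm
      exact congrArg (F (.inr (.inr (i, j)))) h4
  have h0 : φ = 0 := hD (by rw [hφ, map_zero])
  rw [← hlast]
  exact congrFun h0 (.inl (Fin.last N))

end FlagHom

lemma exists_basis_flag_fin {V : Type*} [AddCommGroup V] [Module ℂ V] [FiniteDimensional ℂ V]
    {K : ℕ} (S : Fin K → Submodule ℂ V) (hS : Monotone S) (d : ℕ)
    (hd : Module.finrank ℂ V = d) :
    ∃ b : Module.Basis (Fin d) ℂ V, ∀ k x,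
      x ∈ S k ↔ ∀ q : Fin d, Module.finrank ℂ (S k) ≤ q.val → b.repr x q = 0 := by
  obtain ⟨b, hb⟩ := exists_basis_flag (fun k => if h : k < K then S ⟨k, h⟩ else ⊤) (by
    intro k l hkl
    by_cases hl : l < K
    · simp only [hl, hkl.trans_lt hl, dif_pos]
      exact hS hkl
    · simp [hl]) d hd K (by simp)
  refine ⟨b, fun k x => ?_⟩
  have := hb k k.2.le x
  have e : (if h : k.val < K then S ⟨k, h⟩ else ⊤) = S k := dif_pos k.2
  rw [e] at this
  exact this

lemma injective_of_finrank_le {V W : Type*} [AddCommGroup V] [Module ℂ V] [FiniteDimensional ℂ V]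
    [AddCommGroup W] [Module ℂ W] (f : V →ₗ[ℂ] W)
    (h : Module.finrank ℂ V ≤ Module.finrank ℂ (LinearMap.range f)) : Function.Injective f := by
  rw [← LinearMap.ker_eq_bot]
  have := f.finrank_range_add_finrank_ker
  exact Submodule.finrank_eq_zero.1 (by omega)

lemma surjective_of_finrank_le {V W : Type*} [AddCommGroup V] [Module ℂ V]
    [AddCommGroup W] [Module ℂ W] [FiniteDimensional ℂ W] (f : V →ₗ[ℂ] W)
    (h : Module.finrank ℂ W ≤ Module.finrank ℂ (LinearMap.range f)) : Function.Surjective f := by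
  rw [← LinearMap.range_eq_top]
  exact Submodule.eq_top_of_finrank_eq (le_antisymm (Submodule.finrank_le _) h)

lemma exists_smul_det_eq_one {n : ℕ} (hn : n ≠ 0) (M : Matrix (Fin n) (Fin n) ℂ) (hM : M.det ≠ 0) :
    ∃ c : ℂ, c ≠ 0 ∧ (c • M).det = 1 := by
  obtain ⟨c, hc⟩ := IsAlgClosed.exists_pow_nat_eq (M.det)⁻¹ (Nat.pos_of_ne_zero hn)
  have h1 : (c • M).det = 1 := by
    have := Matrix.det_smul M c
    rw [Fintype.card_fin, hc, inv_mul_cancel₀ hM] at this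
    exact this
  refine ⟨c, ?_, h1⟩
  rintro rfl
  rw [zero_pow hn] at hc
  exact hM (inv_eq_zero.1 hc.symm)

section
variable {N : ℕ} {I : Type} [Fintype I]

theorem hasHWFun_of_injective (a : I → Fin (N + 1) → ℕ) (ν : ℕ → ℕ) (lam : I → ℕ → ℕ)
    (hν : Antitone ν) (hν0 : ν (N + 1) = 0) (hlam : ∀ i j, lam i j ≤ ν 0)
    (hlama : ∀ i (j : Fin (N + 1)), lam i j = lam i (j + 1) + a i j)
    (hlam0 : ∀ i, lam i (N + 1) = 0)
    (hcard : ∑ p : Fin (N + 1), ν p = ∑ i, ∑ j, a i j * (j + 1))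
    (A : QuiverRep (flagSrc (N := N) (I := I)) flagTgt fun v => Fin (flagAlpha ν lam v) → ℂ)
    (F : QuiverRep (flagSrc (N := N) (I := I)) flagTgt fun v => Fin (flagBeta v) → ℂ)
    (hD : Function.Injective (quiverD A F))
    (hA : ∀ e, min (flagAlpha ν lam (flagSrc e)) (flagAlpha ν lam (flagTgt e)) ≤
      Module.finrank ℂ (LinearMap.range (A e)))
    (hF : ∀ e, min (flagBeta (flagSrc (I := I) (N := N) e)) (flagBeta (flagTgt e)) ≤
      Module.finrank ℂ (LinearMap.range (F e))) :
    HasHWFun a (fun p => (ν p : ℤ)) := by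
  classical
  have dF : ∀ v : FlagV N I, Module.finrank ℂ (Fin (flagBeta v) → ℂ) = flagBeta v :=
    fun v => Module.finrank_fin_fun ℂ
  have dA : ∀ v : FlagV N I,
      Module.finrank ℂ (Fin (flagAlpha ν lam v) → ℂ) = flagAlpha ν lam v :=
    fun v => Module.finrank_fin_fun ℂ
  have hFinj : ∀ j : Fin N, Function.Injective (F (.inl j)) := fun j => by
    refine injective_of_finrank_le _ ((dF _).le.trans <| le_trans ?_ (hF (.inl j)))
    simp [flagSrc, flagTgt, flagBeta]
  have hF1 : ∀ i, Function.Surjective (F (.inr (.inl i))) := fun i => by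
    refine surjective_of_finrank_le _ ((dF _).le.trans <| le_trans ?_ (hF (.inr (.inl i))))
    simp [flagSrc, flagTgt, flagBeta]
  have hF2 : ∀ x, Function.Surjective (F (.inr (.inr x))) := fun x => by
    refine surjective_of_finrank_le _ ((dF _).le.trans <| le_trans ?_ (hF (.inr (.inr x))))
    simp [flagSrc, flagTgt, flagBeta]
  have hAinj : ∀ j : Fin N, Function.Injective (A (.inl j)) := fun j => by
    refine injective_of_finrank_le _ ((dA _).le.trans <| le_trans ?_ (hA (.inl j)))
    have := hν (show j.val + 1 ≤ j.val + 1 + 1 by omega)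
    simp [flagSrc, flagTgt, flagAlpha]
    omega
  have hA1 : ∀ i, Function.Surjective (A (.inr (.inl i))) := fun i => by
    refine surjective_of_finrank_le _ ((dA _).le.trans <| le_trans ?_ (hA (.inr (.inl i))))
    simp [flagSrc, flagTgt, flagAlpha, hν0]
  have hA2 : ∀ x, Function.Surjective (A (.inr (.inr x))) := fun x => by
    refine surjective_of_finrank_le _ ((dA _).le.trans <| le_trans ?_ (hA (.inr (.inr x))))
    have := hlama x.1 x.2.castSucc
    simp only [Fin.val_castSucc] at this
    simp [flagSrc, flagTgt, flagAlpha]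
    omega
  have hdA : Module.finrank ℂ (Fin (flagAlpha ν lam (.inl (Fin.last N))) → ℂ) = ν 0 := by
    rw [dA]; simp [flagAlpha, hν0]
  have hdF : Module.finrank ℂ (Fin (flagBeta (I := I) (.inl (Fin.last N))) → ℂ) = N + 1 := dF _
  obtain ⟨e, he⟩ := exists_basis_flag_fin _ (range_flagPad_mono A) (ν 0) hdA
  obtain ⟨b, hb⟩ := exists_basis_flag_fin _ (range_flagPad_mono F) (N + 1) hdF
  have hk : ∀ i, ∃ k : Module.Basis (Fin (ν 0)) ℂ
      (Fin (flagAlpha ν lam (.inl (Fin.last N))) → ℂ), ∀ j x,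
      x ∈ LinearMap.ker (flagTrunc A i j) ↔ ∀ q : Fin (ν 0), lam i j ≤ q.val → k.repr x q = 0 := by
    intro i
    obtain ⟨k, hk⟩ := exists_basis_flag_fin
      (fun j : Fin (N + 1) => LinearMap.ker (flagTrunc A i j.rev))
      (fun j j' h => ker_flagTrunc_anti A i (Fin.rev_le_rev.2 h)) (ν 0) hdA
    refine ⟨k, fun j x => ?_⟩
    obtain ⟨j, rfl⟩ : ∃ j', j = Fin.rev j' := ⟨j.rev, (Fin.rev_rev j).symm⟩
    have h1 := hk j x
    have h2 := (flagTrunc A i j.rev).finrank_range_add_finrank_ker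
    rw [LinearMap.range_eq_top.2 (flagTrunc_surjective A hA1 hA2 i j.rev), finrank_top, hdA,
      dA] at h2
    have h3 : Module.finrank ℂ (LinearMap.ker (flagTrunc A i j.rev)) = lam i j.rev := by
      have h4 : ν 0 - lam i j.rev + Module.finrank ℂ (LinearMap.ker (flagTrunc A i j.rev)) =
        ν 0 := h2
      have := hlam i j.rev
      omega
    rw [h3] at h1
    exact h1
  have hz : ∀ i, ∃ z : Module.Basis (Fin (N + 1)) ℂ
      (Fin (flagBeta (I := I) (.inl (Fin.last N))) → ℂ), ∀ j x,
      x ∈ LinearMap.ker (flagTrunc F i j) ↔ ∀ p : Fin (N + 1), p ≤ j → z.repr x p = 0 := by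
    intro i
    obtain ⟨z, hz⟩ := exists_basis_flag_fin
      (fun j : Fin (N + 1) => LinearMap.ker (flagTrunc F i j.rev))
      (fun j j' h => ker_flagTrunc_anti F i (Fin.rev_le_rev.2 h)) (N + 1) hdF
    refine ⟨z.reindex Fin.revPerm, fun j x => ?_⟩
    obtain ⟨j, rfl⟩ : ∃ j', j = Fin.rev j' := ⟨j.rev, (Fin.rev_rev j).symm⟩
    have h1 := hz j x
    have h2 := (flagTrunc F i j.rev).finrank_range_add_finrank_ker
    rw [LinearMap.range_eq_top.2 (flagTrunc_surjective F hF1 hF2 i j.rev), finrank_top, hdF,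
      dF] at h2
    have h3 : Module.finrank ℂ (LinearMap.ker (flagTrunc F i j.rev)) = j := by
      have h4 : j.rev.val + 1 + Module.finrank ℂ (LinearMap.ker (flagTrunc F i j.rev)) = N + 1 := h2
      rw [Fin.val_rev] at h4
      omega
    rw [h3] at h1
    rw [h1]
    constructor
    · intro h p hp
      rw [Module.Basis.repr_reindex_apply]
      refine h _ ?_
      simp only [Fin.revPerm_symm, Fin.revPerm_apply, Fin.val_rev]
      have := Fin.le_def.1 hp
      rw [Fin.val_rev] at this
      omega
    · intro h p hp
      have h4 := h p.rev (by rw [Fin.le_def, Fin.val_rev, Fin.val_rev]; omega)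
      rw [Module.Basis.repr_reindex_apply] at h4
      simpa using h4
  choose k hk using hk
  choose z hz using hz
  have hrA : ∀ j, Module.finrank ℂ (LinearMap.range (flagPad A j)) = ν 0 - ν (j + 1) := fun j => by
    rw [LinearMap.finrank_range_of_inj (flagPad_injective A hAinj j), dA]
    rfl
  have hrF : ∀ j, Module.finrank ℂ (LinearMap.range (flagPad F j)) = j + 1 := fun j => by
    rw [LinearMap.finrank_range_of_inj (flagPad_injective F hFinj j), dF]
    rfl
  have hg : ∀ i, ∃ c : ℂ, c ≠ 0 ∧ (c • (z i).toMatrix b).det = 1 := fun i =>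
    exists_smul_det_eq_one (Nat.succ_ne_zero N) _ (by
      have h1 := congrArg Matrix.det ((z i).toMatrix_mul_toMatrix_flip b)
      rw [Matrix.det_mul, Matrix.det_one] at h1
      exact left_ne_zero_of_mul_eq_one h1)
  choose c hc0 hc1 using hg
  have hκ : ∀ (x : Σ i, Σ j, Fin (a i j)), lam x.1 (x.2.1 + 1) + x.2.2 < ν 0 := fun x => by
    have h1 := hlama x.1 x.2.1
    have h2 := hlam x.1 x.2.1
    have h3 := x.2.2.2
    omega
  have hjex : ∀ i (j : Fin (N + 1)) (q : ℕ), q < lam i j →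
      ∃ j', j ≤ j' ∧ lam i (j' + 1) ≤ q ∧ q < lam i j' := by
    intro i j q
    induction j using Fin.reverseInduction with
    | last => exact fun h => ⟨_, le_rfl, by rw [Fin.val_last, hlam0]; omega, h⟩
    | cast j ih =>
      intro h
      by_cases h' : q < lam i j.succ
      · obtain ⟨j', h1, h2⟩ := ih h'
        exact ⟨j', j.castSucc_lt_succ.le.trans h1, h2⟩
      · exact ⟨_, le_rfl, by simpa using h', h⟩
  refine hasHWFun_of_kernel a (fun p => ν p) (fun p q h => hν h) (fun p => hν (Nat.zero_le _))
    (fun i => e.toMatrix (k i)) (fun x => ⟨_, hκ x⟩) hcard (fun i => ⟨_, hc1 i⟩) ?_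
  intro x hx1 hx2
  set T : (Fin (flagAlpha ν lam (.inl (Fin.last N))) → ℂ) →ₗ[ℂ]
      (Fin (flagBeta (I := I) (.inl (Fin.last N))) → ℂ) :=
    e.constr ℂ fun q => ∑ p, x p q • b p with hT
  have hTe : ∀ q, T (e q) = ∑ p, x p q • b p := fun q => by rw [hT, Module.Basis.constr_basis]
  have hbT : ∀ y p, b.repr (T y) p = ∑ q, e.repr y q * x p q := by
    intro y p
    conv_lhs => rw [← e.sum_repr y]
    simp only [map_sum, map_smul, hTe, Module.Basis.repr_self, Finsupp.coe_finsetSum,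
      Finset.sum_apply, Finsupp.smul_apply, smul_eq_mul]
    simp [Finsupp.single_apply]
  have hT0 : T = 0 := by
    refine eq_zero_of_flag_preserving A F hD hFinj hA1 hA2 T ?_ ?_
    · intro j y hy
      rw [he] at hy
      rw [hb]
      intro p hp
      rw [hbT]
      refine Finset.sum_eq_zero fun q _ => ?_
      by_cases hq : ν 0 - ν (j + 1) ≤ q
      · rw [hy q (by rw [hrA]; exact hq), zero_mul]
      · rw [hx1 p q, mul_zero]
        rw [hrF] at hp
        have := hν hp
        omega
    · intro i j y hy
      rw [hk] at hy
      rw [← (k i).sum_repr y, map_sum]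
      refine Submodule.sum_mem _ fun q _ => ?_
      rw [map_smul]
      by_cases hq : lam i j ≤ q.val
      · rw [hy q hq, zero_smul]
        exact Submodule.zero_mem _
      · refine Submodule.smul_mem _ _ ?_
        rw [hz]
        intro p hp
        obtain ⟨j', hjj', hq1, hq2⟩ := hjex i j q.val (not_le.1 hq)
        have h3 := hlama i j'
        have h4 := hx2 ⟨i, j', ⟨q.val - lam i (j' + 1), by omega⟩⟩ p (hp.trans hjj')
        have h5 : (⟨lam i (j' + 1) + (q.val - lam i (j' + 1)), hκ ⟨i, j', ⟨q.val - lam i (j' + 1),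
          by omega⟩⟩⟩ : Fin (ν 0)) = q := Fin.ext (by show _ + _ = _; omega)
        simp only [h5] at h4
        have h6 : (z i).repr (T (k i q)) p = ∑ p', (z i).repr (b p') p * b.repr (T (k i q)) p' := by
          conv_lhs => rw [← b.sum_repr (T (k i q))]
          simp only [map_sum, map_smul, Finsupp.coe_finsetSum, Finset.sum_apply, Finsupp.smul_apply,
            smul_eq_mul]
          exact Finset.sum_congr rfl fun _ _ => mul_comm _ _
        rw [h6]
        refine (mul_eq_zero.1 (?_ : c i * _ = 0)).resolve_left (hc0 i)
        rw [← h4, Finset.mul_sum]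
        refine Finset.sum_congr rfl fun p' _ => ?_
        rw [hbT, Finset.mul_sum, Finset.mul_sum]
        refine Finset.sum_congr rfl fun q' _ => ?_
        simp only [Matrix.smul_apply, Module.Basis.toMatrix_apply, smul_eq_mul]
        ring
  ext p q
  have h1 := hbT (e q) p
  rw [hT0] at h1
  simpa [Finsupp.single_apply] using h1.symm

end

section
variable {N : ℕ} {I : Type} [Fintype I]

/-- Extension of a finite sequence by zero. -/
def zeroExt (ν : Fin (N + 1) → ℤ) (p : ℕ) : ℤ := if h : p < N + 1 then ν ⟨p, h⟩ else 0

@[simp] lemma zeroExt_val (ν : Fin (N + 1) → ℤ) (p : Fin (N + 1)) : zeroExt ν p = ν p := by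
  unfold zeroExt
  rw [dif_pos p.2]

lemma zeroExt_last (ν : Fin (N + 1) → ℤ) : zeroExt ν (N + 1) = 0 := by
  simp [zeroExt]

lemma zeroExt_nonneg {ν : Fin (N + 1) → ℤ} (h : ∀ p, 0 ≤ ν p) (p : ℕ) : 0 ≤ zeroExt ν p := by
  unfold zeroExt
  split_ifs
  · exact h _
  · exact le_rfl

lemma zeroExt_antitone {ν : Fin (N + 1) → ℤ} (hν : SLDominant ν) (h : ∀ p, 0 ≤ ν p) :
    Antitone (zeroExt ν) := by
  intro p q hpq
  unfold zeroExt
  split_ifs with h1 h2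
  · exact hν _ _ hpq
  · omega
  · exact h _
  · exact le_rfl

/-- The semi-invariance inequality attached to a dimension vector. -/
def FlagIneq (a : I → Fin (N + 1) → ℕ) (ρ : FlagV N I → ℕ) (ν : Fin (N + 1) → ℤ) : Prop :=
  ∑ j : Fin (N + 1), (zeroExt ν j - zeroExt ν (j + 1)) * ρ (.inl j) ≤
    ∑ i, ∑ j, (a i j : ℤ) * ρ (.inr (i, j))

theorem flagIneq_of_hasHWFun (a : I → Fin (N + 1) → ℕ) (ν : Fin (N + 1) → ℤ) (hd : SLDominant ν)
    (h0 : ∀ p, 0 ≤ ν p) (hsum : ∑ p, ν p = ∑ i, ∑ j : Fin (N + 1), (a i j : ℤ) * (j + 1))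
    (h : HasHWFun a ν) (ρ : FlagV N I → ℕ)
    (hρ : IsUnivSub (flagSrc (N := N) (I := I)) flagTgt flagBeta ρ) : FlagIneq a ρ ν := by
  classical
  obtain ⟨Φ, hΦ, hΦ0, hhw⟩ := h
  obtain ⟨g, hg⟩ : ∃ g, Φ g ≠ 0 := by
    by_contra! h
    exact hΦ0 (funext h)
  obtain ⟨S, hS, hS'⟩ := hρ (flagRep fun i => (g i).val)
  lift ν to Fin (N + 1) → ℕ using h0
  beta_reduce at hsum
  have h1 := sum_pivots_le a ν (by exact_mod_cast hsum) hΦ hhw g hg (S (.inl (Fin.last N)))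
    (fun i j => S (.inr (i, j))) (fun i j x hx => flagRep_trunc_mem hS' i j x hx)
  set ν' : ℕ → ℕ := fun p => (zeroExt (fun p => (ν p : ℤ)) p).toNat with hν'
  have hz : ∀ p, 0 ≤ zeroExt (fun p => (ν p : ℤ)) p := zeroExt_nonneg fun p => Nat.cast_nonneg _
  have hcast : ∀ p, (ν' p : ℤ) = zeroExt (fun p => (ν p : ℤ)) p := fun p =>
    Int.toNat_of_nonneg (hz p)
  have hanti : Antitone ν' := fun p q hpq =>
    Int.toNat_le_toNat (zeroExt_antitone hd (fun p => Nat.cast_nonneg _) hpq)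
  have h2 := sum_sub_mul_card (N := N) ν' hanti (by simp [hν', zeroExt_last])
    (Finset.univ.filter fun p => p ∈ pivots (S (.inl (Fin.last N))))
  have h3 : ∀ p : Fin (N + 1), ν' p = ν p := fun p => by simp [hν']
  simp only [h3] at h2
  rw [← h2] at h1
  have h4 : ∑ j : Fin (N + 1), (ν' j - ν' (j + 1)) * ρ (.inl j) ≤
      ∑ i, ∑ j, a i j * ρ (.inr (i, j)) := by
    refine le_trans (Finset.sum_le_sum fun j _ => ?_) (h1.trans_eq ?_)
    · rw [h3]
      refine Nat.mul_le_mul_left _ ?_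
      rw [Finset.filter_filter, ← hS]
      exact finrank_le_card_pivots _ j _ fun x hx => flagRep_pad_mem hS' j x hx
    · exact Finset.sum_congr rfl fun i _ => Finset.sum_congr rfl fun j _ => by
        rw [← hS (.inr (i, j))]; rfl
  unfold FlagIneq
  have h5 : ∀ j : Fin (N + 1), ((ν' j - ν' (j + 1) : ℕ) : ℤ) =
      zeroExt (fun p => (ν p : ℤ)) j - zeroExt (fun p => (ν p : ℤ)) (j + 1) := fun j => by
    rw [Nat.cast_sub (hanti (Nat.le_succ _)), hcast, hcast]
  simp only [← h5]
  exact_mod_cast h4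

theorem hasHWFun_of_flagIneq (a : I → Fin (N + 1) → ℕ) (ν : Fin (N + 1) → ℤ) (hd : SLDominant ν)
    (h0 : ∀ p, 0 ≤ ν p) (hsum : ∑ p, ν p = ∑ i, ∑ j : Fin (N + 1), (a i j : ℤ) * (j + 1))
    (ha : ∀ i, ∑ j, (a i j : ℤ) ≤ ν 0)
    (h : ∀ ρ : FlagV N I → ℕ, IsUnivSub (flagSrc (N := N) (I := I)) flagTgt flagBeta ρ →
      FlagIneq a ρ ν) : HasHWFun a ν := by
  classical
  lift ν to Fin (N + 1) → ℕ using h0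
  beta_reduce at hsum ha
  set ν' : ℕ → ℕ := fun p => (zeroExt (fun p => (ν p : ℤ)) p).toNat with hν'
  have hz : ∀ p, 0 ≤ zeroExt (fun p => (ν p : ℤ)) p := zeroExt_nonneg fun p => Nat.cast_nonneg _
  have hcast : ∀ p, (ν' p : ℤ) = zeroExt (fun p => (ν p : ℤ)) p := fun p =>
    Int.toNat_of_nonneg (hz p)
  have hanti : Antitone ν' := fun p q hpq =>
    Int.toNat_le_toNat (zeroExt_antitone hd (fun p => Nat.cast_nonneg _) hpq)
  have h3 : ∀ p : Fin (N + 1), ν' p = ν p := fun p => by simp [hν']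
  have hlast : ν' (N + 1) = 0 := by simp [hν', zeroExt_last]
  set lam : I → ℕ → ℕ := fun i j => ∑ j' : Fin (N + 1), if j ≤ j'.val then a i j' else 0 with
      hlamdef
  have hlam : ∀ i j, lam i j ≤ ν' 0 := by
    intro i j
    have h4 : lam i j ≤ ∑ j', a i j' := Finset.sum_le_sum fun j' _ => by split_ifs <;> simp
    have h5 : ∑ j', a i j' ≤ ν 0 := by exact_mod_cast ha i
    have h6 : ν' 0 = ν 0 := h3 0
    omega
  have hlama : ∀ i (j : Fin (N + 1)), lam i j = lam i (j + 1) + a i j := by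
    intro i j
    simp only [hlamdef]
    rw [← Finset.add_sum_erase _ _ (Finset.mem_univ j),
      ← Finset.add_sum_erase (Finset.univ) (fun j' : Fin (N + 1) => if j.val + 1 ≤ j'.val then
        a i j' else 0) (Finset.mem_univ j)]
    simp only [le_refl, if_true, Nat.not_succ_le_self, if_false, zero_add]
    rw [add_comm]
    congr 1
    refine Finset.sum_congr rfl fun j' hj' => ?_
    have : j'.val ≠ j.val := fun h => Finset.ne_of_mem_erase hj' (Fin.ext h)
    refine if_congr ?_ rfl rfl
    omega
  have hlam0 : ∀ i, lam i (N + 1) = 0 := fun i => by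
    simp only [hlamdef]
    refine Finset.sum_eq_zero fun j _ => if_neg ?_
    omega
  have hsum' : ∑ p : Fin (N + 1), ν' p = ∑ i, ∑ j, a i j * (j + 1) := by
    simp only [h3]
    exact_mod_cast hsum
  have hdiff : ∀ i (j : Fin (N + 1)), (lam i j : ℤ) - lam i (j + 1) = a i j := fun i j => by
    rw [hlama]; push_cast; ring
  have heuler := flag_euler ν' lam hanti hlast hlam hlam0
  simp only [hdiff] at heuler
  have h00 : quiverEuler (flagSrc (N := N) (I := I)) flagTgt
      (fun v => (flagAlpha ν' lam v : ℤ)) (fun v => (flagBeta v : ℤ)) = 0 := by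
    rw [heuler]
    have h4 := sum_sub_mul_card (N := N) ν' hanti hlast Finset.univ
    have h5 : ∀ j : Fin (N + 1), (Finset.univ.filter (· ≤ j)).card = j + 1 := fun j => by
      rw [show Finset.univ.filter (· ≤ j) = Finset.Iic j by ext; simp, Fin.card_Iic]
    simp only [h5] at h4
    rw [hsum'] at h4
    have h6 : ∀ j : Fin (N + 1), ((ν' j : ℤ) - ν' (j + 1)) = ((ν' j - ν' (j + 1) : ℕ) : ℤ) :=
      fun j => by rw [Nat.cast_sub (hanti (Nat.le_succ _))]
    simp only [h6, flagBeta, sub_eq_zero]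
    exact_mod_cast h4
  obtain ⟨A, F, hbij, hA, hF⟩ := exists_bijective_quiverD (flagSrc (N := N) (I := I)) flagTgt
    (flagAlpha ν' lam) flagBeta (fun ρ hρ hu => by
      have h4 := h ρ hu
      have h5 := heuler (fun v => (flagBeta v : ℤ) - ρ v)
      have h6 := heuler (fun v => (flagBeta v : ℤ))
      rw [h5]
      rw [h00] at h6
      unfold FlagIneq at h4
      simp only [← hcast] at h4
      simp only [mul_sub, Finset.sum_sub_distrib]
      linarith) h00
  have := hasHWFun_of_injective a ν' lam hanti hlast hlam hlama hlam0 hsum' A F hbij.1 hA hF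
  simpa only [h3] using this

lemma FlagIneq.interpolate {a : I → Fin (N + 1) → ℕ} {ρ : FlagV N I → ℕ} {ν γ : Fin (N + 1) → ℤ}
    {k l : ℕ} (hk : 0 < k) (hl : l ≤ k) (h1 : FlagIneq a ρ ν)
    (h2 : FlagIneq a ρ (fun p => ν p + k * γ p)) : FlagIneq a ρ (fun p => ν p + l * γ p) := by
  unfold FlagIneq at *
  have key : ∀ c : ℤ, ∑ j : Fin (N + 1), (zeroExt (fun p => ν p + c * γ p) j -
      zeroExt (fun p => ν p + c * γ p) (j + 1)) * (ρ (.inl j) : ℤ) =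
      ∑ j : Fin (N + 1), (zeroExt ν j - zeroExt ν (j + 1)) * (ρ (.inl j) : ℤ) +
      c * ∑ j : Fin (N + 1), (zeroExt γ j - zeroExt γ (j + 1)) * (ρ (.inl j) : ℤ) := by
    intro c
    rw [Finset.mul_sum, ← Finset.sum_add_distrib]
    refine Finset.sum_congr rfl fun j _ => ?_
    have : ∀ p, zeroExt (fun p => ν p + c * γ p) p = zeroExt ν p + c * zeroExt γ p := by
      intro p
      unfold zeroExt
      split_ifs <;> simp
    rw [this, this]
    ring
  rw [key] at h2 ⊢
  have hk' : (0 : ℤ) < k := by exact_mod_cast hk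
  have hl' : (l : ℤ) ≤ k := by exact_mod_cast hl
  have hl0 : (0 : ℤ) ≤ l := Int.natCast_nonneg l
  generalize ∑ j : Fin (N + 1), (zeroExt ν j - zeroExt ν (j + 1)) * (ρ (.inl j) : ℤ) = x at *
  generalize ∑ j : Fin (N + 1), (zeroExt γ j - zeroExt γ (j + 1)) * (ρ (.inl j) : ℤ) = y at *
  generalize ∑ i, ∑ j, (a i j : ℤ) * (ρ (.inr (i, j)) : ℤ) = z at *
  generalize (k : ℤ) = k at *
  generalize (l : ℤ) = l at *
  by_contra hcon
  push Not at hcon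
  nlinarith [mul_nonneg (sub_nonneg.2 hl') (sub_nonneg.2 h1), mul_nonneg hl0 (sub_nonneg.2 h2)]

lemma SLDominant.interpolate {n : ℕ} {ν γ : Fin n → ℤ} {k l : ℕ} (hk : 0 < k) (hl : l ≤ k)
    (h1 : SLDominant ν) (h2 : SLDominant fun p => ν p + k * γ p) :
    SLDominant fun p => ν p + l * γ p := by
  intro i j hij
  have e1 := h1 i j hij
  have e2 := h2 i j hij
  have hk' : (0 : ℤ) < k := by exact_mod_cast hk
  have hl' : (l : ℤ) ≤ k := by exact_mod_cast hl
  have hl0 : (0 : ℤ) ≤ l := Int.natCast_nonneg l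
  generalize (k : ℤ) = k at *
  generalize (l : ℤ) = l at *
  dsimp only at e2 ⊢
  by_contra hcon
  push Not at hcon
  nlinarith [mul_nonneg (sub_nonneg.2 hl') (sub_nonneg.2 e1), mul_nonneg hl0 (sub_nonneg.2 e2)]

end

section
variable {N : ℕ} {I : Type} [Fintype I]

lemma leadingMinor_smul {n : ℕ} (j : Fin n) (c : ℂ) (M : Matrix (Fin n) (Fin n) ℂ) :
    leadingMinor j (c • M) = c ^ (j.val + 1) * leadingMinor j M := by
  unfold leadingMinor
  rw [Matrix.submatrix_smul, Pi.smul_apply, Pi.smul_apply, Matrix.det_smul, Fintype.card_fin]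

lemma leadingMinor_last (M : Matrix (Fin (N + 1)) (Fin (N + 1)) ℂ) :
    leadingMinor (Fin.last N) M = M.det := rfl

lemma minorSpan_center {a : I → Fin (N + 1) → ℕ} {Φ : (I → SL (N + 1)) → ℂ}
    (hΦ : Φ ∈ minorSpan a) {ζ : ℂ} {z : SL (N + 1)} (hz : z.val = ζ • 1) (g : I → SL (N + 1)) :
    Φ (fun i => g i * z) = ζ ^ (∑ i, ∑ j : Fin (N + 1), a i j * (j + 1)) * Φ g := by
  induction hΦ using Submodule.span_induction with
  | mem Φ h =>
    obtain ⟨h, rfl⟩ := h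
    simp only [minorProd, Pi.mul_apply]
    rw [← Finset.prod_pow_eq_pow_sum, ← Finset.prod_mul_distrib]
    refine Finset.prod_congr rfl fun i _ => ?_
    rw [← Finset.prod_pow_eq_pow_sum, ← Finset.prod_mul_distrib]
    refine Finset.prod_congr rfl fun j _ => ?_
    have : (g i * z * h i).val = ζ • (g i * h i).val := by
      simp [Matrix.SpecialLinearGroup.coe_mul, hz]
    rw [this, leadingMinor_smul, mul_pow, ← pow_mul, mul_comm (a i j)]
  | zero => simp
  | add x y _ _ hx hy => simp only [Pi.add_apply, hx, hy]; ring
  | smul c x _ hx => simp only [Pi.smul_apply, hx, smul_eq_mul]; ring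

theorem HasHWFun.dvd {a : I → Fin (N + 1) → ℕ} {ν : Fin (N + 1) → ℤ} (h : HasHWFun a ν) :
    ((N + 1 : ℕ) : ℤ) ∣ ∑ p, ν p - ∑ i, ∑ j : Fin (N + 1), (a i j : ℤ) * (j + 1) := by
  obtain ⟨Φ, hΦ, hΦ0, -, hT⟩ := h
  obtain ⟨g, hg⟩ : ∃ g, Φ g ≠ 0 := by
    by_contra! h
    exact hΦ0 (funext h)
  have hζ := Complex.isPrimitiveRoot_exp (N + 1) (Nat.succ_ne_zero N)
  set ζ := Complex.exp (2 * Real.pi * Complex.I / ((N + 1 : ℕ) : ℂ))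
  have hζ0 : ζ ≠ 0 := Complex.exp_ne_zero _
  let z : SL (N + 1) := ⟨ζ • 1, by
    rw [Matrix.det_smul, Fintype.card_fin, hζ.pow_eq_one, Matrix.det_one, one_mul]⟩
  have h1 := minorSpan_center hΦ (z := z) rfl g
  have h2 := hT g z (fun i j hij => by simp [z, Matrix.one_apply_ne hij])
  have h3 : ∏ p, z.val p p ^ ν p = ζ ^ (∑ p, ν p) := by
    have : ∀ p, z.val p p = ζ := fun p => by simp [z]
    simp only [this]
    have key : ∀ s : Finset (Fin (N + 1)), ∏ p ∈ s, ζ ^ ν p = ζ ^ (∑ p ∈ s, ν p) := by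
      intro s
      induction s using Finset.induction_on with
      | empty => simp
      | insert x s hx ih => rw [Finset.prod_insert hx, Finset.sum_insert hx, zpow_add₀ hζ0, ih]
    exact key _
  rw [h1, h3] at h2
  have h4 := mul_right_cancel₀ hg h2
  rw [← hζ.zpow_eq_one_iff_dvd, zpow_sub₀ hζ0, ← h4]
  have : (∑ i, ∑ j : Fin (N + 1), (a i j : ℤ) * (j + 1)) =
      ((∑ i, ∑ j : Fin (N + 1), a i j * (j + 1) : ℕ) : ℤ) := by push_cast; rfl
  rw [this, zpow_natCast, div_self (pow_ne_zero _ hζ0)]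

lemma minorProd_option (a : I → Fin (N + 1) → ℕ) (A : ℕ) (g : Option I → SL (N + 1)) :
    minorProd (fun o : Option I => o.elim (Pi.single (Fin.last N) A) a) g =
      minorProd a (fun i => g (some i)) := by
  unfold minorProd
  rw [Fintype.prod_option]
  have : ∏ j, leadingMinor j (g none).val ^ (Pi.single (Fin.last N) A : Fin (N + 1) → ℕ) j = 1 := by
    refine Finset.prod_eq_one fun j _ => ?_
    by_cases hj : j = Fin.last N
    · subst hj
      rw [leadingMinor_last, (g none).2, one_pow]
    · rw [Pi.single_eq_of_ne hj, pow_zero]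
  simp only [Option.elim_none, this, one_mul, Option.elim_some]

lemma SLIsDiag.prod_eq_one {n : ℕ} {t : SL n} (ht : SLIsDiag t) : ∏ p, t.val p p = 1 := by
  refine (Matrix.det_diagonal (d := fun p => t.val p p)).symm.trans (Eq.trans ?_ t.2)
  congr 1
  ext i j
  by_cases h : i = j
  · subst h; simp
  · rw [Matrix.diagonal_apply_ne _ h, ht i j h]

lemma SLIsDiag.ne_zero {n : ℕ} {t : SL n} (ht : SLIsDiag t) (p : Fin n) : t.val p p ≠ 0 := fun h =>
  zero_ne_one ((Finset.prod_eq_zero (f := fun p => t.val p p) (Finset.mem_univ p) h).symm.trans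
    ht.prod_eq_one)

lemma torus_prod_add_const {n : ℕ} (ν : Fin n → ℤ) (c : ℤ) {t : SL n} (ht : SLIsDiag t) :
    ∏ p, t.val p p ^ (ν p + c) = ∏ p, t.val p p ^ ν p := by
  simp only [zpow_add₀ (ht.ne_zero _), Finset.prod_mul_distrib, Finset.prod_zpow, ht.prod_eq_one,
      one_zpow, mul_one]

theorem hasHWFun_option_iff (a : I → Fin (N + 1) → ℕ) (ν : Fin (N + 1) → ℤ) (A : ℕ) (c : ℤ) :
    HasHWFun (fun o : Option I => o.elim (Pi.single (Fin.last N) A) a) (fun p => ν p + c) ↔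
      HasHWFun a ν := by
  obtain ⟨P, hP⟩ : ∃ P : ((I → SL (N + 1)) → ℂ) →ₗ[ℂ] ((Option I → SL (N + 1)) → ℂ),
      ∀ Φ g, P Φ g = Φ fun i => g (some i) :=
    ⟨LinearMap.funLeft ℂ ℂ fun g i => g (some i), fun _ _ => rfl⟩
  obtain ⟨e, he⟩ : ∃ e : (I → SL (N + 1)) → Option I → SL (N + 1), ∀ g i, e g (some i) = g i :=
    ⟨fun g o => o.elim 1 g, fun _ _ => rfl⟩
  have hspan : minorSpan (fun o : Option I => o.elim (Pi.single (Fin.last N) A) a) =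
      (minorSpan a).map P := by
    unfold minorSpan
    rw [Submodule.map_span]
    congr 1
    ext Φ
    constructor
    · rintro ⟨h, rfl⟩
      refine ⟨_, ⟨fun i => h (some i), rfl⟩, ?_⟩
      funext g
      rw [hP]
      exact (minorProd_option a A (g * h)).symm
    · rintro ⟨_, ⟨h, rfl⟩, rfl⟩
      refine ⟨e h, ?_⟩
      funext g
      rw [hP]
      beta_reduce
      rw [minorProd_option]
      simp only [Pi.mul_apply, he]
      rfl
  unfold HasHWFun
  rw [hspan]
  constructor
  · rintro ⟨_, ⟨Φ, hΦ, rfl⟩, h0, hU, hT⟩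
    refine ⟨Φ, hΦ, fun h => h0 (by rw [h, map_zero]), fun g u hu => ?_, fun g t ht => ?_⟩
    · have := hU (e g) u hu
      simp only [hP, he] at this
      exact this
    · have := hT (e g) t ht
      rw [torus_prod_add_const ν c ht] at this
      simp only [hP, he] at this
      exact this
  · rintro ⟨Φ, hΦ, h0, hU, hT⟩
    refine ⟨P Φ, ⟨Φ, hΦ, rfl⟩, fun h => h0 (funext fun g => ?_), fun g u hu => ?_, fun g t ht => ?_⟩
    · have := congrFun h (e g)
      simp only [hP, he] at this
      exact this
    · rw [hP, hP]
      exact hU (fun i => g (some i)) u hu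
    · rw [torus_prod_add_const ν c ht, hP, hP]
      exact hT (fun i => g (some i)) t ht

lemma le_interpolate {b x y : ℤ} {k l : ℕ} (hk : 0 < k) (hl : l ≤ k) (h1 : b ≤ x)
    (h2 : b ≤ x + k * y) : b ≤ x + l * y := by
  have hk' : (0 : ℤ) < k := by exact_mod_cast hk
  have hl' : (l : ℤ) ≤ k := by exact_mod_cast hl
  have hl0 : (0 : ℤ) ≤ l := Int.natCast_nonneg l
  by_contra hcon
  push Not at hcon
  nlinarith [mul_nonneg (sub_nonneg.2 hl') (sub_nonneg.2 h1), mul_nonneg hl0 (sub_nonneg.2 h2)]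

/-- Saturation and convexity for products of leading minors. -/
theorem HasHWFun.interpolate {a : I → Fin (N + 1) → ℕ} {ν γ : Fin (N + 1) → ℤ} {k l : ℕ}
    (hk : 0 < k) (hl : l ≤ k) (hγ : ∑ p, γ p = 0) (hd0 : SLDominant ν)
    (hdk : SLDominant fun p => ν p + k * γ p) (h0 : HasHWFun a ν)
    (h1 : HasHWFun a fun p => ν p + k * γ p) : HasHWFun a fun p => ν p + l * γ p := by
  classical
  obtain ⟨m, hm⟩ := h0.dvd
  set d : ℤ := ∑ i, ∑ j : Fin (N + 1), (a i j : ℤ) * (j + 1) with hd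
  have hd_nonneg : 0 ≤ d := Finset.sum_nonneg fun i _ => Finset.sum_nonneg fun j _ => by positivity
  have had : ∀ i, ∑ j, (a i j : ℤ) ≤ d := fun i => by
    refine le_trans (Finset.sum_le_sum fun j _ => ?_)
      (Finset.single_le_sum (f := fun i => ∑ j : Fin (N + 1), (a i j : ℤ) * (j + 1))
        (fun i _ => Finset.sum_nonneg fun j _ => by positivity) (Finset.mem_univ i))
    nlinarith [Int.natCast_nonneg (a i j), Int.natCast_nonneg (j : ℕ)]
  set c : ℤ := ∑ p, |ν p| + ∑ p, |ν p + k * γ p| + d + |m| with hc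
  have hs0 : 0 ≤ ∑ p, |ν p| := Finset.sum_nonneg fun p _ => abs_nonneg _
  have hs1 : 0 ≤ ∑ p, |ν p + k * γ p| := Finset.sum_nonneg fun p _ => abs_nonneg _
  have hb0 : ∀ p, d - c ≤ ν p := fun p => by
    have := Finset.single_le_sum (f := fun p => |ν p|) (fun p _ => abs_nonneg _)
      (Finset.mem_univ p)
    have h' := neg_abs_le (ν p)
    have h'' := abs_nonneg m
    beta_reduce at this
    linarith
  have hb1 : ∀ p, d - c ≤ ν p + k * γ p := fun p => by
    have := Finset.single_le_sum (f := fun p => |ν p + k * γ p|) (fun p _ => abs_nonneg _)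
      (Finset.mem_univ p)
    have h' := neg_abs_le (ν p + k * γ p)
    have h'' := abs_nonneg m
    beta_reduce at this
    linarith
  have hb : ∀ p, d - c ≤ ν p + l * γ p := fun p => le_interpolate hk hl (hb0 p) (hb1 p)
  have hA : 0 ≤ m + c := by
    have := neg_abs_le m
    linarith
  obtain ⟨A, hA'⟩ := Int.eq_ofNat_of_zero_le hA
  have hdl := SLDominant.interpolate hk hl hd0 hdk
  have hsumc : ∀ x : ℤ, ∑ p, (ν p + x * γ p + c) = ∑ p, ν p + (N + 1) * c := fun x => by
    rw [Finset.sum_add_distrib, Finset.sum_add_distrib, ← Finset.mul_sum, hγ]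
    simp
  set a' : Option I → Fin (N + 1) → ℕ := fun o => o.elim (Pi.single (Fin.last N) A) a with ha'
  have hsa : ∑ o, ∑ j : Fin (N + 1), (a' o j : ℤ) * (j + 1) = (N + 1) * A + d := by
    rw [Fintype.sum_option]
    congr 1
    rw [Finset.sum_eq_single (Fin.last N)]
    · simp [ha', mul_comm]
    · intro j _ hj
      simp [ha', hj]
    · simp
  have hsum : ∀ x : ℤ, ∑ p, (ν p + x * γ p + c) = ∑ o, ∑ j : Fin (N + 1), (a' o j : ℤ) * (j + 1) :=
      by
    intro x
    rw [hsumc, hsa, ← hA']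
    push_cast at hm
    linarith
  have shift : ∀ {f : Fin (N + 1) → ℤ}, SLDominant f → SLDominant fun p => f p + c :=
    fun h i j hij => by have := h i j hij; linarith
  rw [← hasHWFun_option_iff a _ A c] at h0 h1 ⊢
  have hsum0 := hsum 0
  simp only [zero_mul, add_zero] at hsum0
  refine hasHWFun_of_flagIneq a' _ (shift hdl) (fun p => by have := hb p; linarith)
    (hsum l) (fun o => ?_) (fun ρ hρ => ?_)
  · rcases o with _ | i
    · have e1 : ∑ j, (a' none j : ℤ) = A := by
        rw [Finset.sum_eq_single (Fin.last N)]
        · simp [ha']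
        · intro j _ hj
          simp [ha', hj]
        · simp
      rw [e1]
      have e2 : ∑ p, (ν p + (l : ℤ) * γ p + c) ≤ ∑ p : Fin (N + 1), (ν 0 + (l : ℤ) * γ 0 + c) :=
        Finset.sum_le_sum fun p _ => by
          have := hdl 0 p (Fin.zero_le p)
          beta_reduce at this
          linarith
      rw [hsum l, hsa, Finset.sum_const, Finset.card_univ, Fintype.card_fin, nsmul_eq_mul] at e2
      push_cast at e2
      by_contra hcon
      push Not at hcon
      nlinarith [Int.natCast_nonneg N]
    · have := had i
      have := hb 0
      simp only [ha', Option.elim_some]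
      linarith
  · have f0 := flagIneq_of_hasHWFun a' _ (shift hd0)
      (fun p => by have := hb0 p; linarith) hsum0 h0 ρ hρ
    have f1 := flagIneq_of_hasHWFun a' _ (shift hdk)
      (fun p => by have := hb1 p; linarith) (hsum k) h1 ρ hρ
    have e : ∀ x : ℤ, (fun p => ν p + x * γ p + c) = fun p => (ν p + c) + x * γ p :=
      fun x => by funext p; ring
    rw [e] at f1 ⊢
    exact FlagIneq.interpolate hk hl f0 f1

end

section Transvections
open Matrix.SpecialLinearGroup
variable {ι : Type*} [Fintype ι] [DecidableEq ι]

lemma diag2n_coe_eq {i j : ι} (hij : i ≠ j) (x : ℂ) (hx : x ≠ 0) :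
    (diag2n hij x hx).val = 1 + Matrix.single i i (x - 1) + Matrix.single j j (x⁻¹ - 1) := by
  rw [diag2n_coe]
  ext a b
  by_cases hab : a = b
  · subst hab
    simp only [Matrix.diagonal_apply_eq, Matrix.add_apply, Matrix.one_apply_eq,
      Matrix.single_apply, and_self, eq_comm (a := a)]
    split_ifs with h1 h2 <;> first | (exfalso; exact hij (h1.trans h2.symm)) | ring
  · rw [Matrix.diagonal_apply_ne _ hab]
    simp only [Matrix.add_apply, Matrix.one_apply_ne hab, Matrix.single_apply]
    rw [if_neg (fun h => hab (h.1.symm.trans h.2)), if_neg (fun h => hab (h.1.symm.trans h.2))]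
    ring

lemma transvection_mul_transvection_eq {i j : ι} (hij : i ≠ j) (x : ℂ) (hx : x ≠ 0) :
    (transvection hij 1 * transvection hij.symm (x - 1) : Matrix.SpecialLinearGroup ι ℂ) =
      transvection hij.symm ((x - 1) / x) * diag2n hij x hx * transvection hij x⁻¹ := by
  apply Subtype.ext
  simp only [Matrix.SpecialLinearGroup.coe_mul, diag2n_coe_eq, transvection_coe]
  simp only [mul_add, add_mul, one_mul, mul_one, Matrix.single_mul_single_same,
    Matrix.single_mul_single_of_ne _ _ _ _ hij, Matrix.single_mul_single_of_ne _ _ _ _ hij.symm,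
        zero_mul]
  ext a b
  simp only [Matrix.add_apply, Matrix.single_apply, Matrix.zero_apply]
  split_ifs <;> first | (exfalso; grind) | (field_simp; ring)

/-- Conjugation of a transvection by a diagonal matrix. -/
lemma diag_mul_transvection {n : ℕ} {t : SL n} (ht : SLIsDiag t) {i j : Fin n} (hij : i ≠ j)
    (x : ℂ) : t * transvection hij x = transvection hij (t.val i i * x * (t.val j j)⁻¹) * t := by
  apply Subtype.ext
  have h0 : t.val j j ≠ 0 := ht.ne_zero j
  have hd : t.val = Matrix.diagonal fun p => t.val p p := by
    ext a b
    by_cases h : a = b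
    · subst h; simp
    · rw [Matrix.diagonal_apply_ne _ h, ht a b h]
  simp only [Matrix.SpecialLinearGroup.coe_mul, transvection_coe, mul_add, add_mul, one_mul,
      mul_one]
  congr 1
  ext a b
  rw [hd, Matrix.diagonal_mul, Matrix.mul_diagonal]
  simp only [Matrix.single_apply, Matrix.diagonal_apply_eq]
  split_ifs with h
  · rw [← h.1, ← h.2, inv_mul_cancel_right₀ h0]
  · simp

/-- A predicate stable under right multiplication by transvections holds everywhere. -/
theorem transvection_induction {n : ℕ} {P : SL n → Prop} (h1 : P 1)
    (hmul : ∀ g (i j : Fin n) (hij : i ≠ j) (x : ℂ), P g → P (g * transvection hij x)) (g : SL n) :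
    P g := by
  rcases Nat.lt_or_ge 1 n with hn | hn
  · have : Nontrivial (Fin n) := Fin.nontrivial_iff_two_le.2 hn
    suffices h : ∀ g' : SL n, ∀ g, P g → P (g * g') by simpa using h g 1 h1
    intro g'
    refine diagonal_transvection_induction' (fun g' => ∀ g, P g → P (g * g')) g' ?_
      (fun i j hij x g hg => hmul g i j hij x hg)
      (fun A B hA hB g hg => by rw [← mul_assoc]; exact hB _ (hA _ hg))
    intro i j hij x hx g hg
    have e : (diag2n hij x hx : SL n) = transvection hij.symm (-((x - 1) / x)) *
        transvection hij 1 * transvection hij.symm (x - 1) * transvection hij (-x⁻¹) := by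
      rw [← transvection_inv, ← transvection_inv, mul_assoc _ (transvection hij 1),
        transvection_mul_transvection_eq hij x hx]
      group
    rw [e]
    simp only [← mul_assoc]
    exact hmul _ _ _ _ _ (hmul _ _ _ _ _ (hmul _ _ _ _ _ (hmul _ _ _ _ _ hg)))
  · have : Subsingleton (Fin n) := Fin.subsingleton_iff_le_one.2 hn
    have : g = 1 := Subtype.ext (by
      ext i j
      have hj : j = i := Subsingleton.elim _ _
      subst hj
      have hdet : g.val.det = 1 := g.2
      rw [Matrix.det_eq_elem_of_subsingleton _ j] at hdet
      simp [hdet])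
    rw [this]
    exact h1

end Transvections

section TPoly
open Matrix.SpecialLinearGroup
variable {n : ℕ}

/-- A function on `SL n` whose restrictions to arithmetic progressions in root subgroups are
polynomial. -/
def TPoly (φ : SL n → ℂ) : Prop :=
  ∀ (g h : SL n) (i j : Fin n) (hij : i ≠ j) (x : ℂ),
    ∃ q : ℂ[X], ∀ m : ℕ, φ (g * transvection hij (m * x) * h) = q.eval (m : ℂ)

lemma TPoly.const (c : ℂ) : TPoly fun _ : SL n => c := fun _ _ _ _ _ _ => ⟨C c, by simp⟩

lemma TPoly.add {φ ψ : SL n → ℂ} (hφ : TPoly φ) (hψ : TPoly ψ) : TPoly fun g => φ g + ψ g := by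
  intro g h i j hij x
  obtain ⟨p, hp⟩ := hφ g h i j hij x
  obtain ⟨q, hq⟩ := hψ g h i j hij x
  exact ⟨p + q, fun m => by beta_reduce; rw [eval_add, hp, hq]⟩

lemma TPoly.mul {φ ψ : SL n → ℂ} (hφ : TPoly φ) (hψ : TPoly ψ) : TPoly fun g => φ g * ψ g := by
  intro g h i j hij x
  obtain ⟨p, hp⟩ := hφ g h i j hij x
  obtain ⟨q, hq⟩ := hψ g h i j hij x
  exact ⟨p * q, fun m => by beta_reduce; rw [eval_mul, hp, hq]⟩

lemma TPoly.prod {κ : Type*} (s : Finset κ) {φ : κ → SL n → ℂ} (h : ∀ a ∈ s, TPoly (φ a)) :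
    TPoly fun g => ∏ a ∈ s, φ a g := by
  classical
  induction s using Finset.induction_on with
  | empty => simpa using TPoly.const 1
  | insert a s ha ih =>
    simp only [Finset.prod_insert ha]
    exact (h a (Finset.mem_insert_self _ _)).mul
      (ih fun b hb => h b (Finset.mem_insert_of_mem hb))

lemma TPoly.multiset_prod {κ : Type*} (s : Multiset κ) {φ : κ → SL n → ℂ}
    (h : ∀ a ∈ s, TPoly (φ a)) : TPoly fun g => (s.map fun a => φ a g).prod := by
  induction s using Multiset.induction_on with
  | empty => simpa using TPoly.const 1
  | cons a s ih =>
    simp only [Multiset.map_cons, Multiset.prod_cons]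
    exact (h a (Multiset.mem_cons_self _ _)).mul
      (ih fun b hb => h b (Multiset.mem_cons_of_mem hb))

lemma TPoly.ringHom {φ : SL n → ℂ} (hφ : TPoly φ) (σ : ℂ →+* ℂ) : TPoly fun g => σ (φ g) := by
  intro g h i j hij x
  obtain ⟨p, hp⟩ := hφ g h i j hij x
  refine ⟨p.map σ, fun m => ?_⟩
  beta_reduce
  rw [hp, ← map_natCast σ m, eval_map, eval₂_at_apply, map_natCast]

lemma TPoly.leadingMinor (j : Fin n) : TPoly fun g : SL n => leadingMinor j g.val := by
  intro g h a b hab x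
  obtain ⟨q, hq⟩ := exists_poly_det (ι := Fin (j + 1))
    (fun m : ℂ => ((g.val * (1 + Matrix.single a b (m * x)) * h.val).submatrix
      (Fin.castLE (Nat.succ_le_of_lt j.2)) (Fin.castLE (Nat.succ_le_of_lt j.2)))) (by
    intro i k
    refine ⟨C ((g.val * h.val) (Fin.castLE (Nat.succ_le_of_lt j.2) i)
      (Fin.castLE (Nat.succ_le_of_lt j.2) k)) + X * C ((g.val * Matrix.single a b x * h.val)
      (Fin.castLE (Nat.succ_le_of_lt j.2) i) (Fin.castLE (Nat.succ_le_of_lt j.2) k)), fun m => ?_⟩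
    have : Matrix.single a b (m * x) = m • Matrix.single a b x := by
      rw [Matrix.smul_single, smul_eq_mul]
    rw [this, mul_add, add_mul, mul_one, Matrix.mul_smul, Matrix.smul_mul]
    simp [mul_comm m])
  exact ⟨q, fun m => hq m⟩

/-- `TPoly` functions form a domain. -/
theorem TPoly.eq_zero_or {φ ψ : SL n → ℂ} (hφ : TPoly φ) (hψ : TPoly ψ)
    (h : ∀ g, φ g * ψ g = 0) : (∀ g, φ g = 0) ∨ ∀ g, ψ g = 0 := by
  by_contra! hcon
  obtain ⟨⟨a, ha⟩, b, hb⟩ := hcon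
  have key : ∀ w : SL n, ∀ a, φ a ≠ 0 → ψ (a * w) ≠ 0 → False := by
    intro w
    suffices H : ∀ w' : SL n, ∀ a, φ (a * w'⁻¹) ≠ 0 → ψ (a) ≠ 0 → False by
      intro a ha hb
      exact H w (a * w) (by simpa using ha) hb
    intro w'
    refine transvection_induction (P := fun w' => ∀ a, φ (a * w'⁻¹) ≠ 0 → ψ a ≠ 0 → False)
      (fun a h1 h2 => mul_ne_zero (by simpa using h1) h2 (h a)) (fun g i j hij x ih a h1 h2 => ?_)
          w'
    obtain ⟨p, hp⟩ := hφ a g⁻¹ i j hij (-x)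
    obtain ⟨q, hq⟩ := hψ a 1 i j hij (-x)
    have hp0 : p ≠ 0 := fun h0 => h1 (by
      have := hp 1
      rw [h0, eval_zero, Nat.cast_one, one_mul] at this
      rw [mul_inv_rev, transvection_inv, ← mul_assoc, this])
    have hq0 : q ≠ 0 := fun h0 => h2 (by simpa [h0] using hq 0)
    obtain ⟨m, hm⟩ : ∃ m : ℕ, (p * q).eval (m : ℂ) ≠ 0 := by
      by_contra! hall
      exact mul_ne_zero hp0 hq0 (eq_zero_of_infinite_isRoot _
        ((Set.infinite_range_of_injective (Nat.cast_injective (R := ℂ))).mono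
          (by rintro _ ⟨m, rfl⟩; exact hall m)))
    rw [eval_mul, ← hp, ← hq, mul_one] at hm
    exact ih _ (left_ne_zero_of_mul hm) (right_ne_zero_of_mul hm)
  exact key (a⁻¹ * b) a ha (by simpa using hb)

end TPoly

section LU
open Matrix.SpecialLinearGroup
variable {n : ℕ}

/-- The subgroup generated by the lower triangular transvections. -/
def lowerSub (n : ℕ) : Subgroup (SL n) :=
  Subgroup.closure {g | ∃ (i j : Fin n) (hij : i ≠ j) (x : ℂ), j < i ∧ g = transvection hij x}

/-- The subgroup generated by the upper triangular transvections. -/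
def upperSub (n : ℕ) : Subgroup (SL n) :=
  Subgroup.closure {g | ∃ (i j : Fin n) (hij : i ≠ j) (x : ℂ), i < j ∧ g = transvection hij x}

lemma transvection_mem_lowerSub {i j : Fin n} (hij : i ≠ j) (h : j < i) (x : ℂ) :
    transvection hij x ∈ lowerSub n := Subgroup.subset_closure ⟨i, j, hij, x, h, rfl⟩

lemma transvection_mem_upperSub {i j : Fin n} (hij : i ≠ j) (h : i < j) (x : ℂ) :
    transvection hij x ∈ upperSub n := Subgroup.subset_closure ⟨i, j, hij, x, h, rfl⟩

lemma transpose_transvection {i j : Fin n} (hij : i ≠ j) (x : ℂ) :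
    (transvection hij x : SL n).transpose = transvection hij.symm x := by
  apply Subtype.ext
  rw [Matrix.SpecialLinearGroup.coe_transpose, transvection_coe, transvection_coe,
    Matrix.transpose_add, Matrix.transpose_one, Matrix.transpose_single]

lemma transpose_mul_SL (g h : SL n) : (g * h).transpose = h.transpose * g.transpose :=
  Subtype.ext (by simp [Matrix.transpose_mul])

lemma transpose_one_SL : (1 : SL n).transpose = 1 := Subtype.ext (by simp)

lemma transpose_mem_upperSub {g : SL n} (h : g ∈ lowerSub n) : g.transpose ∈ upperSub n := by
  induction h using Subgroup.closure_induction with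
  | mem g hg =>
    obtain ⟨i, j, hij, x, h, rfl⟩ := hg
    rw [transpose_transvection]
    exact transvection_mem_upperSub _ h x
  | one => rw [transpose_one_SL]; exact one_mem _
  | mul x y _ _ hx hy => rw [transpose_mul_SL]; exact mul_mem hy hx
  | inv x _ hx =>
    have : (x⁻¹).transpose = x.transpose⁻¹ := by
      rw [eq_inv_iff_mul_eq_one, ← transpose_mul_SL, mul_inv_cancel, transpose_one_SL]
    rw [this]
    exact inv_mem hx

/-- Multiplication of leading minors for a lower triangular left factor. -/
lemma leadingMinor_mul_of_lower {L M : Matrix (Fin n) (Fin n) ℂ} (hL : ∀ i j, i < j → L i j = 0)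
    (j : Fin n) : leadingMinor j (L * M) = leadingMinor j L * leadingMinor j M := by
  unfold leadingMinor
  rw [← Matrix.det_mul]
  congr 1
  ext a b
  rw [Matrix.submatrix_apply, Matrix.mul_apply, Matrix.mul_apply]
  symm
  refine Finset.sum_of_injOn (Fin.castLE (Nat.succ_le_of_lt j.2))
    (Fin.castLE_injective _).injOn (fun _ _ => Finset.mem_coe.2 (Finset.mem_univ _))
    (fun k _ hk => ?_) (fun k _ => rfl)
  rw [hL _ _ ?_, zero_mul]
  by_contra hcon
  refine hk ⟨⟨k, ?_⟩, Finset.mem_coe.2 (Finset.mem_univ _), Fin.ext rfl⟩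
  have h1 : k.val ≤ a.val := not_lt.1 hcon
  have := a.2
  omega

lemma leadingMinor_of_upper {M : Matrix (Fin n) (Fin n) ℂ} {j : Fin n}
    (hM : ∀ a b : Fin n, a ≤ j → b < a → M a b = 0) :
    leadingMinor j M = ∏ i ∈ Finset.Iic j, M i i := by
  unfold leadingMinor
  rw [Matrix.det_of_isUpperTriangular]
  · refine Finset.prod_of_injOn (Fin.castLE (Nat.succ_le_of_lt j.2))
      (Fin.castLE_injective _).injOn (fun a _ => ?_) (fun k hk hk' => ?_) (fun k _ => rfl)
    · rw [Finset.coe_Iic, Set.mem_Iic]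
      exact Nat.lt_succ_iff.1 a.2
    · have hk1 : k ≤ j := Finset.mem_Iic.1 hk
      exact absurd ⟨⟨k, Nat.lt_succ_of_le hk1⟩, Finset.mem_coe.2 (Finset.mem_univ _),
          Fin.ext rfl⟩ hk'
  · intro a b hab
    exact hM _ _ (Nat.lt_succ_iff.1 a.2) hab

lemma leadingMinor_of_lower {M : Matrix (Fin n) (Fin n) ℂ} {j : Fin n}
    (hM : ∀ a b : Fin n, a < b → M a b = 0) :
    leadingMinor j M = ∏ i ∈ Finset.Iic j, M i i := by
  have : leadingMinor j M = leadingMinor j M.transpose := by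
    unfold leadingMinor
    rw [← Matrix.det_transpose, Matrix.transpose_submatrix]
  rw [this, leadingMinor_of_upper (M := M.transpose) fun a b _ h => hM b a h]
  rfl

lemma lowerSub_lower {l : SL n} (h : l ∈ lowerSub n) :
    (∀ i j, i < j → l.val i j = 0) ∧ ∀ i, l.val i i = 1 := by
  have hgen : ∀ {i j : Fin n} (hij : i ≠ j) (x : ℂ), j < i →
      (∀ a b, a < b → (transvection hij x : SL n).val a b = 0) ∧
      ∀ a, (transvection hij x : SL n).val a a = 1 := by
    intro i j hij x h
    rw [transvection_coe]
    constructor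
    · intro a b hab
      rw [Matrix.add_apply, Matrix.one_apply_ne hab.ne, Matrix.single_apply, if_neg, add_zero]
      rintro ⟨rfl, rfl⟩
      exact lt_asymm h hab
    · intro a
      rw [Matrix.add_apply, Matrix.one_apply_eq, Matrix.single_apply, if_neg, add_zero]
      rintro ⟨rfl, h⟩
      exact hij h.symm
  have hmul : ∀ {x y : SL n}, ((∀ i j, i < j → x.val i j = 0) ∧ ∀ i, x.val i i = 1) →
      ((∀ i j, i < j → y.val i j = 0) ∧ ∀ i, y.val i i = 1) →
      (∀ i j, i < j → (x * y).val i j = 0) ∧ ∀ i, (x * y).val i i = 1 := by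
    intro x y hx hy
    constructor
    · intro i j hij
      rw [Matrix.SpecialLinearGroup.coe_mul, Matrix.mul_apply]
      refine Finset.sum_eq_zero fun k _ => ?_
      rcases lt_or_ge i k with h | h
      · rw [hx.1 _ _ h, zero_mul]
      · rw [hy.1 _ _ (h.trans_lt hij), mul_zero]
    · intro i
      rw [Matrix.SpecialLinearGroup.coe_mul, Matrix.mul_apply, Finset.sum_eq_single i]
      · rw [hx.2, hy.2, one_mul]
      · intro k _ hk
        rcases lt_or_gt_of_ne hk with h | h
        · rw [hy.1 _ _ h, mul_zero]
        · rw [hx.1 _ _ h, zero_mul]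
      · simp
  refine Subgroup.closure_induction_left (p := fun l _ => (∀ i j, i < j → l.val i j = 0) ∧
    ∀ i, l.val i i = 1) ⟨fun i j hij => Matrix.one_apply_ne hij.ne, fun i => Matrix.one_apply_eq i⟩
    ?_ ?_ h
  · rintro _ ⟨i, j, hij, x, h, rfl⟩ y _ hy
    exact hmul (hgen hij x h) hy
  · rintro _ ⟨i, j, hij, x, h, rfl⟩ y _ hy
    rw [transvection_inv]
    exact hmul (hgen hij _ h) hy

lemma leadingMinor_lowerSub_mul {l : SL n} (h : l ∈ lowerSub n) (g : SL n) (j : Fin n) :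
    leadingMinor j (l * g).val = leadingMinor j g.val := by
  rw [Matrix.SpecialLinearGroup.coe_mul, leadingMinor_mul_of_lower (lowerSub_lower h).1,
    leadingMinor_of_lower (lowerSub_lower h).1]
  simp [(lowerSub_lower h).2]

lemma exists_lowerSub_clear_column (g : SL n) (c : Fin n)
    (h : ∀ i j, j < c → j < i → g.val i j = 0) (hc : g.val c c ≠ 0) (s : Finset (Fin n))
    (hs : ∀ i ∈ s, c < i) :
    ∃ l ∈ lowerSub n, (∀ i j, j < c → j < i → (l * g).val i j = 0) ∧
      (∀ i ∈ s, (l * g).val i c = 0) ∧ (l * g).val c c ≠ 0 := by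
  induction s using Finset.induction_on with
  | empty => exact ⟨1, one_mem _, by simpa using h, by simp, by simpa using hc⟩
  | insert a s ha ih =>
    obtain ⟨l, hl, h1, h2, h3⟩ := ih fun i hi => hs i (Finset.mem_insert_of_mem hi)
    have hac : c < a := hs a (Finset.mem_insert_self _ _)
    set x := -((l * g).val a c / (l * g).val c c) with hx
    have hrow : ∀ i j, (transvection hac.ne' x * l * g).val i j =
        (l * g).val i j + if i = a then x * (l * g).val c j else 0 := by
      intro i j
      rw [mul_assoc, Matrix.SpecialLinearGroup.coe_mul, transvection_coe, add_mul, one_mul,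
        Matrix.add_apply]
      congr 1
      split_ifs with hi
      · subst hi
        simp
      · rw [Matrix.single_mul_apply_of_ne _ _ _ _ _ hi]
    refine ⟨transvection hac.ne' x * l, mul_mem (transvection_mem_lowerSub _ hac _) hl,
      fun i j hj hji => ?_, fun i hi => ?_, ?_⟩
    · rw [hrow, h1 i j hj hji, h1 c j hj hj]
      simp
    · rw [hrow]
      rcases Finset.mem_insert.1 hi with rfl | his
      · rw [if_pos rfl, hx]
        field_simp
        ring
      · rw [h2 i his, if_neg (fun e : i = a => ha (e ▸ his)), add_zero]
    · rw [hrow, if_neg hac.ne, add_zero]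
      exact h3

/-- The elimination half of the LU decomposition. -/
theorem exists_lowerSub_mul_upper (g : SL n) (hg : ∀ j, leadingMinor j g.val ≠ 0) :
    ∃ l ∈ lowerSub n, ∀ i j, j < i → (l * g).val i j = 0 := by
  suffices H : ∀ c ≤ n, ∃ l ∈ lowerSub n, ∀ i j : Fin n, j.val < c → j < i →
      (l * g).val i j = 0 by
    obtain ⟨l, hl, h⟩ := H n le_rfl
    exact ⟨l, hl, fun i j => h i j j.2⟩
  intro c
  induction c with
  | zero => exact fun _ => ⟨1, one_mem _, fun i j h => absurd h (Nat.not_lt_zero _)⟩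
  | succ c ih =>
    intro hc
    obtain ⟨l, hl, h⟩ := ih (Nat.le_of_succ_le hc)
    set c' : Fin n := ⟨c, hc⟩ with hc'
    have hpiv : (l * g).val c' c' ≠ 0 := by
      have h1 := hg c'
      rw [← leadingMinor_lowerSub_mul hl, leadingMinor_of_upper] at h1
      · exact Finset.prod_ne_zero_iff.1 h1 c' (Finset.mem_Iic.2 le_rfl)
      · intro a b ha hb
        exact h a b (lt_of_lt_of_le hb ha) hb
    obtain ⟨l', hl', h1, h2, -⟩ := exists_lowerSub_clear_column (l * g) c' h hpiv
      (Finset.univ.filter (c' < ·)) (by simp)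
    refine ⟨l' * l, mul_mem hl' hl, fun i j hj hji => ?_⟩
    rw [mul_assoc]
    rcases Nat.lt_succ_iff_lt_or_eq.1 hj with hj | hj
    · exact h1 i j hj hji
    · have : j = c' := Fin.ext hj
      subst this
      exact h2 i (by simpa using hji)

theorem mem_upperSub_of_uniUpper {u : SL n} (hu : SLIsUniUpper u) : u ∈ upperSub n := by
  have hlow : ∀ i j, i < j → u.transpose.val i j = 0 := fun i j hij => hu.2 j i hij
  obtain ⟨l, hl, h⟩ := exists_lowerSub_mul_upper u.transpose (fun j => by
    rw [leadingMinor_of_lower hlow]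
    refine Finset.prod_ne_zero_iff.2 fun i _ => ?_
    rw [Matrix.SpecialLinearGroup.coe_transpose, Matrix.transpose_apply, hu.1]
    exact one_ne_zero)
  have h1 : l * u.transpose = 1 := by
    apply Subtype.ext
    ext i j
    rcases lt_trichotomy i j with hij | rfl | hij
    · rw [Matrix.SpecialLinearGroup.coe_one, Matrix.one_apply_ne hij.ne,
        Matrix.SpecialLinearGroup.coe_mul, Matrix.mul_apply]
      refine Finset.sum_eq_zero fun k _ => ?_
      rcases lt_or_ge i k with h | h
      · rw [(lowerSub_lower hl).1 _ _ h, zero_mul]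
      · rw [hlow _ _ (h.trans_lt hij), mul_zero]
    · rw [Matrix.SpecialLinearGroup.coe_one, Matrix.one_apply_eq,
        Matrix.SpecialLinearGroup.coe_mul, Matrix.mul_apply, Finset.sum_eq_single i]
      · rw [(lowerSub_lower hl).2, Matrix.SpecialLinearGroup.coe_transpose, Matrix.transpose_apply,
          hu.1, one_mul]
      · intro k _ hk
        rcases lt_or_gt_of_ne hk with h | h
        · rw [hlow _ _ h, mul_zero]
        · rw [(lowerSub_lower hl).1 _ _ h, zero_mul]
      · simp
    · rw [h _ _ hij, Matrix.SpecialLinearGroup.coe_one, Matrix.one_apply_ne hij.ne']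
  have h2 : u = (l⁻¹).transpose := by
    rw [← (eq_inv_of_mul_eq_one_right h1 : u.transpose = l⁻¹)]
    exact Subtype.ext (by simp)
  rw [h2]
  exact transpose_mem_upperSub (inv_mem hl)

/-- The Gauss decomposition on the big cell. -/
theorem exists_gauss (g : SL n) (hg : ∀ j, leadingMinor j g.val ≠ 0) :
    ∃ l ∈ lowerSub n, ∃ u ∈ upperSub n, ∃ t, SLIsDiag t ∧ g = l * t * u ∧
      ∀ j, leadingMinor j g.val = ∏ i ∈ Finset.Iic j, t.val i i := by
  obtain ⟨l, hl, h⟩ := exists_lowerSub_mul_upper g hg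
  set b := l * g with hb
  have hmin : ∀ j, leadingMinor j g.val = ∏ i ∈ Finset.Iic j, b.val i i := fun j => by
    rw [← leadingMinor_lowerSub_mul hl, ← hb, leadingMinor_of_upper fun a b _ => h a b]
  have hlow : ∀ i j, i < j → b.transpose.val i j = 0 := fun i j hij => h j i hij
  obtain ⟨l', hl', h'⟩ := exists_lowerSub_mul_upper b.transpose (fun j => by
    have := hg j
    rw [hmin] at this
    rwa [leadingMinor_of_lower hlow])
  have hdiag : SLIsDiag (l' * b.transpose) := by
    intro i j hij
    rcases lt_or_gt_of_ne hij with hij | hij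
    · rw [Matrix.SpecialLinearGroup.coe_mul, Matrix.mul_apply]
      refine Finset.sum_eq_zero fun k _ => ?_
      rcases lt_or_ge i k with h | h
      · rw [(lowerSub_lower hl').1 _ _ h, zero_mul]
      · rw [hlow _ _ (h.trans_lt hij), mul_zero]
    · exact h' i j hij
  have hdd : ∀ i, (l' * b.transpose).val i i = b.val i i := by
    intro i
    rw [Matrix.SpecialLinearGroup.coe_mul, Matrix.mul_apply, Finset.sum_eq_single i]
    · rw [(lowerSub_lower hl').2, one_mul]
      rfl
    · intro k _ hk
      rcases lt_or_gt_of_ne hk with h | h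
      · rw [hlow _ _ h, mul_zero]
      · rw [(lowerSub_lower hl').1 _ _ h, zero_mul]
    · simp
  have hself : (l' * b.transpose).transpose = l' * b.transpose := by
    apply Subtype.ext
    ext i j
    rw [Matrix.SpecialLinearGroup.coe_transpose, Matrix.transpose_apply]
    by_cases hij : i = j
    · rw [hij]
    · rw [hdiag i j hij, hdiag j i (Ne.symm hij)]
  have htt : ∀ x : SL n, x.transpose.transpose = x := fun x => Subtype.ext (by simp)
  rw [transpose_mul_SL, htt] at hself
  refine ⟨l⁻¹, inv_mem hl, l'.transpose⁻¹, inv_mem (transpose_mem_upperSub hl'), _, hdiag, ?_,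
    fun j => ?_⟩
  · rw [← hself, hb]
    group
  · simp only [hdd, hmin]

end LU

section Nilp
variable {V : Type*} [AddCommGroup V] [Module ℂ V] [FiniteDimensional ℂ V]

lemma Module.End.isNilpotent_of_spectrum {φ : Module.End ℂ V} (h : ∀ μ ∈ spectrum ℂ φ, μ = 0) :
    IsNilpotent φ := by
  have hs : φ.charpoly.Splits := IsAlgClosed.splits _
  have hr : φ.charpoly.roots = Multiset.replicate (Multiset.card φ.charpoly.roots) 0 :=
    Multiset.eq_replicate_card.2 fun b hb => h b
      ((Module.End.mem_spectrum_iff_isRoot_charpoly φ b).2 (isRoot_of_mem_roots hb))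
  have h1 := hs.eq_prod_roots_of_monic φ.charpoly_monic
  rw [hr, Multiset.map_replicate, Multiset.prod_replicate, C_0, sub_zero] at h1
  refine ⟨Multiset.card φ.charpoly.roots, ?_⟩
  have h2 := φ.aeval_self_charpoly
  rwa [h1, map_pow, aeval_X] at h2

lemma Module.End.ncard_spectrum_le (φ : Module.End ℂ V) :
    (spectrum ℂ φ).ncard ≤ Module.finrank ℂ V := by
  classical
  have h : spectrum ℂ φ ⊆ ((φ.charpoly.roots.toFinset : Finset ℂ) : Set ℂ) := fun μ hμ => by
    rw [Finset.mem_coe, Multiset.mem_toFinset, mem_roots φ.charpoly_monic.ne_zero]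
    exact (Module.End.mem_spectrum_iff_isRoot_charpoly φ μ).1 hμ
  refine (Set.ncard_le_ncard h (Finset.finite_toSet _)).trans ?_
  rw [Set.ncard_coe_finset]
  refine (Multiset.toFinset_card_le _).trans ((card_roots' _).trans ?_)
  rw [LinearMap.charpoly_natDegree]

/-- If the fourth power map permutes a finite set of nonzero numbers, then its elements are roots
of unity of controlled order. -/
lemma pow_eq_one_of_image_pow_four {S : Set ℂ} (hS : S.Finite) (h0 : (0 : ℂ) ∉ S)
    (h : (· ^ 4) '' S = S) {d : ℕ} (hd : S.ncard ≤ d) {μ : ℂ} (hμ : μ ∈ S) :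
    μ ^ (4 ^ d.factorial - 1) = 1 := by
  classical
  have : Fintype S := hS.fintype
  have hmaps : ∀ x ∈ S, x ^ 4 ∈ S := fun x hx => h ▸ Set.mem_image_of_mem (fun y => y ^ 4) hx
  let f : S → S := fun x => ⟨x.1 ^ 4, hmaps x x.2⟩
  have hf : Function.Surjective f := by
    rintro ⟨y, hy⟩
    have hy' := hy
    rw [← h] at hy'
    obtain ⟨x, hx, rfl⟩ := hy'
    exact ⟨⟨x, hx⟩, rfl⟩
  let e : Equiv.Perm S := Equiv.ofBijective f ⟨Finite.injective_iff_surjective.2 hf, hf⟩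
  have he : ∀ (k : ℕ) (x : S), ((e ^ k) x).1 = x.1 ^ 4 ^ k := by
    intro k x
    induction k with
    | zero => simp
    | succ k ih =>
      rw [pow_succ' e, Equiv.Perm.mul_apply]
      change ((e ^ k) x).1 ^ 4 = _
      rw [ih, ← pow_mul, pow_succ]
  have h1 : e ^ d.factorial = 1 := by
    have h2 : Fintype.card (Equiv.Perm S) ∣ d.factorial := by
      rw [Fintype.card_perm]
      apply Nat.factorial_dvd_factorial
      rwa [← Nat.card_coe_set_eq, Nat.card_eq_fintype_card] at hd
    obtain ⟨c, hc⟩ := h2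
    rw [hc, pow_mul, pow_card_eq_one, one_pow]
  have h2 := he d.factorial ⟨μ, hμ⟩
  rw [h1, Equiv.Perm.one_apply] at h2
  have hμ0 : μ ≠ 0 := fun e => h0 (e ▸ hμ)
  have h3 : 4 ^ d.factorial = (4 ^ d.factorial - 1) + 1 :=
    (Nat.sub_add_cancel (Nat.one_le_pow _ _ (by norm_num))).symm
  dsimp only at h2
  rw [h3, pow_succ] at h2
  exact mul_right_cancel₀ hμ0 (by rw [one_mul]; exact h2.symm)

/-- A one-parameter group whose elements are conjugate to their fourth powers is unipotent. -/
theorem isNilpotent_sub_one_of_conj {U : ℂ → Module.End ℂ V} (hadd : ∀ x y, U (x + y) = U x * U y)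
    (h0 : U 0 = 1) (hconj : ∀ x, ∃ P : (Module.End ℂ V)ˣ, U (4 * x) = P * U x * (P⁻¹ : _)) (x : ℂ) :
    IsNilpotent (U x - 1) := by
  have hpow : ∀ (m : ℕ) x, U (m * x) = U x ^ m := by
    intro m x
    induction m with
    | zero => simp [h0]
    | succ m ih => rw [Nat.cast_succ, add_mul, one_mul, hadd, ih, pow_succ]
  have hunit : ∀ x, IsUnit (U x) := fun x =>
    ⟨⟨U x, U (-x), by rw [← hadd, add_neg_cancel, h0], by rw [← hadd, neg_add_cancel, h0]⟩, rfl⟩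
  have hS : ∀ x, (· ^ 4) '' spectrum ℂ (U x) = spectrum ℂ (U x) := by
    intro x
    rw [← spectrum.map_pow_of_pos _ (by norm_num : 0 < 4), ← hpow]
    obtain ⟨P, hP⟩ := hconj x
    rw [Nat.cast_ofNat, hP]
    exact spectrum.units_conjugate
  set M := 4 ^ (Module.finrank ℂ V).factorial - 1 with hM
  have hMpos : 0 < M := by
    have : 4 ^ 1 ≤ 4 ^ (Module.finrank ℂ V).factorial :=
      Nat.pow_le_pow_right (by norm_num) (Nat.factorial_pos _)
    omega
  have h1 : ∀ y, ∀ μ ∈ spectrum ℂ (U y), μ ^ M = 1 := fun y μ hμ =>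
    pow_eq_one_of_image_pow_four (Module.End.finite_spectrum _)
      (spectrum.zero_notMem ℂ (hunit y)) (hS y) (Module.End.ncard_spectrum_le _) hμ
  have hx : x = M * (x / M) := by
    rw [mul_div_cancel₀]
    exact Nat.cast_ne_zero.2 hMpos.ne'
  apply Module.End.isNilpotent_of_spectrum
  intro μ hμ
  have h2 : μ + 1 ∈ spectrum ℂ (U x) := by
    have := (spectrum.add_mem_add_iff (R := ℂ) (r := μ) (s := 1) (a := U x - 1)).2 hμ
    simpa [add_comm] using this
  rw [hx, hpow, spectrum.map_pow_of_pos _ hMpos] at h2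
  obtain ⟨ξ, hξ, h3⟩ := h2
  have h4 : μ + 1 = 1 := h3.symm.trans (h1 _ ξ hξ)
  simpa using h4

end Nilp

section Common
variable {V : Type*} [AddCommGroup V] [Module ℂ V] [FiniteDimensional ℂ V]

theorem exists_common_eigenvector {ι : Type*} (f : ι → Module.End ℂ V)
    (hcomm : ∀ i j, Commute (f i) (f j)) (W : Submodule ℂ V) (hW : W ≠ ⊥)
    (hstab : ∀ i, ∀ w ∈ W, f i w ∈ W) : ∃ v ∈ W, v ≠ 0 ∧ ∀ i, ∃ μ : ℂ, f i v = μ • v := by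
  induction hd : Module.finrank ℂ W using Nat.strong_induction_on generalizing W with
  | _ d ih =>
    by_cases h : ∀ i, ∃ μ : ℂ, ∀ w ∈ W, f i w = μ • w
    · obtain ⟨v, hv, hv0⟩ := W.ne_bot_iff.1 hW
      exact ⟨v, hv, hv0, fun i => (h i).imp fun μ hμ => hμ v hv⟩
    · push Not at h
      obtain ⟨i, hi⟩ := h
      have : Nontrivial W := Submodule.nontrivial_iff_ne_bot.2 hW
      obtain ⟨μ, hμ⟩ := Module.End.exists_eigenvalue ((f i).restrict (hstab i))
      obtain ⟨w, hw⟩ := hμ.exists_hasEigenvector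
      have hw1 : f i w.1 = μ • w.1 := congrArg Subtype.val hw.apply_eq_smul
      have hw0 : w.1 ≠ 0 := fun h => hw.2 (Subtype.ext h)
      obtain ⟨w', hw', hne⟩ := hi μ
      set W' := W ⊓ LinearMap.ker (f i - μ • (1 : Module.End ℂ V)) with hW'
      have hmem : ∀ x, x ∈ W' ↔ x ∈ W ∧ f i x = μ • x := fun x => by
        rw [hW', Submodule.mem_inf, LinearMap.mem_ker, LinearMap.sub_apply, sub_eq_zero]
        rfl
      have hlt : W' < W := by
        refine lt_of_le_of_ne inf_le_left fun e => hne ((hmem w').1 (e ▸ hw')).2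
      obtain ⟨v, hv, h1⟩ := ih _ (hd ▸ Submodule.finrank_lt_finrank_of_lt hlt) W'
        (W'.ne_bot_iff.2 ⟨w, (hmem _).2 ⟨w.2, hw1⟩, hw0⟩) (fun j x hx => by
          rw [hmem] at hx ⊢
          refine ⟨hstab j x hx.1, ?_⟩
          have := LinearMap.congr_fun (hcomm i j).eq x
          rw [Module.End.mul_apply, Module.End.mul_apply, hx.2, map_smul] at this
          exact this) rfl
      exact ⟨v, ((hmem v).1 hv).1, h1⟩

end Common

section HighestWeight
open Matrix.SpecialLinearGroup
variable {n : ℕ} {V : Type*} [AddCommGroup V] [Module ℂ V] [FiniteDimensional ℂ V]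

lemma diag2n_isDiag {i j : Fin n} (hij : i ≠ j) (x : ℂ) (hx : x ≠ 0) :
    SLIsDiag (diag2n hij x hx) := fun a b hab => by
  rw [diag2n_coe, Matrix.diagonal_apply_ne _ hab]

lemma diag2n_fst {i j : Fin n} (hij : i ≠ j) (x : ℂ) (hx : x ≠ 0) :
    (diag2n hij x hx).val i i = x := by
  rw [diag2n_coe_eq]
  simp [hij.symm]

lemma diag2n_snd {i j : Fin n} (hij : i ≠ j) (x : ℂ) (hx : x ≠ 0) :
    (diag2n hij x hx).val j j = x⁻¹ := by
  rw [diag2n_coe_eq]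
  simp [hij]

lemma diag2n_of_ne {i j : Fin n} (hij : i ≠ j) (x : ℂ) (hx : x ≠ 0) {p : Fin n} (hi : p ≠ i)
    (hj : p ≠ j) : (diag2n hij x hx).val p p = 1 := by
  rw [diag2n_coe_eq]
  simp [hi.symm, hj.symm]

lemma transvection_nat_mul {i j : Fin n} (hij : i ≠ j) (m : ℕ) (x : ℂ) :
    (transvection hij (m * x) : SL n) = transvection hij x ^ m := by
  induction m with
  | zero => simp
  | succ m ih => rw [Nat.cast_succ, add_mul, one_mul, transvection_add, ih, pow_succ]

theorem Representation.isNilpotent_transvection (ρ : Representation ℂ (SL n) V) {i j : Fin n}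
    (hij : i ≠ j) (x : ℂ) : IsNilpotent (ρ (transvection hij x) - 1) := by
  refine isNilpotent_sub_one_of_conj (U := fun x => ρ (transvection hij x))
    (fun x y => by rw [transvection_add, map_mul]) (by simp) (fun x => ?_) x
  have h2 : (2 : ℂ) ≠ 0 := two_ne_zero
  have h := diag_mul_transvection (diag2n_isDiag hij 2 h2) hij x
  rw [diag2n_fst, diag2n_snd, inv_inv] at h
  refine ⟨⟨ρ (diag2n hij 2 h2), ρ (diag2n hij 2 h2)⁻¹, by rw [← map_mul]; simp,
    by rw [← map_mul]; simp⟩, ?_⟩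
  change _ = ρ _ * ρ _ * ρ _
  rw [← map_mul, ← map_mul, h, mul_assoc, mul_inv_cancel, mul_one]
  congr 2
  ring

lemma exists_grading_torus (hn : 0 < n) : ∃ t : SL n, SLIsDiag t ∧ ∀ i j : Fin n, i < j →
    t.val i i * (t.val j j)⁻¹ = ((4 ^ (j.val - i.val) : ℕ) : ℂ) := by
  obtain ⟨c, hc⟩ := IsAlgClosed.exists_pow_nat_eq (∏ i : Fin n, ((4 : ℂ) ^ i.val)) hn
  have h4 : ∀ i : Fin n, (4 : ℂ) ^ i.val ≠ 0 := fun i => pow_ne_zero _ (by norm_num)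
  have hc0 : c ≠ 0 := by
    rintro rfl
    rw [zero_pow hn.ne'] at hc
    exact Finset.prod_ne_zero_iff.2 (fun i _ => h4 i) hc.symm
  refine ⟨⟨Matrix.diagonal fun i => c * ((4 : ℂ) ^ i.val)⁻¹, ?_⟩,
    fun i j hij => Matrix.diagonal_apply_ne _ hij, fun i j hij => ?_⟩
  · rw [Matrix.det_diagonal, Finset.prod_mul_distrib, Finset.prod_const, Finset.card_univ,
      Fintype.card_fin, hc, Finset.prod_inv_distrib, mul_inv_cancel₀]
    exact Finset.prod_ne_zero_iff.2 fun i _ => h4 i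
  · change (Matrix.diagonal _ i i) * (Matrix.diagonal _ j j)⁻¹ = _
    rw [Matrix.diagonal_apply_eq, Matrix.diagonal_apply_eq, mul_inv, inv_inv]
    have : (4 : ℂ) ^ j.val = 4 ^ (j.val - i.val) * 4 ^ i.val := by
      rw [← pow_add, Nat.sub_add_cancel hij.le]
    rw [this]
    push_cast
    field_simp [h4 i]

/-- Vectors of maximal grade are fixed by positive unipotents. -/
lemma apply_eq_of_max_grade {τ u : Module.End ℂ V} {q : ℕ} (hq : 2 ≤ q)
    (hu : IsNilpotent (u - 1)) (hτ : τ * u = u ^ q * τ) {μ : ℂ} (hμ0 : μ ≠ 0)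
    (hmax : ∀ μ' : ℂ, τ.HasEigenvalue μ' → ‖μ'‖ ≤ ‖μ‖) {v : V} (hv : τ v = μ • v) : u v = v := by
  classical
  by_contra hne
  have hex : ∃ k : ℕ, ((u - 1) ^ k : Module.End ℂ V) v = 0 := by
    obtain ⟨k, hk⟩ := hu
    exact ⟨k, by rw [hk]; rfl⟩
  obtain ⟨k, hk⟩ : ∃ k, Nat.find hex = k + 1 + 1 := by
    have h0 : Nat.find hex ≠ 0 := fun h => by
      have := Nat.find_spec hex
      rw [h, pow_zero, Module.End.one_apply] at this
      exact hne (by rw [this, map_zero])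
    have h1 : Nat.find hex ≠ 1 := fun h => by
      have := Nat.find_spec hex
      rw [h, pow_one, LinearMap.sub_apply, Module.End.one_apply, sub_eq_zero] at this
      exact hne this
    exact ⟨Nat.find hex - 2, by omega⟩
  set w := ((u - 1) ^ (k + 1)) v with hw
  have hw0 : w ≠ 0 := Nat.find_min hex (by omega)
  have huw : u w = w := by
    have := Nat.find_spec hex
    rw [hk, pow_succ', Module.End.mul_apply, ← hw, LinearMap.sub_apply, Module.End.one_apply,
      sub_eq_zero] at this
    exact this
  have hsemi : SemiconjBy τ (u - 1) (u ^ q - 1) := by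
    change τ * (u - 1) = (u ^ q - 1) * τ
    rw [mul_sub, sub_mul, hτ, mul_one, one_mul]
  have hgeom : (u ^ q - 1) ^ (k + 1) = (∑ i ∈ Finset.range q, u ^ i) ^ (k + 1) *
      (u - 1) ^ (k + 1) := by
    rw [← geom_sum_mul, Commute.mul_pow]
    refine (Commute.sum_left _ _ _ fun i _ => ?_)
    exact ((Commute.refl u).pow_left i).sub_right (Commute.one_right _)
  have hpw : ∀ i : ℕ, (u ^ i) w = w := fun i => by
    induction i with
    | zero => rfl
    | succ i ih => rw [pow_succ, Module.End.mul_apply, huw, ih]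
  have hsum : ∀ m : ℕ, ((∑ i ∈ Finset.range q, u ^ i) ^ m) w = ((q : ℂ) ^ m) • w := fun m => by
    induction m with
    | zero => simp
    | succ m ih =>
      rw [pow_succ', Module.End.mul_apply, ih, map_smul, LinearMap.sum_apply]
      simp only [hpw, Finset.sum_const, Finset.card_range]
      rw [← Nat.cast_smul_eq_nsmul ℂ, smul_smul, pow_succ]
  have hτw : τ w = (q ^ (k + 1) * μ : ℂ) • w := by
    have := LinearMap.congr_fun (hsemi.pow_right (k + 1)).eq v
    rw [Module.End.mul_apply, Module.End.mul_apply, hv, map_smul, hgeom, Module.End.mul_apply,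
      ← hw, hsum, smul_smul] at this
    rw [this, mul_comm]
  have hle := hmax _ (Module.End.hasEigenvalue_of_hasEigenvector
    ⟨Module.End.mem_eigenspace_iff.2 hτw, hw0⟩)
  rw [norm_mul, norm_pow, Complex.norm_natCast] at hle
  have h1 : (1 : ℝ) < (q : ℝ) ^ (k + 1) :=
    one_lt_pow₀ (by exact_mod_cast hq) (Nat.succ_ne_zero _)
  have h2 : 0 < ‖μ‖ := norm_pos_iff.2 hμ0
  nlinarith

theorem Representation.exists_highest_weight_vector (hn : 0 < n) (ρ : Representation ℂ (SL n) V)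
    [Nontrivial V] : ∃ v : V, v ≠ 0 ∧ (∀ t, SLIsDiag t → ∃ μ : ℂ, ρ t v = μ • v) ∧
      ∀ u ∈ upperSub n, ρ u v = v := by
  obtain ⟨τ, hτ, hgr⟩ := exists_grading_torus hn
  obtain ⟨μ, hμ, hmax⟩ : ∃ μ : ℂ, Module.End.HasEigenvalue (ρ τ) μ ∧
      ∀ μ' : ℂ, Module.End.HasEigenvalue (ρ τ) μ' → ‖μ'‖ ≤ ‖μ‖ := by
    obtain ⟨μ0, h0⟩ := Module.End.exists_eigenvalue (ρ τ)
    obtain ⟨μ, h1, h2⟩ := Set.exists_max_image {μ : ℂ | Module.End.HasEigenvalue (ρ τ) μ} (fun z =>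
        ‖z‖)
      (Module.End.finite_hasEigenvalue _) ⟨μ0, h0⟩
    exact ⟨μ, h1, h2⟩
  have hμ0 : μ ≠ 0 := by
    rintro rfl
    obtain ⟨w, hw⟩ := hμ.exists_hasEigenvector
    have h1 := hw.apply_eq_smul
    rw [zero_smul] at h1
    exact hw.2 (by rw [← ρ.inv_self_apply τ w, h1, map_zero])
  have htt : ∀ s t : SL n, SLIsDiag s → SLIsDiag t → s * t = t * s := by
    intro s t hs ht
    have hd : ∀ t : SL n, SLIsDiag t → t.val = Matrix.diagonal fun p => t.val p p := by
      intro t ht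
      ext a b
      by_cases h : a = b
      · subst h; simp
      · rw [Matrix.diagonal_apply_ne _ h, ht a b h]
    apply Subtype.ext
    rw [Matrix.SpecialLinearGroup.coe_mul, Matrix.SpecialLinearGroup.coe_mul, hd s hs, hd t ht,
      Matrix.diagonal_mul_diagonal, Matrix.diagonal_mul_diagonal]
    congr 1
    ext p
    exact mul_comm _ _
  obtain ⟨v, hv, hv0, h⟩ := exists_common_eigenvector (fun t : {t : SL n // SLIsDiag t} => ρ t.1)
    (fun s t => by
      change _ * _ = _ * _
      rw [← map_mul, ← map_mul, htt _ _ s.2 t.2]) (Module.End.eigenspace (ρ τ) μ) hμ (fun t w hw =>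
          by
      rw [Module.End.mem_eigenspace_iff] at hw ⊢
      rw [← Module.End.mul_apply, ← map_mul, htt _ _ hτ t.2, map_mul, Module.End.mul_apply, hw,
        map_smul])
  refine ⟨v, hv0, fun t ht => h ⟨t, ht⟩, fun u hu => ?_⟩
  rw [Module.End.mem_eigenspace_iff] at hv
  induction hu using Subgroup.closure_induction with
  | mem g hg =>
    obtain ⟨i, j, hij, x, hlt, rfl⟩ := hg
    refine apply_eq_of_max_grade (q := 4 ^ (j.val - i.val)) ?_ (ρ.isNilpotent_transvection hij x)
      ?_ hμ0 hmax hv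
    · calc 2 ≤ 4 ^ 1 := by norm_num
        _ ≤ 4 ^ (j.val - i.val) := Nat.pow_le_pow_right (by norm_num) (by
          have : i.val < j.val := hlt
          omega)
    · rw [← map_pow, ← map_mul, ← map_mul, diag_mul_transvection hτ, ← transvection_nat_mul,
        mul_right_comm, hgr i j hlt]
  | one => simp
  | mul x y _ _ hx hy => rw [map_mul, Module.End.mul_apply, hy, hx]
  | inv x _ hx =>
    nth_rewrite 1 [← hx]
    exact ρ.inv_self_apply x v

end HighestWeight

section CharLemma
variable {d : ℕ}

/-- A nonzero function on `ℂ^d`, additive in each variable, which spans a finite dimensional space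
under dilations and is homogeneous for a character `χ`, forces `χ` to be a product of ring
homomorphisms. -/
theorem char_eq_prod_of_multiadditive {P : (Fin d → ℂ) → ℂ} (hP : P ≠ 0)
    (hadd : ∀ x i a b, P (Function.update x i (a + b)) =
      P (Function.update x i a) + P (Function.update x i b))
    {χ : ℂ → ℂ} (hχ : ∀ c, c ≠ 0 → ∀ x, P (fun i => c * x i) = χ c * P x)
    (E : Submodule ℂ ((Fin d → ℂ) → ℂ)) [FiniteDimensional ℂ E]
    (hE : ∀ c : Fin d → ℂ, (fun x => P (c * x)) ∈ E) :
    ∃ σ : Fin d → ℂ →+* ℂ, ∀ c, c ≠ 0 → χ c = ∏ i, σ i c := by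
  classical
  set F : Submodule ℂ ((Fin d → ℂ) → ℂ) :=
    Submodule.span ℂ (Set.range fun (c : Fin d → ℂ) x => P (c * x)) with hF
  have hFE : F ≤ E := Submodule.span_le.2 (by rintro _ ⟨c, rfl⟩; exact hE c)
  have : FiniteDimensional ℂ F := Submodule.finiteDimensional_of_le hFE
  let D : (Fin d → ℂ) → Module.End ℂ ((Fin d → ℂ) → ℂ) := fun c =>
    LinearMap.funLeft ℂ ℂ fun x => c * x
  have hD : ∀ c φ x, D c φ x = φ (c * x) := fun c φ x => rfl
  have hDF : ∀ c, ∀ φ ∈ F, D c φ ∈ F := by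
    intro c φ hφ
    induction hφ using Submodule.span_induction with
    | mem φ h =>
      obtain ⟨c', rfl⟩ := h
      refine Submodule.subset_span ⟨c' * c, ?_⟩
      funext x
      rw [hD]
      beta_reduce
      rw [mul_assoc]
    | zero => rw [map_zero]; exact zero_mem _
    | add φ ψ _ _ h1 h2 => rw [map_add]; exact add_mem h1 h2
    | smul a φ _ h => rw [map_smul]; exact F.smul_mem a h
  have hPF : P ∈ F := Submodule.subset_span ⟨1, by simp⟩
  obtain ⟨Q, -, hQ0, hQ⟩ := exists_common_eigenvector (fun c => (D c).restrict (hDF c))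
    (fun c c' => by
      refine LinearMap.ext fun φ => Subtype.ext (funext fun x => ?_)
      change φ.1 (c' * (c * x)) = φ.1 (c * (c' * x))
      rw [mul_left_comm]) ⊤ (by
      rw [Ne, Submodule.eq_bot_iff]
      push Not
      exact ⟨⟨P, hPF⟩, Submodule.mem_top, fun h => hP (congrArg Subtype.val h)⟩)
    (fun _ _ _ => Submodule.mem_top)
  choose κ hκ using hQ
  have hκ' : ∀ c x, Q.1 (c * x) = κ c * Q.1 x := fun c x =>
    congrFun (congrArg Subtype.val (hκ c)) x
  have hQ1 : Q.1 1 ≠ 0 := by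
    intro h
    apply hQ0
    apply Subtype.ext
    funext x
    have := hκ' x 1
    rw [mul_one, h, mul_zero] at this
    exact this
  have hFadd : ∀ φ ∈ F, ∀ x i a b, φ (Function.update x i (a + b)) =
      φ (Function.update x i a) + φ (Function.update x i b) := by
    intro φ hφ
    induction hφ using Submodule.span_induction with
    | mem φ h =>
      obtain ⟨c, rfl⟩ := h
      intro x i a b
      have hu : ∀ a, c * Function.update x i a = Function.update (c * x) i (c i * a) := by
        intro a
        funext j
        by_cases hj : j = i
        · subst hj; simp
        · simp [hj]
      beta_reduce
      rw [hu, hu, hu, mul_add, hadd]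
    | zero => simp
    | add φ ψ _ _ h1 h2 =>
      intro x i a b
      simp only [Pi.add_apply, h1, h2]
      ring
    | smul a φ _ h =>
      intro x i a b
      simp only [Pi.smul_apply, h, smul_eq_mul]
      ring
  have hFχ : ∀ φ ∈ F, ∀ c, c ≠ 0 → ∀ x, φ (fun i => c * x i) = χ c * φ x := by
    intro φ hφ c hc
    induction hφ using Submodule.span_induction with
    | mem φ h =>
      obtain ⟨c', rfl⟩ := h
      intro x
      beta_reduce
      rw [← hχ c hc]
      congr 1
      funext i
      exact mul_left_comm _ _ _
    | zero => simp
    | add φ ψ _ _ h1 h2 =>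
      intro x
      simp only [Pi.add_apply, h1, h2]
      ring
    | smul a φ _ h =>
      intro x
      simp only [Pi.smul_apply, h, smul_eq_mul]
      ring
  have hκ1 : ∀ x, Q.1 x = κ x * Q.1 1 := fun x => by rw [← hκ' x 1, mul_one]
  have hκone : κ 1 = 1 := mul_right_cancel₀ hQ1 (by rw [← hκ1, one_mul])
  have hκmul : ∀ c c', κ (c * c') = κ c * κ c' := fun c c' =>
    mul_right_cancel₀ hQ1 (by rw [← hκ1, hκ', hκ1 c', mul_assoc])
  let κm : (Fin d → ℂ) →* ℂ := ⟨⟨κ, hκone⟩, hκmul⟩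
  let m : Fin d → ℂ →* ℂ := fun i => κm.comp (MonoidHom.mulSingle (fun _ : Fin d => ℂ) i)
  have hmadd : ∀ i a b, m i (a + b) = m i a + m i b := by
    intro i a b
    apply mul_right_cancel₀ hQ1
    change κ (Pi.mulSingle i (a + b)) * _ = (κ (Pi.mulSingle i a) + κ (Pi.mulSingle i b)) * _
    rw [add_mul, ← hκ1, ← hκ1, ← hκ1]
    exact hFadd Q.1 Q.2 1 i a b
  refine ⟨fun i => ⟨m i, ?_, hmadd i⟩, fun c hc => ?_⟩
  · have := hmadd i 0 0
    rw [add_zero] at this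
    exact left_eq_add.1 this
  · have h1 : χ c = κ fun _ => c := by
      apply mul_right_cancel₀ hQ1
      rw [← hκ1, ← hFχ Q.1 Q.2 c hc]
      simp
    rw [h1, ← Finset.univ_prod_mulSingle (fun _ : Fin d => c)]
    change κm _ = _
    rw [map_prod]
    rfl

variable {A : Type*} [CommRing A] [Algebra ℂ A] [FiniteDimensional ℂ A]

/-- Characters through which dilations act on a matrix coefficient of a unipotent one-parameter
group are products of ring homomorphisms. -/
theorem char_eq_prod {U : ℂ → A} (hadd : ∀ x y, U (x + y) = U x * U y) (h0 : U 0 = 1)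
    (hnil : ∀ x, IsNilpotent (U x - 1)) {T : ℂ → A →ₗ[ℂ] A}
    (hT : ∀ c x, U (c * x) - 1 = T c (U x - 1)) {ℓ : A →ₗ[ℂ] ℂ} {χ : ℂ → ℂ}
    (hχ : ∀ c, c ≠ 0 → ∀ x, ℓ (U (c * x)) = χ c * ℓ (U x)) (hne : ∃ x, ℓ (U x) ≠ 0) :
    ∃ L : Multiset (ℂ →+* ℂ), ∀ c, c ≠ 0 → χ c = (L.map fun σ => σ c).prod := by
  classical
  set ε : ℂ → A := fun x => U x - 1 with hε
  have hart : IsArtinianRing A := IsArtinianRing.of_finite ℂ A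
  obtain ⟨M, hM⟩ := IsArtinianRing.isNilpotent_nilradical (R := A)
  have hbound : ∀ s : Multiset ℂ, M ≤ Multiset.card s → (s.map ε).prod = 0 := by
    intro s hs
    have h1 : ∀ s : Multiset ℂ, (s.map ε).prod ∈ nilradical A ^ Multiset.card s := by
      intro s
      induction s using Multiset.induction_on with
      | empty => simp
      | cons a s ih =>
        rw [Multiset.map_cons, Multiset.prod_cons, Multiset.card_cons, pow_succ']
        exact Ideal.mul_mem_mul (mem_nilradical.2 (hnil a)) ih
    have h2 := Ideal.pow_le_pow_right hs (h1 s)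
    rw [hM] at h2
    exact h2
  let S : Set ℕ := {d | ∃ s : Multiset ℂ, Multiset.card s = d ∧ ℓ (s.map ε).prod ≠ 0}
  have hSne : S.Nonempty := by
    by_contra hS
    rw [Set.not_nonempty_iff_eq_empty, Set.eq_empty_iff_forall_notMem] at hS
    obtain ⟨x, hx⟩ := hne
    have e0 : ℓ 1 = 0 := by
      by_contra h
      exact hS 0 ⟨0, rfl, by simpa using h⟩
    have e1 : ℓ (ε x) = 0 := by
      by_contra h
      exact hS 1 ⟨{x}, rfl, by simpa using h⟩
    apply hx
    rw [hε, map_sub, e0, sub_zero] at e1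
    exact e1
  have hSb : BddAbove S := ⟨M, fun d hd => by
    obtain ⟨s, rfl, hs⟩ := hd
    by_contra h
    exact hs (by rw [hbound s (le_of_not_ge h), map_zero])⟩
  obtain ⟨d, hd, hmax⟩ : ∃ d ∈ S, ∀ d' ∈ S, d' ≤ d :=
    ⟨sSup S, Nat.sSup_mem hSne hSb, fun d' h => le_csSup hSb h⟩
  have hvan : ∀ s : Multiset ℂ, Multiset.card s = d + 1 → ℓ (s.map ε).prod = 0 := by
    intro s hs
    by_contra h
    have := hmax _ ⟨s, hs, h⟩
    omega
  let P : (Fin d → ℂ) → ℂ := fun x => ℓ (∏ i, ε (x i))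
  have hP : P ≠ 0 := by
    obtain ⟨s, hs, h⟩ := hd
    intro hP0
    apply h
    obtain ⟨l, rfl⟩ := Quot.exists_rep s
    have hl : l.length = d := hs
    subst hl
    have := congrFun hP0 fun i => l.get i
    simp only [P, Pi.zero_apply] at this
    rw [← this]
    congr 1
    change ((l : Multiset ℂ).map ε).prod = _
    rw [Multiset.map_coe, Multiset.prod_coe, ← List.prod_ofFn]
    congr 1
    exact (List.ofFn_getElem_eq_map l ε).symm
  have hεadd : ∀ a b, ε (a + b) = ε a + ε b + ε a * ε b := by
    intro a b
    simp only [hε, hadd]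
    ring
  have hPadd : ∀ x i a b, P (Function.update x i (a + b)) =
      P (Function.update x i a) + P (Function.update x i b) := by
    intro x i a b
    have hupd : ∀ a, ∏ j, ε (Function.update x i a j) =
        ε a * ∏ j ∈ Finset.univ.erase i, ε (x j) := by
      intro a
      rw [← Finset.mul_prod_erase _ _ (Finset.mem_univ i), Function.update_self]
      congr 1
      refine Finset.prod_congr rfl fun j hj => ?_
      rw [Function.update_of_ne (Finset.ne_of_mem_erase hj)]
    have hcross : ℓ (ε a * ε b * ∏ j ∈ Finset.univ.erase i, ε (x j)) = 0 := by
      have := hvan (a ::ₘ b ::ₘ (Finset.univ.erase i).val.map x) (by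
        rw [Multiset.card_cons, Multiset.card_cons, Multiset.card_map, Finset.card_val,
          Finset.card_erase_of_mem (Finset.mem_univ _), Finset.card_univ, Fintype.card_fin]
        have := i.pos
        omega)
      rw [Multiset.map_cons, Multiset.map_cons, Multiset.prod_cons, Multiset.prod_cons,
        Multiset.map_map, ← mul_assoc] at this
      exact this
    simp only [P, hupd, hεadd, add_mul, map_add, hcross, add_zero]
  have hhom : ∀ c, c ≠ 0 → ∀ (s : Multiset ℂ) y, ℓ (U (c * y) * (s.map fun x => ε (c * x)).prod) =
      χ c * ℓ (U y * (s.map ε).prod) := by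
    intro c hc s
    induction s using Multiset.induction_on with
    | empty => intro y; simpa using hχ c hc y
    | cons a s ih =>
      intro y
      have e1 : ∀ u v w, U u * (ε v * w) = U (u + v) * w - U u * w := by
        intro u v w
        rw [hadd]
        simp only [hε]
        ring
      rw [Multiset.map_cons, Multiset.map_cons, Multiset.prod_cons, Multiset.prod_cons, e1, e1,
        ← mul_add, map_sub, map_sub, ih, ih, mul_sub]
  have hPχ : ∀ c, c ≠ 0 → ∀ x, P (fun i => c * x i) = χ c * P x := by
    intro c hc x
    have := hhom c hc (Finset.univ.val.map x) 0
    rw [mul_zero, h0, one_mul, one_mul, Multiset.map_map, Multiset.map_map] at this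
    exact this
  let Ev : MultilinearMap ℂ (fun _ : Fin d => A) ℂ →ₗ[ℂ] ((Fin d → ℂ) → ℂ) :=
    { toFun := fun m x => m fun i => ε (x i)
      map_add' := fun _ _ => rfl
      map_smul' := fun _ _ => rfl }
  obtain ⟨σ, hσ⟩ := char_eq_prod_of_multiadditive hP hPadd hPχ (LinearMap.range Ev) (by
    intro c
    refine ⟨ℓ.compMultilinearMap ((MultilinearMap.mkPiAlgebra ℂ (Fin d) A).compLinearMap
      fun i => T (c i)), ?_⟩
    funext x
    change ℓ (MultilinearMap.mkPiAlgebra ℂ (Fin d) A _) = _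
    rw [MultilinearMap.mkPiAlgebra_apply]
    simp only [P, Pi.mul_apply, hε, hT])
  exact ⟨Finset.univ.val.map σ, fun c hc => by rw [hσ c hc, Multiset.map_map]; rfl⟩

end CharLemma

section NilpPoly
variable {R : Type*} [Ring R] [Algebra ℂ R]

/-- Powers of a unipotent element depend polynomially on the exponent. -/
lemma exists_poly_pow_of_isNilpotent {u : R} (hu : IsNilpotent (u - 1)) (L : R →ₗ[ℂ] ℂ) :
    ∃ q : ℂ[X], ∀ m : ℕ, L (u ^ m) = q.eval (m : ℂ) := by
  obtain ⟨d, hd⟩ := hu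
  refine ⟨∑ k ∈ Finset.range d, C (L ((u - 1) ^ k) * ((k.factorial : ℂ))⁻¹) * descPochhammer ℂ k,
    fun m => ?_⟩
  have h1 : u ^ m = ∑ k ∈ Finset.range (m + 1 + d), (u - 1) ^ k * (m.choose k : R) := by
    have h2 : u = (u - 1) + 1 := by abel
    nth_rewrite 1 [h2]
    rw [(Commute.one_right (u - 1)).add_pow]
    simp only [one_pow, mul_one]
    refine Finset.sum_subset (Finset.range_subset_range.2 (Nat.le_add_right _ _)) fun k _ hk => ?_
    rw [Nat.choose_eq_zero_of_lt, Nat.cast_zero, mul_zero]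
    simpa using hk
  have h3 : u ^ m = ∑ k ∈ Finset.range d, (u - 1) ^ k * (m.choose k : R) := by
    rw [h1]
    symm
    refine Finset.sum_subset (Finset.range_subset_range.2 (Nat.le_add_left _ _)) fun k _ hk => ?_
    have hk' : d ≤ k := by simpa using hk
    rw [← Nat.sub_add_cancel hk', pow_add, hd, mul_zero, zero_mul]
  rw [h3, map_sum, eval_finsetSum]
  refine Finset.sum_congr rfl fun k _ => ?_
  rw [eval_mul, eval_C, descPochhammer_eval_eq_descFactorial,
      Nat.descFactorial_eq_factorial_mul_choose,
    Nat.cast_mul, mul_assoc, inv_mul_cancel_left₀ (by exact_mod_cast k.factorial_ne_zero)]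
  have h4 : (u - 1) ^ k * (m.choose k : R) = (m.choose k : ℂ) • (u - 1) ^ k := by
    rw [Nat.cast_smul_eq_nsmul, nsmul_eq_mul, Nat.cast_comm]
  rw [h4, map_smul, smul_eq_mul, mul_comm]

end NilpPoly

section EndChar
variable {V : Type*} [AddCommGroup V] [Module ℂ V] [FiniteDimensional ℂ V]

open scoped IsMulCommutative in
theorem end_char_eq_prod {U : ℂ → Module.End ℂ V} (hadd : ∀ x y, U (x + y) = U x * U y)
    (h0 : U 0 = 1) (hnil : ∀ x, IsNilpotent (U x - 1))
    (hT : ∀ c, ∃ T : Module.End ℂ V →ₗ[ℂ] Module.End ℂ V, ∀ x, U (c * x) - 1 = T (U x - 1))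
    {ℓ : Module.End ℂ V →ₗ[ℂ] ℂ} {χ : ℂ → ℂ}
    (hχ : ∀ c, c ≠ 0 → ∀ x, ℓ (U (c * x)) = χ c * ℓ (U x)) (hne : ∃ x, ℓ (U x) ≠ 0) :
    ∃ L : Multiset (ℂ →+* ℂ), ∀ c, c ≠ 0 → χ c = (L.map fun σ => σ c).prod := by
  choose T hT using hT
  set A := Algebra.adjoin ℂ (Set.range U) with hA
  have hcomm : IsMulCommutative A := Algebra.isMulCommutative_adjoin ℂ (by
    rintro _ ⟨x, rfl⟩ _ ⟨y, rfl⟩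
    rw [← hadd, add_comm, hadd])
  obtain ⟨π, hπ⟩ := (Subalgebra.toSubmodule A).subtype.exists_leftInverse_of_injective
    (Submodule.ker_subtype _)
  have hπ' : ∀ a : A, π a.1 = a := fun a => LinearMap.congr_fun hπ a
  have hmem : ∀ x, U x ∈ A := fun x => Algebra.subset_adjoin ⟨x, rfl⟩
  have hfin : FiniteDimensional ℂ A := inferInstanceAs
    (FiniteDimensional ℂ (Subalgebra.toSubmodule A))
  refine char_eq_prod (A := A) (U := fun x => ⟨U x, hmem x⟩) (fun x y => Subtype.ext (hadd x y))
    (Subtype.ext h0) (fun x => ?_)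
    (T := fun c => π ∘ₗ T c ∘ₗ (Subalgebra.toSubmodule A).subtype) (fun c x => ?_)
    (ℓ := ℓ ∘ₗ (Subalgebra.toSubmodule A).subtype) hχ hne
  · obtain ⟨k, hk⟩ := hnil x
    exact ⟨k, Subtype.ext hk⟩
  · have h := hT c x
    have h1 := congrArg π h
    change _ = π (T c (U x - 1))
    rw [← h1]
    exact (hπ' (⟨U (c * x), hmem _⟩ - 1)).symm

end EndChar

section Coeff
open Matrix.SpecialLinearGroup
variable {n : ℕ} {V : Type*} [AddCommGroup V] [Module ℂ V] [FiniteDimensional ℂ V]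

lemma Representation.tPoly (ρ : Representation ℂ (SL n) V) (η : V →ₗ[ℂ] ℂ) (v : V) :
    TPoly fun g => η (ρ g v) := by
  intro g h i j hij x
  obtain ⟨q, hq⟩ := exists_poly_pow_of_isNilpotent (R := Module.End ℂ V)
    (ρ.isNilpotent_transvection hij x) (η ∘ₗ ρ g ∘ₗ LinearMap.applyₗ (ρ h v))
  refine ⟨q, fun m => ?_⟩
  rw [← hq, transvection_nat_mul]
  beta_reduce
  rw [map_mul, map_mul, map_pow]
  rfl

lemma Representation.exists_lowest_covector (hn : 0 < n) (ρ : Representation ℂ (SL n) V)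
    [Nontrivial V] : ∃ η : V →ₗ[ℂ] ℂ, η ≠ 0 ∧ ∀ l ∈ lowerSub n, ∀ v, η (ρ l v) = η v := by
  let ρ' : Representation ℂ (SL n) (V →ₗ[ℂ] ℂ) :=
    { toFun := fun g => LinearMap.lcomp ℂ ℂ (ρ g.transpose)
      map_one' := by
        rw [transpose_one_SL, map_one]
        rfl
      map_mul' := fun g h => by
        rw [transpose_mul_SL, map_mul]
        rfl }
  obtain ⟨η, h0, -, h⟩ := ρ'.exists_highest_weight_vector hn
  refine ⟨η, h0, fun l hl v => ?_⟩
  have := LinearMap.congr_fun (h _ (transpose_mem_upperSub hl)) v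
  have htt : l.transpose.transpose = l := Subtype.ext (by simp)
  change η (ρ l.transpose.transpose v) = η v at this
  rwa [htt] at this

end Coeff

section TorusParam
open Matrix.SpecialLinearGroup
variable {N : ℕ}

/-- The coroot parametrization of the diagonal torus. -/
noncomputable def torusParam (N : ℕ) : (Fin N → ℂˣ) →* SL (N + 1) where
  toFun c := ⟨Matrix.diagonal fun i => (if h : i.val < N then (c ⟨i, h⟩ : ℂ) else 1) *
      (if h : 0 < i.val then (c ⟨i.val - 1, by omega⟩ : ℂ) else 1)⁻¹, by
    have h1 : ∏ i : Fin (N + 1), (if h : i.val < N then (c ⟨i, h⟩ : ℂ) else 1) = ∏ i, (c i : ℂ) :=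
        by
      rw [Fin.prod_univ_castSucc, dif_neg (by simp), mul_one]
      exact Finset.prod_congr rfl fun i _ => dif_pos i.2
    have h2 : ∏ i : Fin (N + 1), (if h : 0 < i.val then (c ⟨i.val - 1, by omega⟩ : ℂ) else 1) =
        ∏ i, (c i : ℂ) := by
      rw [Fin.prod_univ_succ, dif_neg (by simp), one_mul]
      exact Finset.prod_congr rfl fun i _ => dif_pos (Nat.succ_pos _)
    rw [Matrix.det_diagonal, Finset.prod_mul_distrib, Finset.prod_inv_distrib, h1, h2]
    exact mul_inv_cancel₀ (Finset.prod_ne_zero_iff.2 fun i _ => (c i).ne_zero)⟩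
  map_one' := by
    apply Subtype.ext
    simp [← Matrix.diagonal_one]
  map_mul' c c' := by
    apply Subtype.ext
    refine Eq.trans ?_ (Matrix.diagonal_mul_diagonal _ _).symm
    refine congrArg Matrix.diagonal ?_
    funext i
    split_ifs <;> simp <;> ring

lemma torusParam_isDiag (c : Fin N → ℂˣ) : SLIsDiag (torusParam N c) :=
  fun _ _ h => Matrix.diagonal_apply_ne _ h

lemma torusParam_mulSingle (j : Fin N) (x : ℂˣ) : torusParam N (Pi.mulSingle j x) =
    diag2n (Fin.castSucc_lt_succ (i := j)).ne x.1 x.ne_zero := by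
  apply Subtype.ext
  rw [diag2n_coe]
  change Matrix.diagonal _ = _
  congr 1
  funext i
  simp only [Pi.mulSingle_apply, Fin.ext_iff, Fin.val_castSucc, Fin.val_succ]
  have := i.2
  have := j.2
  split_ifs <;> first | omega | simp

lemma eq_torusParam {t : SL (N + 1)} (ht : SLIsDiag t) (c : Fin N → ℂˣ)
    (hc : ∀ j : Fin N, (c j : ℂ) = ∏ i ∈ Finset.Iic j.castSucc, t.val i i) :
    t = torusParam N c := by
  apply Subtype.ext
  ext a b
  change _ = Matrix.diagonal _ a b
  by_cases hab : a = b
  swap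
  · rw [ht a b hab, Matrix.diagonal_apply_ne _ hab]
  subst hab
  rw [Matrix.diagonal_apply_eq]
  have hpos : ∀ (h : 0 < a.val), ∏ i ∈ Finset.Iic a, t.val i i = t.val a a *
      ∏ i ∈ Finset.Iic (⟨a.val - 1, by omega⟩ : Fin (N + 1)), t.val i i := by
    intro h
    have : Finset.Iic a = insert a (Finset.Iic (⟨a.val - 1, by omega⟩ : Fin (N + 1))) := by
      ext i
      simp only [Finset.mem_Iic, Finset.mem_insert, Fin.le_def, Fin.ext_iff]
      omega
    rw [this, Finset.prod_insert]
    simp only [Finset.mem_Iic, Fin.le_def]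
    omega
  have h0 : ∀ h : ¬ 0 < a.val, ∏ i ∈ Finset.Iic a, t.val i i = t.val a a := by
    intro h
    have : Finset.Iic a = {a} := by
      ext i
      simp only [Finset.mem_Iic, Finset.mem_singleton, Fin.le_def, Fin.ext_iff]
      omega
    rw [this, Finset.prod_singleton]
  have hA : (if h : a.val < N then (c ⟨a, h⟩ : ℂ) else 1) = ∏ i ∈ Finset.Iic a, t.val i i := by
    split_ifs with h
    · rw [hc]
      rfl
    · have : Finset.Iic a = Finset.univ := by
        ext i
        simp only [Finset.mem_Iic, Finset.mem_univ, iff_true, Fin.le_def]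
        omega
      rw [this, ht.prod_eq_one]
  rw [hA]
  split_ifs with h
  · rw [hpos h, hc]
    have h2 : (⟨a.val - 1, by omega⟩ : Fin N).castSucc = (⟨a.val - 1, by omega⟩ : Fin (N + 1)) :=
        rfl
    rw [h2, mul_inv_cancel_right₀]
    exact Finset.prod_ne_zero_iff.2 fun i _ => ht.ne_zero i
  · rw [h0 h, inv_one, mul_one]

end TorusParam

section Structure
open Matrix.SpecialLinearGroup
variable {n : ℕ} {V : Type*} [AddCommGroup V] [Module ℂ V] [FiniteDimensional ℂ V]

lemma eq_of_forall_nat_pos {q₁ q₂ : ℂ[X]} (h : ∀ m : ℕ, 0 < m → q₁.eval (m : ℂ) = q₂.eval (m : ℂ)) :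
    q₁ = q₂ := by
  refine Polynomial.eq_of_infinite_eval_eq _ _ (Set.Infinite.mono (s := Set.range fun m : ℕ =>
    ((m + 1 : ℕ) : ℂ)) ?_ (Set.infinite_range_of_injective fun a b h => ?_))
  · rintro _ ⟨m, rfl⟩
    exact h _ (Nat.succ_pos _)
  · simpa using h

theorem Representation.character_diag2n (ρ : Representation ℂ (SL n) V) {v : V} {η : V →ₗ[ℂ] ℂ}
    (hηv : η v ≠ 0) (hv : ∀ u ∈ upperSub n, ρ u v = v) (hη : ∀ l ∈ lowerSub n, ∀ w, η (ρ l w) = η w)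
    {χ : SL n → ℂ} (hχ : ∀ t, SLIsDiag t → ρ t v = χ t • v) {i j : Fin n} (hij : i < j) :
    ∃ L : Multiset (ℂ →+* ℂ), ∀ x (hx : x ≠ 0),
      χ (diag2n hij.ne x hx) = (L.map fun σ => σ x).prod := by
  classical
  have hv0 : v ≠ 0 := fun h => hηv (by rw [h, map_zero])
  let U : ℂ → Module.End ℂ V := fun x => ρ (transvection hij.ne' x)
  let w : SL n := transvection hij.ne 1 * transvection hij.ne' (-1)
  let ℓ : Module.End ℂ V →ₗ[ℂ] ℂ := η ∘ₗ ρ w ∘ₗ LinearMap.applyₗ v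
  have hU : ∀ x, U x = ρ (transvection hij.ne' x) := fun x => rfl
  have hadd : ∀ x y, U (x + y) = U x * U y := fun x y => by
    rw [hU, transvection_add, map_mul]
  have h0 : U 0 = 1 := by rw [hU]; simp
  have hℓ : ∀ x, ℓ (U x) = η (ρ (transvection hij.ne 1 * transvection hij.ne' (x - 1)) v) := by
    intro x
    change η (ρ w (ρ (transvection hij.ne' x) v)) = _
    rw [← Module.End.mul_apply, ← map_mul, mul_assoc, ← transvection_add]
    congr 6
    ring
  have hp : ∀ x (hx : x ≠ 0), ℓ (U x) = χ (diag2n hij.ne x hx) * η v := by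
    intro x hx
    rw [hℓ, transvection_mul_transvection_eq hij.ne x hx, map_mul, map_mul, Module.End.mul_apply,
      Module.End.mul_apply, hv _ (transvection_mem_upperSub _ hij _), hχ _ (diag2n_isDiag _ _ _),
      map_smul, map_smul, hη _ (transvection_mem_lowerSub _ hij _), smul_eq_mul]
  let χ' : ℂ → ℂ := fun c => if h : c ≠ 0 then χ (diag2n hij.ne c h) else 0
  have hχ' : ∀ c (h : c ≠ 0), χ' c = χ (diag2n hij.ne c h) := fun c h => dif_pos h
  have hmulχ : ∀ c d, c ≠ 0 → d ≠ 0 → χ' (c * d) = χ' c * χ' d := by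
    intro c d hc hd
    rw [hχ' c hc, hχ' d hd, hχ' _ (mul_ne_zero hc hd)]
    have e : (diag2n hij.ne (c * d) (mul_ne_zero hc hd) : SL n) =
        diag2n hij.ne c hc * diag2n hij.ne d hd := by
      apply Subtype.ext
      rw [Matrix.SpecialLinearGroup.coe_mul, diag2n_coe, diag2n_coe, diag2n_coe,
        Matrix.diagonal_mul_diagonal]
      congr 1
      funext k
      split_ifs <;> simp [mul_comm]
    have h1 := hχ _ (diag2n_isDiag hij.ne (c * d) (mul_ne_zero hc hd))
    rw [e, map_mul, Module.End.mul_apply, hχ _ (diag2n_isDiag _ _ _), map_smul,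
      hχ _ (diag2n_isDiag _ _ _), smul_smul] at h1
    rw [e, mul_comm]
    exact (smul_left_injective ℂ hv0 h1).symm
  have hT : ∀ c, ∃ T : Module.End ℂ V →ₗ[ℂ] Module.End ℂ V, ∀ x, U (c * x) - 1 = T (U x - 1) := by
    intro c
    by_cases hc : c = 0
    · exact ⟨0, fun x => by rw [hc, zero_mul, h0, sub_self]; rfl⟩
    · obtain ⟨a, ha⟩ := IsAlgClosed.exists_pow_nat_eq c⁻¹ (n := 2) (by norm_num)
      have ha0 : a ≠ 0 := by
        rintro rfl
        rw [zero_pow two_ne_zero] at ha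
        exact inv_ne_zero hc ha.symm
      set t : SL n := diag2n hij.ne a ha0 with ht
      refine ⟨LinearMap.mulLeft ℂ (ρ t : Module.End ℂ V) ∘ₗ
        LinearMap.mulRight ℂ (ρ t⁻¹ : Module.End ℂ V), fun x => ?_⟩
      have h1 := diag_mul_transvection (diag2n_isDiag hij.ne a ha0) hij.ne' x
      rw [diag2n_fst, diag2n_snd, ← ht] at h1
      have h2 : a⁻¹ * x * a⁻¹ = c * x := by
        rw [← inv_inv c, ← ha, sq, mul_inv]
        ring
      rw [h2] at h1
      rw [LinearMap.comp_apply, LinearMap.mulLeft_apply, LinearMap.mulRight_apply, sub_mul, mul_sub,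
        one_mul, hU, hU]
      change _ = ρ t * (ρ _ * ρ _) - ρ t * ρ _
      rw [← map_mul, ← map_mul, ← map_mul, mul_inv_cancel, map_one, ← mul_assoc, h1,
        mul_inv_cancel_right]
  have hhom : ∀ c, c ≠ 0 → ∀ x, ℓ (U (c * x)) = χ' c * ℓ (U x) := by
    intro c hc
    have hne : ∀ x, x ≠ 0 → ℓ (U (c * x)) = χ' c * ℓ (U x) := by
      intro x hx
      rw [hp x hx, hp _ (mul_ne_zero hc hx), ← hχ', ← hχ', hmulχ c x hc hx, mul_assoc]
    intro x
    by_cases hx : x = 0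
    · have hpoly : ∀ y : ℂ, ∃ q : ℂ[X], ∀ m : ℕ, ℓ (U (m * y)) = q.eval (m : ℂ) := fun y => by
        obtain ⟨q, hq⟩ := exists_poly_pow_of_isNilpotent (R := Module.End ℂ V)
          (ρ.isNilpotent_transvection hij.ne' y) ℓ
        refine ⟨q, fun m => ?_⟩
        rw [← hq, hU, transvection_nat_mul, map_pow]
      obtain ⟨q₁, h1⟩ := hpoly c
      obtain ⟨q₂, h2⟩ := hpoly 1
      have h3 : q₁ = C (χ' c) * q₂ := eq_of_forall_nat_pos fun m hm => by
        rw [eval_mul, eval_C, ← h1, ← h2, mul_one, mul_comm]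
        exact hne m (Nat.cast_ne_zero.2 hm.ne')
      have h4 := h1 0
      have h5 := h2 0
      rw [h3, eval_mul, eval_C, ← h5] at h4
      rw [hx, mul_zero]
      simpa using h4
    · exact hne x hx
  have hne1 : ℓ (U 1) ≠ 0 := by
    rw [hp 1 one_ne_zero]
    refine mul_ne_zero ?_ hηv
    intro h
    have h1 := hχ _ (diag2n_isDiag hij.ne 1 one_ne_zero)
    rw [h, zero_smul] at h1
    exact hv0 (by rw [← ρ.inv_self_apply (diag2n hij.ne 1 one_ne_zero) v, h1, map_zero])
  obtain ⟨L, hL⟩ := end_char_eq_prod (U := U) hadd h0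
    (fun x => ρ.isNilpotent_transvection hij.ne' x) hT (ℓ := ℓ) (χ := χ') hhom ⟨1, hne1⟩
  exact ⟨L, fun x hx => by rw [← hχ' x hx, hL x hx]⟩

/-- The product of twisted leading minors attached to multisets of ring homomorphisms. -/
noncomputable def charProd (L : Fin n → Multiset (ℂ →+* ℂ)) (g : SL n) : ℂ :=
  ∏ j, ((L j).map fun σ => σ (leadingMinor j g.val)).prod

lemma tPoly_charProd (L : Fin n → Multiset (ℂ →+* ℂ)) : TPoly (charProd L) :=
  TPoly.prod _ fun j _ => TPoly.multiset_prod _ fun σ _ => (TPoly.leadingMinor j).ringHom σ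

lemma leadingMinor_one (j : Fin n) : leadingMinor j (1 : SL n).val = 1 := by
  rw [Matrix.SpecialLinearGroup.coe_one, leadingMinor_of_lower fun a b h => Matrix.one_apply_ne
      h.ne]
  simp

/-- `TPoly` functions vanishing on the big cell vanish. -/
lemma TPoly.eq_zero_of_bigCell {φ : SL n → ℂ} (hφ : TPoly φ)
    (h : ∀ g : SL n, (∀ j, _root_.leadingMinor j g.val ≠ 0) → φ g = 0) (g : SL n) : φ g = 0 := by
  classical
  have hΔ : TPoly fun g : SL n => ∏ j, _root_.leadingMinor j g.val :=
    TPoly.prod _ fun j _ => TPoly.leadingMinor j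
  have hz : ∀ g, φ g * ∏ j, _root_.leadingMinor j g.val = 0 := fun g => by
    by_cases hg : ∀ j, _root_.leadingMinor j g.val ≠ 0
    · rw [h g hg, zero_mul]
    · push Not at hg
      obtain ⟨j, hj⟩ := hg
      rw [Finset.prod_eq_zero (Finset.mem_univ j) hj, mul_zero]
  rcases hφ.eq_zero_or hΔ hz with h1 | h1
  · exact h1 g
  · have := h1 1
    simp only [leadingMinor_one, Finset.prod_const_one] at this
    exact absurd this one_ne_zero

end Structure

section Structure
open Matrix.SpecialLinearGroup
variable {N : ℕ} {V : Type*} [AddCommGroup V] [Module ℂ V]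

lemma SLIsDiag.mul {n : ℕ} {s t : SL n} (hs : SLIsDiag s) (ht : SLIsDiag t) : SLIsDiag (s * t) := by
  intro i j hij
  rw [Matrix.SpecialLinearGroup.coe_mul, Matrix.mul_apply]
  refine Finset.sum_eq_zero fun k _ => ?_
  by_cases h : i = k
  · subst h
    rw [ht _ _ hij, mul_zero]
  · rw [hs _ _ h, zero_mul]

lemma RepIsIrreducible.span_orbit_eq_top {n : ℕ} {ρ : Representation ℂ (SL n) V}
    (hirr : RepIsIrreducible ρ) {v : V} (hv : v ≠ 0) :
    Submodule.span ℂ (Set.range fun g => ρ g v) = ⊤ := by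
  have hinv : ∀ g, ∀ x ∈ Submodule.span ℂ (Set.range fun g => ρ g v),
      ρ g x ∈ Submodule.span ℂ (Set.range fun g => ρ g v) := by
    intro g x hx
    induction hx using Submodule.span_induction with
    | mem x hx =>
      obtain ⟨h, rfl⟩ := hx
      refine Submodule.subset_span ⟨g * h, ?_⟩
      change ρ (g * h) v = ρ g (ρ h v)
      rw [map_mul]
      rfl
    | zero => rw [map_zero]; exact zero_mem _
    | add x y _ _ h1 h2 => rw [map_add]; exact add_mem h1 h2
    | smul c x _ h => rw [map_smul]; exact Submodule.smul_mem _ _ h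
  rcases hirr.2 _ hinv with h | h
  · refine absurd ?_ hv
    have : ρ 1 v ∈ Submodule.span ℂ (Set.range fun g => ρ g v) := Submodule.subset_span ⟨1, rfl⟩
    rw [h, map_one] at this
    simpa using this
  · exact h

/-- Every irreducible finite-dimensional representation of the abstract group `SL (N + 1)` embeds
in the functions on the group, as the span of the right translates of a product of twisted
leading minors. -/
theorem RepIsIrreducible.exists_charProd_model [FiniteDimensional ℂ V]
    {ρ : Representation ℂ (SL (N + 1)) V} (hirr : RepIsIrreducible ρ) :
    ∃ (L : Fin (N + 1) → Multiset (ℂ →+* ℂ)) (Ψ : V →ₗ[ℂ] (SL (N + 1) → ℂ)),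
      Function.Injective Ψ ∧ (∀ h v g, Ψ (ρ h v) g = Ψ v (g * h)) ∧
      LinearMap.range Ψ = Submodule.span ℂ (Set.range fun h g => charProd L (g * h)) := by
  classical
  obtain ⟨v₀, hv₀⟩ := hirr.1
  have : Nontrivial V := ⟨v₀, 0, hv₀⟩
  obtain ⟨v, hv, hvT, hvU⟩ := ρ.exists_highest_weight_vector (Nat.succ_pos N)
  obtain ⟨η, hη0, hη⟩ := ρ.exists_lowest_covector (Nat.succ_pos N)
  have hspan := hirr.span_orbit_eq_top hv
  have hχ' : ∀ t, ∃ μ : ℂ, SLIsDiag t → ρ t v = μ • v := fun t => by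
    by_cases ht : SLIsDiag t
    · exact (hvT t ht).imp fun μ h _ => h
    · exact ⟨0, fun h => absurd h ht⟩
  choose χ hχ using hχ'
  have hcell : ∀ l ∈ lowerSub (N + 1), ∀ u ∈ upperSub (N + 1), ∀ t, SLIsDiag t →
      η (ρ (l * t * u) v) = χ t * η v := by
    intro l hl u hu t ht
    rw [map_mul, map_mul, Module.End.mul_apply, Module.End.mul_apply, hvU u hu, hη l hl, hχ t ht,
      map_smul, smul_eq_mul]
  have hηv : η v ≠ 0 := by
    intro h0
    have hz : ∀ g, η (ρ g v) = 0 := (ρ.tPoly η v).eq_zero_of_bigCell fun g hg => by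
      obtain ⟨l, hl, u, hu, t, ht, rfl, -⟩ := exists_gauss g hg
      rw [hcell l hl u hu t ht, h0, mul_zero]
    refine hη0 (LinearMap.ext_on_range hspan fun g => ?_)
    simpa using hz g
  have hχ1 : χ 1 = 1 := by
    have h := hχ 1 fun i j hij => Matrix.one_apply_ne hij
    rw [map_one] at h
    refine smul_left_injective ℂ hv (h.symm.trans ?_)
    simp
  have hχmul : ∀ s t, SLIsDiag s → SLIsDiag t → χ (s * t) = χ s * χ t := by
    intro s t hs ht
    have h := hχ _ (hs.mul ht)
    rw [map_mul, Module.End.mul_apply, hχ t ht, map_smul, hχ s hs, smul_smul] at h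
    rw [mul_comm (χ s)]
    exact (smul_left_injective ℂ hv h).symm
  let X : (Fin N → ℂˣ) →* ℂ :=
    { toFun := fun c => χ (torusParam N c)
      map_one' := by rw [map_one, hχ1]
      map_mul' := fun c d => by
        rw [map_mul, hχmul _ _ (torusParam_isDiag c) (torusParam_isDiag d)] }
  choose L hL using fun j : Fin N =>
    ρ.character_diag2n hηv hvU hη hχ (Fin.castSucc_lt_succ (i := j))
  let L' : Fin (N + 1) → Multiset (ℂ →+* ℂ) := Fin.snoc (α := fun _ => Multiset (ℂ →+* ℂ)) L 0
  have hcellχ : ∀ g : SL (N + 1), (∀ j, leadingMinor j g.val ≠ 0) →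
      η (ρ g v) = η v * charProd L' g := by
    intro g hg
    obtain ⟨l, hl, u, hu, t, ht, hgt, hmin⟩ := exists_gauss g hg
    let c : Fin N → ℂˣ := fun j => Units.mk0 (leadingMinor j.castSucc g.val) (hg _)
    have htc : t = torusParam N c := eq_torusParam ht c fun j => hmin j.castSucc
    have h1 : χ t = ∏ j, χ (torusParam N (Pi.mulSingle j (c j))) := by
      rw [htc]
      change X c = ∏ j, X (Pi.mulSingle j (c j))
      rw [← map_prod, Finset.univ_prod_mulSingle]
    have h2 : charProd L' g = χ t := by
      rw [h1, charProd, Fin.prod_univ_castSucc]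
      simp only [L', Fin.snoc_castSucc, Fin.snoc_last, Multiset.map_zero, Multiset.prod_zero,
        mul_one]
      refine Finset.prod_congr rfl fun j _ => ?_
      rw [torusParam_mulSingle, hL j]
      rfl
    rw [h2]
    conv_lhs => rw [hgt]
    rw [hcell l hl u hu t ht, mul_comm]
  have hall : ∀ g, η (ρ g v) = η v * charProd L' g := by
    intro g
    have hT : TPoly fun g => η (ρ g v) + (-η v) * charProd L' g :=
      (ρ.tPoly η v).add ((TPoly.const _).mul (tPoly_charProd L'))
    have := hT.eq_zero_of_bigCell (fun g hg => by
      rw [hcellχ g hg]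
      ring) g
    linear_combination this
  let Ψ : V →ₗ[ℂ] (SL (N + 1) → ℂ) := LinearMap.pi fun g => (η v)⁻¹ • (η ∘ₗ ρ g)
  have hΨ : ∀ w g, Ψ w g = (η v)⁻¹ * η (ρ g w) := fun _ _ => rfl
  refine ⟨L', Ψ, ?_, ?_, ?_⟩
  · rw [← LinearMap.ker_eq_bot]
    refine (hirr.2 _ fun h x hx => ?_).resolve_right fun h => hη0 ?_
    · rw [LinearMap.mem_ker] at hx ⊢
      funext g
      have := congrFun hx (g * h)
      rw [hΨ, map_mul] at this
      rw [hΨ]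
      exact this
    · ext w
      have hw : w ∈ LinearMap.ker Ψ := h ▸ Submodule.mem_top
      have h1 := congrFun (LinearMap.mem_ker.1 hw) 1
      rw [hΨ, map_one] at h1
      exact (mul_eq_zero.1 h1).resolve_left (inv_ne_zero hηv)
  · intro h w g
    rw [hΨ, hΨ, map_mul]
    rfl
  · rw [LinearMap.range_eq_map, ← hspan, Submodule.map_span, ← Set.range_comp]
    congr 2
    funext h g
    change Ψ (ρ h v) g = _
    rw [hΨ, ← Module.End.mul_apply, ← map_mul, hall, inv_mul_cancel_left₀ hηv]

end Structure

section RingHomIndependence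
variable {K : Type}

lemma exists_ringHom_separating [Fintype K] {τ : K → ℂ →+* ℂ} (hτ : Function.Injective τ) :
    ∃ c : ℂ, Function.Injective fun κ => τ κ c := by
  classical
  let D : K × K → Subspace ℚ ℂ := fun p =>
    LinearMap.ker ((τ p.1).toAddMonoidHom.toRatLinearMap - (τ p.2).toAddMonoidHom.toRatLinearMap)
  have hD : ∀ p c, c ∈ D p ↔ τ p.1 c = τ p.2 c := fun p c => by
    rw [LinearMap.mem_ker, LinearMap.sub_apply, sub_eq_zero]
    rfl
  have hne := Subspace.biUnion_ne_univ_of_top_notMem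
    (s := (Finset.univ.filter fun p : K × K => p.1 ≠ p.2).image D) (by
      intro h
      obtain ⟨p, hp, h⟩ := Finset.mem_image.1 h
      refine (Finset.mem_filter.1 hp).2 (hτ (RingHom.ext fun c => ?_))
      rw [← hD p c, h]
      exact Submodule.mem_top)
  obtain ⟨c, hc⟩ := (Set.ne_univ_iff_exists_notMem _).1 hne
  refine ⟨c, fun κ κ' h => ?_⟩
  by_contra hκ
  refine hc (Set.mem_biUnion (x := D (κ, κ')) ?_ ((hD (κ, κ') c).2 h))
  exact Finset.mem_image_of_mem _ (Finset.mem_filter.2 ⟨Finset.mem_univ _, hκ⟩)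

/-- Distinct ring endomorphisms of `ℂ` are algebraically independent. -/
theorem MvPolynomial.eq_zero_of_eval_ringHom [Fintype K] {τ : K → ℂ →+* ℂ} (hτ :
    Function.Injective τ)
    {P : MvPolynomial K ℂ} (h : ∀ x : ℂ, MvPolynomial.eval (fun κ => τ κ x) P = 0) : P = 0 := by
  obtain ⟨c, hc⟩ := exists_ringHom_separating hτ
  let e := Fintype.equivFin K
  let y : (Fin (Fintype.card K) → ℂ) → K → ℂ := fun m κ => ∑ l, m l * τ κ c ^ (l : ℕ)
  let P' : MvPolynomial (Fin (Fintype.card K)) ℂ := MvPolynomial.bind₁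
    (fun κ => ∑ l : Fin (Fintype.card K), MvPolynomial.X l * MvPolynomial.C (τ κ c ^ (l : ℕ))) P
  have hP' : ∀ m, MvPolynomial.eval m P' = MvPolynomial.eval (y m) P := by
    intro m
    change MvPolynomial.eval₂Hom (RingHom.id ℂ) m (MvPolynomial.bind₁ _ P) = _
    rw [MvPolynomial.eval₂Hom_bind₁]
    change MvPolynomial.eval (fun κ => MvPolynomial.eval m
      (∑ l : Fin (Fintype.card K), MvPolynomial.X l * MvPolynomial.C (τ κ c ^ (l : ℕ)))) P = _
    congr 2
    funext κ
    simp [y]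
  have hz : P' = 0 := by
    refine MvPolynomial.funext_set (fun _ => Set.range fun k : ℕ => (k : ℂ))
      (fun _ => Set.infinite_range_of_injective Nat.cast_injective) fun m hm => ?_
    choose k hk using fun l => hm l (Set.mem_univ _)
    rw [hP', map_zero, ← h (∑ l, (k l : ℂ) * c ^ (l : ℕ))]
    congr 2
    funext κ
    simp only [y, map_sum, map_mul, map_pow, map_natCast, ← hk]
  have hV : IsUnit (Matrix.vandermonde fun l => τ (e.symm l) c) := by
    rw [Matrix.isUnit_iff_isUnit_det, isUnit_iff_ne_zero, Matrix.det_vandermonde_ne_zero_iff]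
    exact hc.comp e.symm.injective
  refine MvPolynomial.funext fun x => ?_
  obtain ⟨m, hm⟩ := (Matrix.mulVec_surjective_iff_isUnit.2 hV) (fun l => x (e.symm l))
  have hy : y m = x := by
    funext κ
    have := congrFun hm (e κ)
    rw [Equiv.symm_apply_apply] at this
    rw [← this]
    simp only [y, Matrix.mulVec, dotProduct, Matrix.vandermonde_apply, Equiv.symm_apply_apply]
    exact Finset.sum_congr rfl fun l _ => mul_comm _ _
  rw [← hy, ← hP', hz, map_zero, map_zero]

/-- The polynomial functions of a tuple of complex numbers with values in an algebra. -/
noncomputable def mvFun (K A : Type*) [CommRing A] [Algebra ℂ A] : Subalgebra A ((K → ℂ) → A) :=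
  Algebra.adjoin A (Set.range fun κ x => algebraMap ℂ A (x κ))

section mvFun
variable {A : Type*} [CommRing A] [Algebra ℂ A]

lemma mvFun_coord (κ : K) : (fun x => algebraMap ℂ A (x κ)) ∈ mvFun K A :=
  Algebra.subset_adjoin ⟨κ, rfl⟩

lemma const_mem_mvFun (a : A) : (fun _ => a) ∈ mvFun K A :=
  (mvFun K A).algebraMap_mem a

lemma exists_mvPolynomial_of_mem_mvFun {Q : (K → ℂ) → A} (hQ : Q ∈ mvFun K A) :
    ∃ P : MvPolynomial K A, ∀ x, Q x = MvPolynomial.eval (fun κ => algebraMap ℂ A (x κ)) P := by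
  rw [mvFun, Algebra.adjoin_range_eq_range_aeval] at hQ
  obtain ⟨P, rfl⟩ := hQ
  refine ⟨P, fun x => ?_⟩
  induction P using MvPolynomial.induction_on with
  | C a => simp
  | add p q hp hq => simpa using congrArg₂ (· + ·) hp hq
  | mul_X p κ hp => simpa using congrArg (· * algebraMap ℂ A (x κ)) hp

/-- A polynomial function all of whose values at conjugates lie in a subspace stays there. -/
theorem mem_of_mem_mvFun [Fintype K] {τ : K → ℂ →+* ℂ} (hτ : Function.Injective τ) (o : K)
    (S : Submodule ℂ A) {Q : (K → ℂ) → A}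
    (hQ : Q ∈ mvFun K A) (h : ∀ x : ℂ, x ≠ 0 → Q (fun κ => τ κ x) ∈ S) (x : K → ℂ) :
    Q x ∈ S := by
  by_contra hmem
  obtain ⟨ℓ, hℓ, hS⟩ := Submodule.exists_le_ker_of_notMem hmem
  obtain ⟨P, hP⟩ := exists_mvPolynomial_of_mem_mvFun hQ
  let P' : MvPolynomial K ℂ := ∑ d ∈ P.support, MvPolynomial.monomial d (ℓ (P.coeff d))
  have hP' : ∀ x, ℓ (Q x) = MvPolynomial.eval x P' := by
    intro x
    rw [hP, MvPolynomial.eval_eq', map_sum, map_sum]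
    refine Finset.sum_congr rfl fun d _ => ?_
    rw [MvPolynomial.eval_monomial, Finsupp.prod_fintype _ _ fun _ => pow_zero _, mul_comm,
      mul_comm (ℓ _), ← smul_eq_mul (_ : ℂ) (ℓ _), ← map_smul, Algebra.smul_def, map_prod]
    simp only [map_pow]
  have hz : P' * MvPolynomial.X o = 0 := MvPolynomial.eq_zero_of_eval_ringHom hτ fun y => by
    rw [map_mul, MvPolynomial.eval_X]
    by_cases hy : y = 0
    · rw [hy, map_zero, mul_zero]
    · rw [← hP', LinearMap.mem_ker.1 (hS (h y hy)), zero_mul]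
  rw [hP', (mul_eq_zero.1 hz).resolve_right (MvPolynomial.X_ne_zero o), map_zero] at hℓ
  exact hℓ rfl

end mvFun

end RingHomIndependence

section MultiMinor
set_option linter.unusedSectionVars false
open Matrix.SpecialLinearGroup
variable {K I : Type} [Fintype K] [DecidableEq K] [Fintype I] [DecidableEq I] {n : ℕ}

/-- The product of powers of leading minors of a doubly indexed family of matrices. -/
noncomputable def multiMinor (a : K → I → Fin n → ℕ) (Y : K → I → Matrix (Fin n) (Fin n) ℂ) : ℂ :=
  ∏ κ, ∏ i, ∏ j, leadingMinor j (Y κ i) ^ a κ i j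

/-- `multiMinor` on families of elements of `SL n`. -/
noncomputable def multiMinorSL (a : K → I → Fin n → ℕ) (z : K → I → SL n) : ℂ :=
  multiMinor a fun κ i => (z κ i).val

lemma multiMinorSL_eq (a : K → I → Fin n → ℕ) (z : K → I → SL n) :
    multiMinorSL a z = ∏ κ, minorProd (a κ) (z κ) := rfl

lemma mvFun_lift {α : Type*} {Q : (K → ℂ) → ℂ} (hQ : Q ∈ mvFun K ℂ) :
    (fun x (_ : α) => Q x) ∈ mvFun K (α → ℂ) := by
  induction hQ using Algebra.adjoin_induction with
  | mem Q hQ =>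
    obtain ⟨κ, rfl⟩ := hQ
    exact mvFun_coord κ
  | algebraMap c => exact const_mem_mvFun fun _ => c
  | add P Q _ _ hP hQ => exact add_mem hP hQ
  | mul P Q _ _ hP hQ => exact mul_mem hP hQ

lemma mvFun_det {α ι : Type*} [Fintype ι] [DecidableEq ι] {M : (K → ℂ) → α → Matrix ι ι ℂ}
    (hM : ∀ p q, (fun x b => M x b p q) ∈ mvFun K (α → ℂ)) :
    (fun x b => (M x b).det) ∈ mvFun K (α → ℂ) := by
  have h : (fun x b => (M x b).det) = ∑ σ : Equiv.Perm ι,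
      (fun _ _ => ((Equiv.Perm.sign σ : ℤ) : ℂ)) * ∏ i, fun x b => M x b (σ i) i := by
    funext x b
    simp [Matrix.det_apply', Finset.sum_apply, Finset.prod_apply]
  rw [h]
  exact sum_mem fun σ _ => mul_mem (const_mem_mvFun _) (prod_mem fun i _ => hM _ _)

lemma mvFun_multiMinor {α : Type*} (a : K → I → Fin n → ℕ)
    (B C : α → K → I → Matrix (Fin n) (Fin n) ℂ) {E : (K → ℂ) → K → I → Matrix (Fin n) (Fin n) ℂ}
    (hE : ∀ κ i p q, (fun x => E x κ i p q) ∈ mvFun K ℂ) :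
    (fun x b => multiMinor a fun κ i => B b κ i * E x κ i * C b κ i) ∈ mvFun K (α → ℂ) := by
  have h : (fun x b => multiMinor a fun κ i => B b κ i * E x κ i * C b κ i) =
      ∏ κ, ∏ i, ∏ j, (fun x b => leadingMinor j (B b κ i * E x κ i * C b κ i)) ^ a κ i j := by
    funext x b
    simp [multiMinor, Finset.prod_apply]
  rw [h]
  refine prod_mem fun κ _ => prod_mem fun i _ => prod_mem fun j _ => pow_mem (mvFun_det ?_) _
  intro p q
  have h : (fun x b => (Matrix.submatrix (B b κ i * E x κ i * C b κ i)
      (Fin.castLE (Nat.succ_le_of_lt j.2)) (Fin.castLE (Nat.succ_le_of_lt j.2))) p q) =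
      ∑ t, ∑ s, ((fun _ b => B b κ i (Fin.castLE (Nat.succ_le_of_lt j.2) p) s) *
        (fun x (_ : α) => E x κ i s t)) *
        fun _ b => C b κ i t (Fin.castLE (Nat.succ_le_of_lt j.2) q) := by
    funext x b
    simp only [Matrix.submatrix_apply, Matrix.mul_apply, Finset.sum_apply, Pi.mul_apply,
      Finset.sum_mul]
  rw [h]
  exact sum_mem fun t _ => sum_mem fun s _ => mul_mem (mul_mem (const_mem_mvFun _)
    (mvFun_lift (hE _ _ _ _))) (const_mem_mvFun _)

/-- The family which is a transvection with varying parameters in the slots `(κ, i₀)`. -/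
noncomputable def elemFamily (i₀ : I) {i j : Fin n} (hij : i ≠ j) (x : K → ℂ) : K → I → SL n :=
  fun κ => Pi.mulSingle i₀ (transvection hij (x κ))

lemma elemFamily_entry (i₀ : I) {i j : Fin n} (hij : i ≠ j) (κ : K) (i' : I) (p q : Fin n) :
    (fun x : K → ℂ => (elemFamily i₀ hij x κ i').val p q) ∈ mvFun K ℂ := by
  by_cases h : i' = i₀
  · subst h
    have : (fun x : K → ℂ => (elemFamily i' hij x κ i').val p q) = (fun x : K → ℂ =>
        (1 : Matrix (Fin n) (Fin n) ℂ) p q) + fun x => (if i = p ∧ j = q then x κ else 0) := by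
      funext x
      rw [elemFamily, Pi.mulSingle_eq_same, transvection_coe, Matrix.add_apply, Pi.add_apply,
        Matrix.single_apply]
    rw [this]
    refine add_mem (const_mem_mvFun _) ?_
    split_ifs
    · exact mvFun_coord κ
    · exact const_mem_mvFun 0
  · have : (fun x : K → ℂ => (elemFamily i₀ hij x κ i').val p q) = (fun x : K → ℂ =>
        (1 : Matrix (Fin n) (Fin n) ℂ) p q) := by
      funext x
      rw [elemFamily, Pi.mulSingle_eq_of_ne h]
      rfl
    rw [this]
    exact const_mem_mvFun _

/-- Functions on `K → I → SL n` which are polynomial along translates of `elemFamily`. -/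
def KPoly {A : Type*} [CommRing A] [Algebra ℂ A] (y : (K → I → SL n) → A) : Prop :=
  ∀ (z z' : K → I → SL n) (i₀ : I) (i j : Fin n) (hij : i ≠ j),
    (fun x : K → ℂ => y (z * elemFamily i₀ hij x * z')) ∈ mvFun K A

lemma kPoly_multiMinor {α : Type*} (a : K → I → Fin n → ℕ) (B C : α → K → I → SL n) :
    KPoly fun z b => multiMinorSL a (B b * z * C b) := by
  intro z z' i₀ i j hij
  have := mvFun_multiMinor a (fun b κ i => (B b κ i * z κ i).val)
    (fun b κ i => (z' κ i * C b κ i).val) (elemFamily_entry i₀ hij)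
  convert this using 3 with x b
  change multiMinor a _ = _
  refine congrArg (multiMinor a) ?_
  funext κ i
  simp only [Pi.mul_apply, Matrix.SpecialLinearGroup.coe_mul, mul_assoc]

lemma KPoly.sub {A : Type*} [CommRing A] [Algebra ℂ A] {y y' : (K → I → SL n) → A} (hy : KPoly y)
    (hy' : KPoly y') : KPoly fun z => y z - y' z :=
  fun z z' i₀ i j hij => sub_mem (hy z z' i₀ i j hij) (hy' z z' i₀ i j hij)

lemma KPoly.smul {A : Type*} [CommRing A] [Algebra ℂ A] {y : (K → I → SL n) → A} (hy : KPoly y)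
    (c : ℂ) : KPoly fun z => c • y z := by
  intro z z' i₀ i j hij
  simp only [Algebra.smul_def]
  exact mul_mem (const_mem_mvFun _) (hy z z' i₀ i j hij)

/-- The tuple of conjugates of a tuple of matrices. -/
noncomputable def conjHom (τ : K → ℂ →+* ℂ) : (I → SL n) →* (K → I → SL n) where
  toFun g κ i := Matrix.SpecialLinearGroup.map (τ κ) (g i)
  map_one' := by
    funext κ i
    exact map_one _
  map_mul' g h := by
    funext κ i
    exact map_mul _ _ _

lemma conjHom_mulSingle_transvection (τ : K → ℂ →+* ℂ) (i₀ : I) {i j : Fin n} (hij : i ≠ j)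
    (x : ℂ) : conjHom τ (Pi.mulSingle i₀ (transvection hij x)) =
      elemFamily i₀ hij fun κ => τ κ x := by
  funext κ i'
  change Matrix.SpecialLinearGroup.map (τ κ) _ =
    (Pi.mulSingle i₀ (transvection hij (τ κ x)) : I → SL n) i'
  by_cases h : i' = i₀
  · subst h
    rw [Pi.mulSingle_eq_same, Pi.mulSingle_eq_same]
    apply Subtype.ext
    rw [Matrix.SpecialLinearGroup.map_apply_coe, transvection_coe, transvection_coe, map_add,
      map_one]
    congr 1
    exact Matrix.map_single _ _ _ _
  · rw [Pi.mulSingle_eq_of_ne h, Pi.mulSingle_eq_of_ne h, map_one]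

lemma mem_of_mulSingle_transvection_mem {H : Submonoid (K → I → SL n)}
    (h : ∀ (κ : K) (i₀ : I) (i j : Fin n) (hij : i ≠ j) (x : ℂ),
      (Pi.mulSingle κ (Pi.mulSingle i₀ (transvection hij x) : I → SL n) : K → I → SL n) ∈ H)
    (z : K → I → SL n) : z ∈ H := by
  refine Submonoid.pi_mem_of_mulSingle_mem z fun κ => ?_
  have h1 : z κ ∈ H.comap (MonoidHom.mulSingle (fun _ : K => I → SL n) κ) := by
    refine Submonoid.pi_mem_of_mulSingle_mem (z κ) fun i₀ => ?_
    have h2 : z κ i₀ ∈ (H.comap (MonoidHom.mulSingle (fun _ : K => I → SL n) κ)).comap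
        (MonoidHom.mulSingle (fun _ : I => SL n) i₀) := by
      refine transvection_induction (P := fun g => g ∈
        (H.comap (MonoidHom.mulSingle (fun _ : K => I → SL n) κ)).comap
          (MonoidHom.mulSingle (fun _ : I => SL n) i₀)) (one_mem _) ?_ (z κ i₀)
      intro g i j hij x hg
      exact mul_mem hg (h κ i₀ i j hij x)
    exact h2
  exact h1

/-- The conjugates of elements of `SL n` are dense for the `KPoly` functions. -/
theorem KPoly.mem_of_conjHom {A : Type*} [CommRing A] [Algebra ℂ A] {τ : K → ℂ →+* ℂ}
    (hτ : Function.Injective τ) (o : K) {y : (K → I → SL n) → A} (hy : KPoly y)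
    (S : Submodule ℂ A) (h : ∀ g, y (conjHom τ g) ∈ S) (z : K → I → SL n) : y z ∈ S := by
  let H : Submonoid (K → I → SL n) :=
    { carrier := {w | ∀ w', (∀ g, y (conjHom τ g * w') ∈ S) → ∀ g, y (conjHom τ g * (w * w')) ∈ S}
      one_mem' := fun w' hw' g => by rw [one_mul]; exact hw' g
      mul_mem' := fun {u v} hu hv w' hw' g => by
        rw [mul_assoc]
        exact hu _ (hv _ hw') g }
  have helem : ∀ (i₀ : I) {i j : Fin n} (hij : i ≠ j) (x : K → ℂ), elemFamily i₀ hij x ∈ H := by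
    intro i₀ i j hij x w' hw' g
    rw [← mul_assoc]
    refine mem_of_mem_mvFun hτ o S (hy (conjHom τ g) w' i₀ i j hij) (fun t _ => ?_) x
    rw [← conjHom_mulSingle_transvection, ← map_mul]
    exact hw' _
  have hall : z ∈ H := mem_of_mulSingle_transvection_mem (fun κ i₀ i j hij x => by
    convert helem i₀ hij (Pi.single κ x) using 1
    funext κ'
    by_cases hκ : κ' = κ
    · subst hκ
      rw [Pi.mulSingle_eq_same, elemFamily, Pi.single_eq_same]
    · rw [Pi.mulSingle_eq_of_ne hκ, elemFamily, Pi.single_eq_of_ne hκ, transvection_coeff_zero,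
        Pi.mulSingle_one]) z
  have := hall 1 (fun g => by rw [mul_one]; exact h g) 1
  rwa [map_one, one_mul, mul_one] at this

end MultiMinor

section ConjExt
set_option linter.unusedSectionVars false
open Matrix.SpecialLinearGroup
variable {K I : Type} [Fintype K] [DecidableEq K] [Fintype I] [DecidableEq I] {n : ℕ}

/-- The span of the right translates of `multiMinorSL a` composed with `conjHom τ`. -/
noncomputable def conjSpan (a : K → I → Fin n → ℕ) (τ : K → ℂ →+* ℂ) :
    Submodule ℂ ((I → SL n) → ℂ) :=
  Submodule.span ℂ (Set.range fun h g => multiMinorSL a (conjHom τ (g * h)))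

/-- The extension to `K → I → SL n` of an element of `conjSpan`. -/
noncomputable def conjExt (a : K → I → Fin n → ℕ) (τ : K → ℂ →+* ℂ) (c : (I → SL n) →₀ ℂ)
    (z : K → I → SL n) : ℂ :=
  ∑ h ∈ c.support, c h * multiMinorSL a (z * conjHom τ h)

/-- The linear form given by a finitely supported weight. -/
noncomputable def evalComb {α : Type*} (c : α →₀ ℂ) : (α → ℂ) →ₗ[ℂ] ℂ :=
  ∑ h ∈ c.support, c h • LinearMap.proj h

lemma evalComb_apply {α : Type*} (c : α →₀ ℂ) (f : α → ℂ) :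
    evalComb c f = ∑ h ∈ c.support, c h * f h := by
  simp [evalComb]

variable {a : K → I → Fin n → ℕ} {τ : K → ℂ →+* ℂ}

lemma conjExt_eq_evalComb (c : (I → SL n) →₀ ℂ) (z : K → I → SL n) :
    conjExt a τ c z = evalComb c fun h => multiMinorSL a (z * conjHom τ h) :=
  (evalComb_apply _ _).symm

lemma exists_conjExt_eq {Φ : (I → SL n) → ℂ} (hΦ : Φ ∈ conjSpan a τ) :
    ∃ c : (I → SL n) →₀ ℂ, ∀ g, conjExt a τ c (conjHom τ g) = Φ g := by
  obtain ⟨c, hc⟩ := (Finsupp.mem_span_range_iff_exists_finsupp).1 hΦ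
  refine ⟨c, fun g => ?_⟩
  rw [← hc, Finsupp.sum, Finset.sum_apply, conjExt]
  refine Finset.sum_congr rfl fun h _ => ?_
  change _ = c h * multiMinorSL a (conjHom τ (g * h))
  rw [map_mul]

lemma multiMinorSL_translate_mem (hτ : Function.Injective τ) (o : K) (ζ : K → I → SL n) :
    (fun g => multiMinorSL a (conjHom τ g * ζ)) ∈ conjSpan a τ := by
  have hy := kPoly_multiMinor a (fun g : I → SL n => conjHom τ g) (fun _ => 1)
  simp only [mul_one] at hy
  refine hy.mem_of_conjHom hτ o (conjSpan a τ) (fun h => ?_) ζ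
  refine Submodule.subset_span ⟨h, ?_⟩
  funext g
  change multiMinorSL a (conjHom τ (g * h)) = _
  rw [map_mul]

lemma conjExt_mul_eq_of_conjHom (hτ : Function.Injective τ) (o : K) {c : (I → SL n) →₀ ℂ}
    {b : K → I → SL n} {k : ℂ}
    (h : ∀ g, conjExt a τ c (conjHom τ g * b) = k * conjExt a τ c (conjHom τ g))
    (z : K → I → SL n) : conjExt a τ c (z * b) = k * conjExt a τ c z := by
  have hy := (kPoly_multiMinor a (fun _ : I → SL n => 1) fun h => b * conjHom τ h).sub
    ((kPoly_multiMinor a (fun _ : I → SL n => 1) fun h => conjHom τ h).smul k)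
  simp only [one_mul, ← mul_assoc] at hy
  have h1 := hy.mem_of_conjHom hτ o (LinearMap.ker (evalComb c)) (fun g => ?_) z
  · rw [LinearMap.mem_ker, map_sub, map_smul, ← conjExt_eq_evalComb, ← conjExt_eq_evalComb,
      sub_eq_zero] at h1
    exact h1
  · rw [LinearMap.mem_ker, map_sub, map_smul, ← conjExt_eq_evalComb, ← conjExt_eq_evalComb,
      h g, smul_eq_mul, sub_self]

/-- The families which are constant in the second index. -/
def constFamily (I : Type) (n : ℕ) : (K → SL n) →* (K → I → SL n) where
  toFun b κ _ := b κ
  map_one' := rfl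
  map_mul' _ _ := rfl

lemma conjHom_const (g : SL n) : conjHom τ (fun _ : I => g) =
    constFamily I n fun κ => Matrix.SpecialLinearGroup.map (τ κ) g := rfl

lemma map_transvection_SL (σ : ℂ →+* ℂ) {i j : Fin n} (hij : i ≠ j) (x : ℂ) :
    Matrix.SpecialLinearGroup.map σ (transvection hij x) = transvection hij (σ x) := by
  apply Subtype.ext
  rw [Matrix.SpecialLinearGroup.map_apply_coe, transvection_coe, transvection_coe, map_add,
    map_one]
  congr 1
  exact Matrix.map_single _ _ _ _

lemma uniUpper_transvection {i j : Fin n} (hij : i < j) (x : ℂ) :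
    SLIsUniUpper (transvection hij.ne x : SL n) := by
  refine ⟨fun p => ?_, fun p q hpq => ?_⟩
  · rw [transvection_coe, Matrix.add_apply, Matrix.one_apply_eq, Matrix.single_apply_of_ne,
        add_zero]
    rintro ⟨rfl, rfl⟩
    exact hij.ne rfl
  · rw [transvection_coe, Matrix.add_apply, Matrix.one_apply_ne hpq.ne', Matrix.single_apply_of_ne,
      add_zero]
    rintro ⟨rfl, rfl⟩
    exact hij.not_gt hpq

lemma constFamily_transvection_entry {i j : Fin n} (hij : i ≠ j) (κ : K) (i' : I) (p q : Fin n) :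
    (fun x : K → ℂ => (constFamily I n (fun κ => transvection hij (x κ)) κ i').val p q) ∈
      mvFun K ℂ := by
  have := elemFamily_entry i' hij κ i' p q
  simp only [elemFamily, Pi.mulSingle_eq_same] at this
  exact this

lemma conjExt_mul_upper (hτ : Function.Injective τ) (o : K) {c : (I → SL n) →₀ ℂ}
    {ν : Fin n → ℤ} (hΦ : IsRightHW ν fun g => conjExt a τ c (conjHom τ g)) {b : K → SL n}
    (hb : ∀ κ, b κ ∈ upperSub n) (z : K → I → SL n) :
    conjExt a τ c (z * constFamily I n b) = conjExt a τ c z := by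
  have hel : ∀ {i j : Fin n} (hij : i < j) (x : K → ℂ) (z : K → I → SL n),
      conjExt a τ c (z * constFamily I n fun κ => transvection hij.ne (x κ)) = conjExt a τ c z := by
    intro i j hij x
    have := conjExt_mul_eq_of_conjHom hτ o (a := a) (c := c) (k := 1)
      (b := constFamily I n fun κ => transvection hij.ne (x κ)) fun g => ?_
    · simpa only [one_mul] using this
    have h1 := mvFun_multiMinor a (fun (_ : I → SL n) κ i => (conjHom τ g κ i).val)
      (fun h κ i => (conjHom τ h κ i).val) (constFamily_transvection_entry (I := I) hij.ne)
    have h2 := mem_of_mem_mvFun hτ o (LinearMap.ker (evalComb c)) (sub_mem h1 (const_mem_mvFun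
      fun h => multiMinorSL a (conjHom τ g * conjHom τ h))) (fun y _ => ?_) x
    · have h3 := LinearMap.mem_ker.1 h2
      rw [Pi.sub_apply, map_sub, sub_eq_zero] at h3
      rw [one_mul, conjExt_eq_evalComb, conjExt_eq_evalComb]
      exact h3
    · have h3 := hΦ.1 g _ (uniUpper_transvection hij y)
      rw [LinearMap.mem_ker, Pi.sub_apply, map_sub, sub_eq_zero]
      refine Eq.trans ?_ (h3.trans ?_)
      · refine Eq.trans ?_ (conjExt_eq_evalComb _ _).symm
        refine congrArg _ (funext fun h => ?_)
        refine congrArg (multiMinor a) (funext fun κ => funext fun i => ?_)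
        change _ = (conjHom τ (g * fun _ => transvection hij.ne y) κ i * conjHom τ h κ i).val
        rw [map_mul, conjHom_const]
        simp only [map_transvection_SL]
        rfl
      · exact conjExt_eq_evalComb _ _
  let H : Subgroup (K → SL n) :=
    { carrier := {b | ∀ z, conjExt a τ c (z * constFamily I n b) = conjExt a τ c z}
      one_mem' := fun z => by rw [map_one, mul_one]
      mul_mem' := fun {u v} hu hv z => by rw [map_mul, ← mul_assoc, hv, hu]
      inv_mem' := fun {u} hu z => by rw [← hu, mul_assoc, ← map_mul, inv_mul_cancel, map_one,
          mul_one] }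
  have hbH : b ∈ H := by
    refine Subgroup.pi_mem_of_mulSingle_mem b fun κ => ?_
    have hle : upperSub n ≤ H.comap (MonoidHom.mulSingle (fun _ : K => SL n) κ) := by
      rw [upperSub, Subgroup.closure_le]
      rintro _ ⟨i, j, hij, x, hlt, rfl⟩
      intro z
      convert hel hlt (Pi.single κ x) z using 4
      funext κ'
      rw [MonoidHom.mulSingle_apply]
      by_cases hκ : κ' = κ
      · subst hκ
        rw [Pi.mulSingle_eq_same, Pi.single_eq_same]
      · rw [Pi.mulSingle_eq_of_ne hκ, Pi.single_eq_of_ne hκ, transvection_coeff_zero]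
    exact hle (hb κ)
  exact hbH z

end ConjExt

section ConjExtTorus
set_option linter.unusedSectionVars false
open Matrix.SpecialLinearGroup
variable {K I : Type} [Fintype K] [DecidableEq K] [Fintype I] [DecidableEq I]

lemma SLIsDiag.mul_apply {n : ℕ} {s t : SL n} (hs : SLIsDiag s) (p : Fin n) :
    (s * t).val p p = s.val p p * t.val p p := by
  rw [Matrix.SpecialLinearGroup.coe_mul, Matrix.mul_apply, Finset.sum_eq_single p]
  · intro q _ hq
    rw [hs _ _ hq.symm, zero_mul]
  · simp

lemma prod_diag2n_zpow {n : ℕ} {i j : Fin n} (hij : i < j) {y : ℂ} (hy : y ≠ 0) (ν : Fin n → ℤ) :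
    ∏ p, (diag2n hij.ne y hy).val p p ^ ν p = y ^ (ν i - ν j) := by
  rw [Finset.prod_eq_mul i j hij.ne, diag2n_fst, diag2n_snd, zpow_sub₀ hy, inv_zpow, div_eq_mul_inv]
  · intro p _ hp
    rw [diag2n_of_ne _ _ _ hp.1 hp.2, one_zpow]
  · simp
  · simp

lemma multiMinor_smul {n : ℕ} (a : K → I → Fin n → ℕ) (x : K → ℂ)
    (Y : K → I → Matrix (Fin n) (Fin n) ℂ) : multiMinor a (fun κ i => x κ • Y κ i) =
      (∏ κ, x κ ^ ∑ i, ∑ j : Fin n, (j.val + 1) * a κ i j) * multiMinor a Y := by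
  unfold multiMinor
  rw [← Finset.prod_mul_distrib]
  refine Finset.prod_congr rfl fun κ _ => ?_
  rw [← Finset.prod_pow_eq_pow_sum, ← Finset.prod_mul_distrib]
  refine Finset.prod_congr rfl fun i _ => ?_
  rw [← Finset.prod_pow_eq_pow_sum, ← Finset.prod_mul_distrib]
  refine Finset.prod_congr rfl fun j _ => ?_
  rw [leadingMinor_smul, mul_pow, pow_mul]

/-- The diagonal matrix proportional to `diag2n` whose entries are polynomial in `x`. -/
noncomputable def scaledDiag {n : ℕ} (i j : Fin n) (x : ℂ) : Matrix (Fin n) (Fin n) ℂ :=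
  Matrix.diagonal fun p => if p = i then x * x else if p = j then 1 else x

lemma scaledDiag_eq {n : ℕ} {i j : Fin n} (hij : i ≠ j) {x : ℂ} (hx : x ≠ 0) :
    scaledDiag i j x = x • (diag2n hij x hx).val := by
  rw [diag2n_coe, ← Matrix.diagonal_smul, scaledDiag]
  congr 1
  funext p
  rw [Pi.smul_apply, smul_eq_mul]
  split_ifs <;> simp [hx]

lemma map_diag2n_SL {n : ℕ} (σ : ℂ →+* ℂ) {i j : Fin n} (hij : i ≠ j) {x : ℂ} (hx : x ≠ 0)
    (hσ : σ x ≠ 0) :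
    Matrix.SpecialLinearGroup.map σ (diag2n hij x hx) = diag2n hij (σ x) hσ := by
  apply Subtype.ext
  rw [Matrix.SpecialLinearGroup.map_apply_coe, diag2n_coe, diag2n_coe]
  change (Matrix.diagonal _).map σ = _
  rw [Matrix.diagonal_map (map_zero σ)]
  congr 1
  funext p
  change σ (if p = i then x else if p = j then x⁻¹ else 1) = _
  split_ifs <;> simp

lemma scaledDiag_entry {n : ℕ} (i j : Fin n) (κ : K) (p q : Fin n) :
    (fun x : K → ℂ => scaledDiag i j (x κ) p q) ∈ mvFun K ℂ := by
  unfold scaledDiag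
  simp only [Matrix.diagonal_apply]
  split_ifs
  · exact mul_mem (mvFun_coord κ) (mvFun_coord κ)
  · exact const_mem_mvFun 1
  · exact mvFun_coord κ
  · exact const_mem_mvFun 0

variable {n : ℕ} {a : K → I → Fin n → ℕ} {τ : K → ℂ →+* ℂ}

lemma conjExt_mul_diag2n (hτ : Function.Injective τ) {o : K} (ho : τ o = RingHom.id ℂ)
    {c : (I → SL n) →₀ ℂ} {ν : Fin n → ℤ} (hν : SLDominant ν)
    (hΦ : IsRightHW ν fun g => conjExt a τ c (conjHom τ g)) {i j : Fin n} (hij : i < j)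
    (x : K → ℂ) (hx : ∀ κ, x κ ≠ 0) (z : K → I → SL n) :
    conjExt a τ c (z * constFamily I n fun κ => diag2n hij.ne (x κ) (hx κ)) =
      x o ^ (ν i - ν j) * conjExt a τ c z := by
  refine conjExt_mul_eq_of_conjHom hτ o (fun g => ?_) z
  obtain ⟨e, he⟩ := Int.eq_ofNat_of_zero_le (sub_nonneg.2 (hν i j hij.le))
  rw [he, zpow_natCast]
  set d : K → ℕ := fun κ => ∑ i, ∑ j : Fin n, (j.val + 1) * a κ i j with hd
  have hscale : ∀ (x : K → ℂ) (hx : ∀ κ, x κ ≠ 0), (evalComb c fun h => multiMinor a fun κ i' =>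
      (conjHom τ g κ i').val * scaledDiag i j (x κ) * (conjHom τ h κ i').val) =
      (∏ κ, x κ ^ d κ) * conjExt a τ c (conjHom τ g * constFamily I n fun κ =>
        diag2n hij.ne (x κ) (hx κ)) := by
    intro x hx
    rw [conjExt_eq_evalComb, ← smul_eq_mul, ← map_smul]
    refine congrArg _ (funext fun h => ?_)
    rw [Pi.smul_apply, smul_eq_mul, multiMinorSL, hd, ← multiMinor_smul]
    refine congrArg (multiMinor a) (funext fun κ => funext fun i' => ?_)
    rw [scaledDiag_eq hij.ne (hx κ), Matrix.mul_smul, Matrix.smul_mul]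
    rfl
  have h1 := mvFun_multiMinor a (fun (_ : I → SL n) κ i => (conjHom τ g κ i).val)
    (fun h κ i => (conjHom τ h κ i).val) (E := fun x κ _ => scaledDiag i j (x κ))
    (fun κ i' p q => scaledDiag_entry i j κ p q)
  have hpoly : (fun x : K → ℂ => (∏ κ, x κ ^ d κ) * x o ^ e) ∈ mvFun K ℂ := by
    have : (fun x : K → ℂ => (∏ κ, x κ ^ d κ) * x o ^ e) =
        (∏ κ, (fun x : K → ℂ => x κ) ^ d κ) * (fun x : K → ℂ => x o) ^ e := by
      funext x
      simp [Finset.prod_apply]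
    rw [this]
    exact mul_mem (prod_mem fun κ _ => pow_mem (mvFun_coord κ) _) (pow_mem (mvFun_coord o) _)
  have hval : ∀ x : K → ℂ, (evalComb c ((fun _ : I → SL n => (∏ κ, x κ ^ d κ) * x o ^ e) *
      fun h => multiMinorSL a (conjHom τ g * conjHom τ h))) =
      (∏ κ, x κ ^ d κ) * (x o ^ e * conjExt a τ c (conjHom τ g)) := by
    intro x
    rw [conjExt_eq_evalComb, ← mul_assoc, ← smul_eq_mul (_ : ℂ) (evalComb c _), ← map_smul]
    rfl
  have h2 := mem_of_mem_mvFun hτ o (LinearMap.ker (evalComb c)) (sub_mem h1 (mul_mem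
    (mvFun_lift hpoly) (const_mem_mvFun fun h => multiMinorSL a (conjHom τ g * conjHom τ h))))
    (fun y hy => ?_) x
  · have h3 := LinearMap.mem_ker.1 h2
    rw [Pi.sub_apply, map_sub, sub_eq_zero] at h3
    have h4 := (hscale x hx).symm.trans (h3.trans (hval x))
    exact mul_left_cancel₀ (Finset.prod_ne_zero_iff.2 fun κ _ => pow_ne_zero _ (hx κ)) h4
  · have hτy : ∀ κ, τ κ y ≠ 0 := fun κ => (_root_.map_ne_zero _).2 hy
    rw [LinearMap.mem_ker, Pi.sub_apply, map_sub, sub_eq_zero]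
    refine (hscale _ hτy).trans (Eq.trans ?_ (hval _).symm)
    congr 1
    have h3 := hΦ.2 g _ (diag2n_isDiag hij.ne y hy)
    rw [prod_diag2n_zpow hij hy, he, zpow_natCast] at h3
    rw [ho, RingHom.id_apply]
    refine Eq.trans ?_ h3
    have h4 : (fun κ => diag2n hij.ne (τ κ y) (hτy κ)) =
        fun κ => Matrix.SpecialLinearGroup.map (τ κ) (diag2n hij.ne y hy) :=
      funext fun κ => (map_diag2n_SL _ _ _ _).symm
    rw [h4, ← conjHom_const (I := I), ← map_mul]
    rfl

lemma conjExt_mul_torusParam {N : ℕ} {a : K → I → Fin (N + 1) → ℕ} (hτ : Function.Injective τ)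
    {o : K} (ho : τ o = RingHom.id ℂ)
    {c : (I → SL (N + 1)) →₀ ℂ} {ν : Fin (N + 1) → ℤ} (hν : SLDominant ν)
    (hΦ : IsRightHW ν fun g => conjExt a τ c (conjHom τ g)) (s : K → Fin N → ℂˣ)
    (z : K → I → SL (N + 1)) :
    conjExt a τ c (z * constFamily I (N + 1) fun κ => torusParam N (s κ)) =
      (∏ p, (torusParam N (s o)).val p p ^ ν p) * conjExt a τ c z := by
  let H : Submonoid (K → Fin N → ℂˣ) :=
    { carrier := {s | ∀ z, conjExt a τ c (z * constFamily I (N + 1) fun κ => torusParam N (s κ)) =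
        (∏ p, (torusParam N (s o)).val p p ^ ν p) * conjExt a τ c z}
      one_mem' := fun z => by
        have h1 : (fun κ => torusParam N ((1 : K → Fin N → ℂˣ) κ)) = 1 := by
          funext κ
          exact map_one _
        rw [h1, map_one, mul_one, Pi.one_apply, map_one]
        simp
      mul_mem' := fun {u v} hu hv z => by
        have h1 : (fun κ => torusParam N ((u * v) κ)) =
            (fun κ => torusParam N (u κ)) * fun κ => torusParam N (v κ) := by
          funext κ
          exact map_mul _ _ _
        rw [h1, map_mul, ← mul_assoc, hv, hu, ← mul_assoc, ← Finset.prod_mul_distrib]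
        congr 1
        refine Finset.prod_congr rfl fun p _ => ?_
        rw [Pi.mul_apply, map_mul, (torusParam_isDiag _).mul_apply, mul_zpow, mul_comm] }
  have hel : ∀ (j : Fin N) (y : K → ℂˣ), (fun κ => Pi.mulSingle j (y κ)) ∈ H := by
    intro j y z
    simp only [torusParam_mulSingle]
    rw [prod_diag2n_zpow Fin.castSucc_lt_succ]
    exact conjExt_mul_diag2n hτ ho hν hΦ Fin.castSucc_lt_succ (fun κ => (y κ).1)
      (fun κ => (y κ).ne_zero) z
  have hs : s ∈ H := by
    refine Submonoid.pi_mem_of_mulSingle_mem s fun κ => ?_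
    have h1 : s κ ∈ H.comap (MonoidHom.mulSingle (fun _ : K => Fin N → ℂˣ) κ) := by
      refine Submonoid.pi_mem_of_mulSingle_mem (s κ) fun j => ?_
      rw [Submonoid.mem_comap]
      convert hel j (Pi.mulSingle κ (s κ j)) using 1
      funext κ'
      rw [MonoidHom.mulSingle_apply]
      by_cases hκ : κ' = κ
      · subst hκ
        rw [Pi.mulSingle_eq_same, Pi.mulSingle_eq_same]
      · rw [Pi.mulSingle_eq_of_ne hκ, Pi.mulSingle_eq_of_ne hκ, Pi.mulSingle_one]
    exact h1
  exact hs z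

end ConjExtTorus

section ConjInterpolate
set_option linter.unusedSectionVars false
open Matrix.SpecialLinearGroup
variable {K I : Type} [Fintype K] [DecidableEq K] [Fintype I] [DecidableEq I]

lemma SLIsDiag.exists_eq_torusParam {N : ℕ} {t : SL (N + 1)} (ht : SLIsDiag t) :
    ∃ c, t = torusParam N c :=
  ⟨_, eq_torusParam ht (fun j : Fin N => Units.mk0 (∏ i ∈ Finset.Iic j.castSucc, t.val i i)
    (Finset.prod_ne_zero_iff.2 fun i _ => ht.ne_zero i)) fun _ => rfl⟩

lemma multiMinorSL_eq_mul {n : ℕ} (a : K → I → Fin n → ℕ) (o : K) (z : K → I → SL n) :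
    multiMinorSL a z = minorProd (a o) (z o) * ∏ κ ∈ Finset.univ.erase o, minorProd (a κ) (z κ) :=
        by
  rw [multiMinorSL_eq]
  exact (Finset.mul_prod_erase _ (fun κ => minorProd (a κ) (z κ)) (Finset.mem_univ o)).symm

lemma conjExt_update_mem {n : ℕ} (a : K → I → Fin n → ℕ) (τ : K → ℂ →+* ℂ) (o : K)
    (c : (I → SL n) →₀ ℂ) (z : K → I → SL n) :
    (fun g => conjExt a τ c (Function.update z o g)) ∈ minorSpan (a o) := by
  have h1 : (fun g => conjExt a τ c (Function.update z o g)) = ∑ h ∈ c.support,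
      (c h * ∏ κ ∈ Finset.univ.erase o, minorProd (a κ) (z κ * conjHom τ h κ)) •
        fun g => minorProd (a o) (g * conjHom τ h o) := by
    funext g
    rw [Finset.sum_apply, conjExt]
    refine Finset.sum_congr rfl fun h _ => ?_
    rw [multiMinorSL_eq_mul a o, Pi.smul_apply, smul_eq_mul, Pi.mul_apply, Function.update_self,
      mul_comm (minorProd _ _), mul_assoc]
    congr 2
    refine Finset.prod_congr rfl fun κ hκ => ?_
    rw [Pi.mul_apply, Function.update_of_ne (Finset.ne_of_mem_erase hκ)]
  rw [h1]
  exact sum_mem fun h _ => Submodule.smul_mem _ _ (Submodule.subset_span ⟨_, rfl⟩)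

lemma update_mul_constFamily {n : ℕ} (z : K → I → SL n) (o : K) (g : I → SL n) (u : SL n) :
    Function.update z o g * constFamily I n (Pi.mulSingle o u) =
      Function.update z o fun i => g i * u := by
  funext κ i
  change Function.update z o g κ i * (Pi.mulSingle o u : K → SL n) κ = _
  by_cases hκ : κ = o
  · subst hκ
    rw [Function.update_self, Function.update_self, Pi.mulSingle_eq_same]
  · rw [Function.update_of_ne hκ, Function.update_of_ne hκ, Pi.mulSingle_eq_of_ne hκ, mul_one]

variable {N : ℕ} {a : K → I → Fin (N + 1) → ℕ} {τ : K → ℂ →+* ℂ}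

lemma conjExt_mul_diag (hτ : Function.Injective τ)
    {o : K} (ho : τ o = RingHom.id ℂ)
    {c : (I → SL (N + 1)) →₀ ℂ} {ν : Fin (N + 1) → ℤ} (hν : SLDominant ν)
    (hΦ : IsRightHW ν fun g => conjExt a τ c (conjHom τ g)) {t : K → SL (N + 1)}
    (ht : ∀ κ, SLIsDiag (t κ)) (z : K → I → SL (N + 1)) :
    conjExt a τ c (z * constFamily I (N + 1) t) =
      (∏ p, (t o).val p p ^ ν p) * conjExt a τ c z := by
  choose s hs using fun κ => (ht κ).exists_eq_torusParam
  rw [funext hs]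
  exact conjExt_mul_torusParam hτ ho hν hΦ s z

lemma isRightHW_conjExt_update (hτ : Function.Injective τ)
    {o : K} (ho : τ o = RingHom.id ℂ)
    {c : (I → SL (N + 1)) →₀ ℂ} {ν : Fin (N + 1) → ℤ} (hν : SLDominant ν)
    (hΦ : IsRightHW ν fun g => conjExt a τ c (conjHom τ g)) (z : K → I → SL (N + 1)) :
    IsRightHW ν fun g => conjExt a τ c (Function.update z o g) := by
  refine ⟨fun g u hu => ?_, fun g t ht => ?_⟩
  · change conjExt a τ c (Function.update z o fun i => g i * u) = _
    rw [← update_mul_constFamily]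
    refine conjExt_mul_upper hτ o hΦ (fun κ => ?_) _
    by_cases hκ : κ = o
    · subst hκ
      rw [Pi.mulSingle_eq_same]
      exact mem_upperSub_of_uniUpper hu
    · rw [Pi.mulSingle_eq_of_ne hκ]
      exact one_mem _
  · change conjExt a τ c (Function.update z o fun i => g i * t) = _
    have h1 : ∀ κ, SLIsDiag ((Pi.mulSingle o t : K → SL (N + 1)) κ) := by
      intro κ
      by_cases hκ : κ = o
      · subst hκ
        rw [Pi.mulSingle_eq_same]
        exact ht
      · rw [Pi.mulSingle_eq_of_ne hκ]
        exact fun i j hij => Matrix.one_apply_ne hij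
    rw [← update_mul_constFamily, conjExt_mul_diag hτ ho hν hΦ h1, Pi.mulSingle_eq_same]

lemma exists_hasHWFun_of_conjSpan (hτ : Function.Injective τ)
    {o : K} (ho : τ o = RingHom.id ℂ) {ν : Fin (N + 1) → ℤ} (hν : SLDominant ν)
    {Φ : (I → SL (N + 1)) → ℂ} (hΦ : Φ ∈ conjSpan a τ) (hΦ0 : Φ ≠ 0) (hΦν : IsRightHW ν Φ) :
    HasHWFun (a o) ν := by
  obtain ⟨c, hc⟩ := exists_conjExt_eq hΦ
  obtain ⟨g, hg⟩ := Function.ne_iff.1 hΦ0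
  refine ⟨_, conjExt_update_mem a τ o c (conjHom τ g), fun h => hg ?_,
    isRightHW_conjExt_update hτ ho hν (by rwa [funext hc]) _⟩
  rw [← hc, Pi.zero_apply]
  have := congrFun h (conjHom τ g o)
  rwa [Function.update_eq_self] at this

lemma map_uniUpper {n : ℕ} (σ : ℂ →+* ℂ) {u : SL n} (hu : SLIsUniUpper u) :
    SLIsUniUpper (Matrix.SpecialLinearGroup.map σ u) := by
  refine ⟨fun i => ?_, fun i j hij => ?_⟩
  · rw [Matrix.SpecialLinearGroup.map_apply_coe]
    change σ (u.val i i) = 1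
    rw [hu.1, map_one]
  · rw [Matrix.SpecialLinearGroup.map_apply_coe]
    change σ (u.val i j) = 0
    rw [hu.2 i j hij, map_zero]

lemma map_diag {n : ℕ} (σ : ℂ →+* ℂ) {u : SL n} (hu : SLIsDiag u) :
    SLIsDiag (Matrix.SpecialLinearGroup.map σ u) := by
  intro i j hij
  rw [Matrix.SpecialLinearGroup.map_apply_coe]
  change σ (u.val i j) = 0
  rw [hu i j hij, map_zero]

lemma conjHom_apply_id {n : ℕ} {τ : K → ℂ →+* ℂ} {o : K} (ho : τ o = RingHom.id ℂ)
    (g : I → SL n) : conjHom τ g o = g := by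
  funext i
  change Matrix.SpecialLinearGroup.map (τ o) (g i) = g i
  rw [ho]
  apply Subtype.ext
  ext p q
  rfl

lemma update_conjHom_mul_constFamily {n : ℕ} (τ : K → ℂ →+* ℂ) (o : K)
    (g : I → SL n) (w : I → SL n) (u : SL n) :
    Function.update (conjHom τ fun i => g i * u) o w = Function.update (conjHom τ g) o w *
      constFamily I n (Function.update (fun κ => Matrix.SpecialLinearGroup.map (τ κ) u) o 1) := by
  funext κ i
  change _ = Function.update (conjHom τ g) o w κ i *
    Function.update (fun κ => Matrix.SpecialLinearGroup.map (τ κ) u) o 1 κ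
  by_cases hκ : κ = o
  · subst hκ
    rw [Function.update_self, Function.update_self, Function.update_self, mul_one]
  · rw [Function.update_of_ne hκ, Function.update_of_ne hκ, Function.update_of_ne hκ]
    exact (Matrix.SpecialLinearGroup.map (τ κ)).map_mul _ _

/-- The span of the right translates of `multiMinorSL a`. -/
noncomputable def multiSpan {n : ℕ} (a : K → I → Fin n → ℕ) :
    Submodule ℂ ((K → I → SL n) → ℂ) :=
  Submodule.span ℂ (Set.range fun ζ z => multiMinorSL a (z * ζ))

lemma comp_conjHom_mem (hτ : Function.Injective τ) (o : K) {F : (K → I → SL (N + 1)) → ℂ}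
    (hF : F ∈ multiSpan a) : (fun g => F (conjHom τ g)) ∈ conjSpan a τ := by
  have h : multiSpan a ≤ (conjSpan a τ).comap (LinearMap.funLeft ℂ ℂ (conjHom τ)) := by
    rw [multiSpan, Submodule.span_le]
    rintro _ ⟨ζ, rfl⟩
    exact multiMinorSL_translate_mem hτ o ζ
  exact h hF

lemma eq_zero_of_comp_conjHom (hτ : Function.Injective τ) (o : K)
    {F : (K → I → SL (N + 1)) → ℂ} (hF : F ∈ multiSpan a)
    (h : ∀ g, F (conjHom τ g) = 0) (z : K → I → SL (N + 1)) : F z = 0 := by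
  obtain ⟨d, hd⟩ := (Finsupp.mem_span_range_iff_exists_finsupp).1 hF
  have h1 : ∀ z, F z = evalComb d fun ζ => multiMinorSL a (z * ζ) := by
    intro z
    rw [← hd, Finsupp.sum, Finset.sum_apply, evalComb_apply]
    rfl
  have hy := kPoly_multiMinor a (fun _ : K → I → SL (N + 1) => 1) fun ζ => ζ
  simp only [one_mul] at hy
  rw [h1]
  refine LinearMap.mem_ker.1 (hy.mem_of_conjHom hτ o (LinearMap.ker (evalComb d)) (fun g => ?_) z)
  rw [LinearMap.mem_ker, ← h1, h]

lemma mul_conjExt_update_mem {o : K} {Φ : (I → SL (N + 1)) → ℂ} (hΦ : Φ ∈ minorSpan (a o))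
    (c : (I → SL (N + 1)) →₀ ℂ) (w : I → SL (N + 1)) :
    (fun z => Φ (z o) * conjExt a τ c (Function.update z o w)) ∈ multiSpan a := by
  refine Submodule.span_induction (p := fun Φ _ => (fun z : K → I → SL (N + 1) => Φ (z o) *
    conjExt a τ c (Function.update z o w)) ∈ multiSpan a) ?_ ?_ ?_ ?_ hΦ
  · rintro _ ⟨h', rfl⟩
    have h1 : (fun z : K → I → SL (N + 1) => minorProd (a o) (z o * h') * conjExt a τ c
        (Function.update z o w)) = ∑ h ∈ c.support,
        (c h * minorProd (a o) (w * conjHom τ h o)) •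
          fun z => multiMinorSL a (z * Function.update (conjHom τ h) o h') := by
      funext z
      rw [Finset.sum_apply, conjExt, Finset.mul_sum]
      refine Finset.sum_congr rfl fun h _ => ?_
      rw [Pi.smul_apply, smul_eq_mul, multiMinorSL_eq_mul a o, multiMinorSL_eq_mul a o,
        Pi.mul_apply, Pi.mul_apply, Function.update_self, Function.update_self]
      have h2 : ∏ κ ∈ Finset.univ.erase o, minorProd (a κ)
          ((Function.update z o w * conjHom τ h) κ) =
          ∏ κ ∈ Finset.univ.erase o, minorProd (a κ)
          ((z * Function.update (conjHom τ h) o h') κ) := by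
        refine Finset.prod_congr rfl fun κ hκ => ?_
        rw [Pi.mul_apply, Pi.mul_apply, Function.update_of_ne (Finset.ne_of_mem_erase hκ),
          Function.update_of_ne (Finset.ne_of_mem_erase hκ)]
      rw [h2]
      ring
    change (fun z : K → I → SL (N + 1) => minorProd (a o) (z o * h') * conjExt a τ c
        (Function.update z o w)) ∈ _
    rw [h1]
    exact sum_mem fun h _ => Submodule.smul_mem _ _ (Submodule.subset_span ⟨_, rfl⟩)
  · simp only [Pi.zero_apply, zero_mul]
    exact zero_mem _
  · intro Φ Φ' _ _ h h'
    simp only [Pi.add_apply, add_mul]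
    exact add_mem h h'
  · intro x Φ _ h
    simp only [Pi.smul_apply, smul_eq_mul, mul_assoc]
    exact Submodule.smul_mem _ x h

lemma mul_conjExt_update_ne_zero (hτ : Function.Injective τ) {o : K} (ho : τ o = RingHom.id ℂ)
    {Φ : (I → SL (N + 1)) → ℂ} (hΦ : Φ ∈ minorSpan (a o)) (hΦ0 : Φ ≠ 0)
    (c : (I → SL (N + 1)) →₀ ℂ) {w : K → I → SL (N + 1)} (hw : conjExt a τ c w ≠ 0) :
    (fun g => Φ g * conjExt a τ c (Function.update (conjHom τ g) o (w o))) ≠ 0 := by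
  intro h0
  obtain ⟨g, hg⟩ := Function.ne_iff.1 hΦ0
  have h1 := eq_zero_of_comp_conjHom hτ o (mul_conjExt_update_mem (τ := τ) hΦ c (w o))
    (fun g => by rw [conjHom_apply_id ho]; exact congrFun h0 g) (Function.update w o g)
  rw [Function.update_self, Function.update_idem, Function.update_eq_self] at h1
  exact mul_ne_zero hg hw h1

theorem conjSpan_interpolate (hτ : Function.Injective τ) {o : K} (ho : τ o = RingHom.id ℂ)
    {ν γ : Fin (N + 1) → ℤ} {k l : ℕ} (hk : 0 < k) (hl : l ≤ k) (hγ : ∑ p, γ p = 0)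
    (hd0 : SLDominant ν) (hdk : SLDominant fun p => ν p + k * γ p)
    (h0 : ∃ Φ ∈ conjSpan a τ, Φ ≠ 0 ∧ IsRightHW ν Φ)
    (h1 : ∃ Φ ∈ conjSpan a τ, Φ ≠ 0 ∧ IsRightHW (fun p => ν p + k * γ p) Φ) :
    ∃ Φ ∈ conjSpan a τ, Φ ≠ 0 ∧ IsRightHW (fun p => ν p + l * γ p) Φ := by
  obtain ⟨Φ₀, hm, hne, hw⟩ := h0
  obtain ⟨Φ₁, hm1, hne1, hw1⟩ := h1
  obtain ⟨Φ, hm2, hne2, hw2⟩ := HasHWFun.interpolate hk hl hγ hd0 hdk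
    (exists_hasHWFun_of_conjSpan hτ ho hd0 hm hne hw)
    (exists_hasHWFun_of_conjSpan hτ ho hdk hm1 hne1 hw1)
  obtain ⟨c, hc⟩ := exists_conjExt_eq hm
  obtain ⟨g₀, hg₀⟩ := Function.ne_iff.1 hne
  have hw' : IsRightHW ν fun g => conjExt a τ c (conjHom τ g) := by rwa [funext hc]
  have hmem := comp_conjHom_mem hτ o (mul_conjExt_update_mem (τ := τ) hm2 c (conjHom τ g₀ o))
  simp only [conjHom_apply_id ho] at hmem
  refine ⟨fun g => Φ g * conjExt a τ c (Function.update (conjHom τ g) o (conjHom τ g₀ o)),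
    by simpa only [conjHom_apply_id ho] using hmem,
    mul_conjExt_update_ne_zero hτ ho hm2 hne2 c (by rwa [hc]), fun g u hu => ?_, fun g t ht => ?_⟩
  · change Φ (fun i => g i * u) * _ = _
    rw [hw2.1 g u hu, update_conjHom_mul_constFamily, conjExt_mul_upper hτ o hw']
    intro κ
    by_cases hκ : κ = o
    · subst hκ
      rw [Function.update_self]
      exact one_mem _
    · rw [Function.update_of_ne hκ]
      exact mem_upperSub_of_uniUpper (map_uniUpper _ hu)
  · change Φ (fun i => g i * t) * _ = _
    rw [hw2.2 g t ht, update_conjHom_mul_constFamily, conjExt_mul_diag hτ ho hd0 hw',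
      Function.update_self]
    · have : ∏ p, (1 : SL (N + 1)).val p p ^ ν p = 1 :=
        Finset.prod_eq_one fun p _ => by
          rw [Matrix.SpecialLinearGroup.coe_one, Matrix.one_apply_eq, one_zpow]
      rw [this, one_mul, mul_assoc]
    · intro κ
      by_cases hκ : κ = o
      · subst hκ
        rw [Function.update_self]
        exact fun i j hij => Matrix.one_apply_ne hij
      · rw [Function.update_of_ne hκ]
        exact map_diag _ ht

end ConjInterpolate

section TensorEval

/-- The linear map sending a pure tensor `⨂ vᵢ` to the function `g ↦ ∏ Ψᵢ vᵢ gᵢ`. -/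
noncomputable def tensorEval {ι X : Type*} [Fintype ι] {V : ι → Type*} [∀ i, AddCommGroup (V i)]
    [∀ i, Module ℂ (V i)] (Ψ : ∀ i, V i →ₗ[ℂ] (X → ℂ)) : (⨂[ℂ] i, V i) →ₗ[ℂ] ((ι → X) → ℂ) :=
  PiTensorProduct.lift (MultilinearMap.pi fun g =>
    (MultilinearMap.mkPiAlgebra ℂ ι ℂ).compLinearMap fun i => LinearMap.proj (g i) ∘ₗ Ψ i)

variable {ι X : Type*} [Fintype ι] {V : ι → Type*} [∀ i, AddCommGroup (V i)]
    [∀ i, Module ℂ (V i)] (Ψ : ∀ i, V i →ₗ[ℂ] (X → ℂ))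

lemma tensorEval_tprod (v : ∀ i, V i) (g : ι → X) :
    tensorEval Ψ (PiTensorProduct.tprod ℂ v) g = ∏ i, Ψ i (v i) (g i) := by
  rw [tensorEval, PiTensorProduct.lift.tprod]
  simp

lemma exists_eq_sum_eval {V : Type*} [AddCommGroup V] [Module ℂ V] [FiniteDimensional ℂ V]
    {Ψ : V →ₗ[ℂ] (X → ℂ)} (hΨ : Function.Injective Ψ) :
    ∃ (F : Finset X) (b : X → V), ∀ v, v = ∑ x ∈ F, Ψ v x • b x := by
  classical
  have htop : Submodule.span ℂ (Set.range fun x => LinearMap.proj x ∘ₗ Ψ) = ⊤ := by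
    refine Submodule.span_eq_top_of_ne_zero fun v hv => ?_
    obtain ⟨x, hx⟩ := Function.ne_iff.1 ((map_ne_zero_iff Ψ hΨ).2 hv)
    exact ⟨_, ⟨x, rfl⟩, hx⟩
  let e := Module.finBasis ℂ V
  have h1 : ∀ k, ∃ d : X →₀ ℂ, (d.sum fun x y => y • (LinearMap.proj x ∘ₗ Ψ)) = e.coord k := by
    intro k
    refine Finsupp.mem_span_range_iff_exists_finsupp.1 ?_
    rw [htop]
    trivial
  choose d hd using h1
  refine ⟨Finset.univ.biUnion fun k => (d k).support, fun x => ∑ k, d k x • e k, fun v => ?_⟩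
  simp only [Finset.smul_sum]
  rw [Finset.sum_comm]
  conv_lhs => rw [← e.sum_repr v]
  refine Finset.sum_congr rfl fun k _ => ?_
  simp only [← mul_smul]
  rw [← Finset.sum_smul]
  congr 1
  rw [← e.coord_apply, ← hd, Finsupp.sum, LinearMap.sum_apply]
  refine (Finset.sum_subset (Finset.subset_biUnion_of_mem (fun k => (d k).support)
    (Finset.mem_univ k)) fun x _ hx => ?_).trans (Finset.sum_congr rfl fun x _ => ?_)
  · rw [Finsupp.notMem_support_iff.1 hx, zero_smul, LinearMap.zero_apply]
  · rw [LinearMap.smul_apply, smul_eq_mul, mul_comm]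
    rfl

lemma tensorEval_injective [∀ i, FiniteDimensional ℂ (V i)] {Ψ : ∀ i, V i →ₗ[ℂ] (X → ℂ)}
    (hΨ : ∀ i, Function.Injective (Ψ i)) : Function.Injective (tensorEval Ψ) := by
  classical
  choose F b hb using fun i => exists_eq_sum_eval (hΨ i)
  have h : ∀ T, T = ∑ x ∈ Fintype.piFinset F, tensorEval Ψ T x •
      PiTensorProduct.tprod ℂ fun i => b i (x i) := by
    intro T
    induction T using PiTensorProduct.induction_on with
    | smul_tprod c v =>
      conv_lhs => rw [funext fun i => hb i (v i), MultilinearMap.map_sum_finset]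
      rw [Finset.smul_sum]
      refine Finset.sum_congr rfl fun x _ => ?_
      rw [MultilinearMap.map_smul_univ, map_smul, Pi.smul_apply, tensorEval_tprod, smul_assoc]
    | add S T hS hT =>
      conv_lhs => rw [hS, hT]
      rw [← Finset.sum_add_distrib]
      refine Finset.sum_congr rfl fun x _ => ?_
      rw [map_add, Pi.add_apply, add_smul]
  intro S T hST
  rw [h S, h T, hST]

lemma tensorEval_piTensorRep {n r : ℕ} {V : Fin r → Type*} [∀ i, AddCommGroup (V i)]
    [∀ i, Module ℂ (V i)] {ρ : ∀ i, Representation ℂ (SL n) (V i)}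
    {Ψ : ∀ i, V i →ₗ[ℂ] (SL n → ℂ)} (hΨ : ∀ i h v g, Ψ i (ρ i h v) g = Ψ i v (g * h))
    (h : SL n) (T : ⨂[ℂ] i, V i) (g : Fin r → SL n) :
    tensorEval Ψ (piTensorRep ρ h T) g = tensorEval Ψ T fun i => g i * h := by
  induction T using PiTensorProduct.induction_on with
  | smul_tprod c v =>
    have h1 : piTensorRep ρ h (PiTensorProduct.tprod ℂ v) =
        PiTensorProduct.tprod ℂ fun i => ρ i h (v i) := PiTensorProduct.map_tprod _ _
    rw [map_smul, h1, map_smul, map_smul, Pi.smul_apply, Pi.smul_apply, tensorEval_tprod,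
      tensorEval_tprod]
    simp only [hΨ]
  | add S T hS hT =>
    rw [map_add, map_add, map_add, Pi.add_apply, Pi.add_apply, hS, hT]

lemma occurs_iff_of_tensorEval {n r : ℕ} {V : Fin r → Type*} [∀ i, AddCommGroup (V i)]
    [∀ i, Module ℂ (V i)] [∀ i, FiniteDimensional ℂ (V i)]
    {ρ : ∀ i, Representation ℂ (SL n) (V i)} {Ψ : ∀ i, V i →ₗ[ℂ] (SL n → ℂ)}
    (hinj : ∀ i, Function.Injective (Ψ i)) (hΨ : ∀ i h v g, Ψ i (ρ i h v) g = Ψ i v (g * h))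
    (ν : Fin n → ℤ) : Occurs (piTensorRep ρ) ν ↔
      ∃ Φ ∈ LinearMap.range (tensorEval Ψ), Φ ≠ 0 ∧ IsRightHW ν Φ := by
  have hinj' := tensorEval_injective hinj
  constructor
  · rintro ⟨T, hT0, hTu, hTt⟩
    refine ⟨_, ⟨T, rfl⟩, (map_ne_zero_iff _ hinj').2 hT0, fun g u hu => ?_, fun g t ht => ?_⟩
    · rw [← tensorEval_piTensorRep hΨ, hTu u hu]
    · rw [← tensorEval_piTensorRep hΨ, hTt t ht, map_smul, Pi.smul_apply, smul_eq_mul]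
  · rintro ⟨_, ⟨T, rfl⟩, hT0, hTu, hTt⟩
    refine ⟨T, (map_ne_zero_iff _ hinj').1 hT0, fun u hu => hinj' (funext fun g => ?_),
      fun t ht => hinj' (funext fun g => ?_)⟩
    · rw [tensorEval_piTensorRep hΨ, hTu g u hu]
    · rw [tensorEval_piTensorRep hΨ, hTt g t ht, map_smul, Pi.smul_apply, smul_eq_mul]

lemma range_tensorEval {n r : ℕ} {V : Fin r → Type*} [∀ i, AddCommGroup (V i)]
    [∀ i, Module ℂ (V i)] {Ψ : ∀ i, V i →ₗ[ℂ] (SL n → ℂ)} {f : Fin r → SL n → ℂ}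
    (hΨ : ∀ i, LinearMap.range (Ψ i) = Submodule.span ℂ (Set.range fun h g => f i (g * h))) :
    LinearMap.range (tensorEval Ψ) =
      Submodule.span ℂ (Set.range fun (h g : Fin r → SL n) => ∏ i, f i (g i * h i)) := by
  classical
  apply le_antisymm
  · rintro _ ⟨T, rfl⟩
    induction T using PiTensorProduct.induction_on with
    | smul_tprod x v =>
      rw [map_smul]
      refine Submodule.smul_mem _ _ ?_
      have h1 : ∀ i, ∃ c : SL n →₀ ℂ, (c.sum fun h y => y • fun g => f i (g * h)) = Ψ i (v i) :=
        fun i => Finsupp.mem_span_range_iff_exists_finsupp.1 (hΨ i ▸ ⟨v i, rfl⟩)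
      choose c hc using h1
      have h2 : tensorEval Ψ (PiTensorProduct.tprod ℂ v) =
          ∑ h ∈ Fintype.piFinset fun i => (c i).support, (∏ i, c i (h i)) •
            fun g => ∏ i, f i (g i * h i) := by
        funext g
        rw [tensorEval_tprod]
        have h3 : ∀ i, Ψ i (v i) (g i) = ∑ h ∈ (c i).support, c i h * f i (g i * h) := by
          intro i
          rw [← hc, Finsupp.sum, Finset.sum_apply]
          rfl
        simp only [h3]
        rw [Finset.prod_univ_sum, Finset.sum_apply]
        refine Finset.sum_congr rfl fun h _ => ?_
        rw [Pi.smul_apply, smul_eq_mul, Finset.prod_mul_distrib]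
      rw [h2]
      exact sum_mem fun h _ => Submodule.smul_mem _ _ (Submodule.subset_span ⟨h, rfl⟩)
    | add S T hS hT =>
      rw [map_add]
      exact add_mem hS hT
  · rw [Submodule.span_le]
    rintro _ ⟨h, rfl⟩
    have h1 : ∀ i, ∃ v, Ψ i v = fun g => f i (g * h i) := fun i => by
      have : (fun g => f i (g * h i)) ∈ LinearMap.range (Ψ i) := by
        rw [hΨ]
        exact Submodule.subset_span ⟨h i, rfl⟩
      exact this
    choose v hv using h1
    refine ⟨PiTensorProduct.tprod ℂ v, funext fun g => ?_⟩
    rw [tensorEval_tprod]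
    simp only [hv]

end TensorEval

section Wiring
variable {r n : ℕ}

lemma leadingMinor_map (σ : ℂ →+* ℂ) (j : Fin n) (g : SL n) :
    leadingMinor j (Matrix.SpecialLinearGroup.map σ g).val = σ (leadingMinor j g.val) :=
  (RingHom.map_det σ _).symm

lemma prod_charProd_eq (L : Fin r → Fin n → Multiset (ℂ →+* ℂ)) {S : Finset (ℂ →+* ℂ)}
    (hS : ∀ i j, ∀ σ ∈ L i j, σ ∈ S) [DecidableEq (ℂ →+* ℂ)] (g : Fin r → SL n) :
    ∏ i, charProd (L i) (g i) = multiMinorSL (fun (κ : S) i j => (L i j).count κ.1)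
      (conjHom (fun κ : S => κ.1) g) := by
  have h1 : ∀ i j, ((L i j).map fun σ => σ (leadingMinor j (g i).val)).prod =
      ∏ κ : S, leadingMinor j (conjHom (fun κ : S => κ.1) g κ i).val ^ (L i j).count κ.1 := by
    intro i j
    rw [Finset.prod_multiset_map_count, Finset.prod_subset (s₂ := S), ← Finset.prod_coe_sort]
    · refine Finset.prod_congr rfl fun κ _ => ?_
      exact congrArg (fun x : ℂ => x ^ (L i j).count κ.1) (leadingMinor_map _ _ _).symm
    · exact fun σ hσ => hS i j σ (Multiset.mem_toFinset.1 hσ)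
    · intro σ _ hσ
      rw [Multiset.mem_toFinset] at hσ
      rw [Multiset.count_eq_zero_of_notMem hσ, pow_zero]
  simp only [charProd, h1]
  exact (Finset.prod_congr rfl fun i _ => Finset.prod_comm).trans Finset.prod_comm

end Wiring

theorem convexity_tensor_SL_succ (N r : ℕ)
    (V : Fin r → Type*) [∀ i, AddCommGroup (V i)] [∀ i, Module ℂ (V i)]
    [∀ i, FiniteDimensional ℂ (V i)]
    (ρ : ∀ i, Representation ℂ (SL (N + 1)) (V i)) (hirr : ∀ i, RepIsIrreducible (ρ i))
    (k : ℕ) (hk : 0 < k) (ν γ : Fin (N + 1) → ℤ) (hγ : ∑ j, γ j = 0)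
    (hν : SLDominant ν) (hνk : SLDominant (ν + k • γ))
    (h0 : Occurs (piTensorRep ρ) ν) (hkocc : Occurs (piTensorRep ρ) (ν + k • γ))
    (l : ℕ) (hl : l ≤ k) : Occurs (piTensorRep ρ) (ν + l • γ) := by
  classical
  choose L Ψ hinj heq hrange using fun i => (hirr i).exists_charProd_model
  let S : Finset (ℂ →+* ℂ) := insert (RingHom.id ℂ)
    (Finset.univ.biUnion fun i => Finset.univ.biUnion fun j => (L i j).toFinset)
  have hS : ∀ i j, ∀ σ ∈ L i j, σ ∈ S := fun i j σ hσ =>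
    Finset.mem_insert_of_mem (Finset.mem_biUnion.2 ⟨i, Finset.mem_univ _,
      Finset.mem_biUnion.2 ⟨j, Finset.mem_univ _, Multiset.mem_toFinset.2 hσ⟩⟩)
  let a : S → Fin r → Fin (N + 1) → ℕ := fun κ i j => (L i j).count κ.1
  let τ : S → ℂ →+* ℂ := Subtype.val
  let o : S := ⟨RingHom.id ℂ, Finset.mem_insert_self _ _⟩
  have hspan : LinearMap.range (tensorEval Ψ) = conjSpan a τ := by
    rw [range_tensorEval hrange, conjSpan]
    congr 2
    funext h g
    exact prod_charProd_eq L hS (g * h)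
  have hocc := occurs_iff_of_tensorEval hinj heq
  rw [hspan] at hocc
  have hw : ∀ m : ℕ, ν + m • γ = fun p => ν p + m * γ p := fun m => by
    funext p
    simp
  rw [hw] at hνk hkocc ⊢
  rw [hocc] at h0 hkocc ⊢
  exact conjSpan_interpolate (τ := τ) Subtype.val_injective (o := o) rfl hk hl hγ hν hνk h0 hkocc

theorem convexity_tensor_SL (n r : ℕ)
    (V : Fin r → Type*) [∀ i, AddCommGroup (V i)] [∀ i, Module ℂ (V i)]
    [∀ i, FiniteDimensional ℂ (V i)]
    (ρ : ∀ i, Representation ℂ (SL n) (V i)) (hirr : ∀ i, RepIsIrreducible (ρ i))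
    (k : ℕ) (hk : 0 < k) (ν γ : Fin n → ℤ)
    (hγ : ∑ j, γ j = 0)  -- γ lies in the root lattice
    (hν : SLDominant ν) (hνk : SLDominant (ν + k • γ))
    (h0 : Occurs (piTensorRep ρ) ν) (hkocc : Occurs (piTensorRep ρ) (ν + k • γ)) :
    ∀ l : ℕ, l ≤ k → Occurs (piTensorRep ρ) (ν + l • γ) := by
  intro l hl
  cases n with
  | zero =>
    rw [Subsingleton.elim (ν + l • γ) ν]
    exact h0
  | succ N => exact convexity_tensor_SL_succ N r V ρ hirr k hk ν γ hγ hν hνk h0 hkocc l hl
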